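/- Recursion Theorem for infinite time Turing machines: let f : ℕ → ℕ be infinite time computable in the sense that there is a program q such that for every n ∈ ℕ, φ_q applied to (the real coding) n halts with output (the real coding) f(n). Then there is a program p such that φ_p = φ_{f(p)}: for every x ∈ 2^ℕ, the computation of p on x halts if and only if the computation of f(p) on x halts, and in that case the outputs agree. -/

import Mathlib

open scoped Classical

namespace ITTM

/-- A real is an element of Cantor space. -/
abbrev R := ℕ → Bool

/-- The constant-zero real. -/
def zeroR : R := fun _ => false

/-- The real ⟨1,0,0,...⟩ coding the answer "Yes". -/
def oneR : R := fun n => decide (n = 0)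

/-- The real coding a natural number `p`: `p` ones followed by zeros. -/
def natR (p : ℕ) : R := fun n => decide (n < p)

/-- The real coding the pair of reals `(y, z)`. -/
def pairR (y z : R) : R := fun n => if n % 2 = 0 then y (n / 2) else z (n / 2)

/-- A snapshot of an infinite time Turing machine computation with state set
`Fin (Q+1)`: the current state, the head position, and the contents of the
three tapes (tape 0 is the input tape, tape 1 the scratch tape, tape 2 the
output tape); cells hold values in `Bool` (`true` = 1, `false` = 0). -/
structure Snapshot (Q : ℕ) where
  state : Fin (Q + 1)
  head : ℕ
  tape : Fin 3 → ℕ → Bool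

/-- An infinite time Turing machine program: a finite set of states
`Fin (Q+1)` with distinguished start, limit and halt states, and a finite
transition table which, given the current state and the three cell values
read by the head, specifies the next state, the three values to write, and
the direction to move (`true` = right, `false` = left). -/
structure Machine where
  Q : ℕ
  start : Fin (Q + 1)
  limit : Fin (Q + 1)
  halt : Fin (Q + 1)
  trans : Fin (Q + 1) × (Fin 3 → Bool) → Fin (Q + 1) × (Fin 3 → Bool) × Bool

instance : Inhabited Machine := ⟨⟨0, 0, 0, 0, fun _ => (0, fun _ => false, true)⟩⟩

namespace Machine

/-- The initial snapshot on input `x`: head on cell 0 in the start state, `x`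
on the input tape, the other tapes filled with zeros. -/
def init (M : Machine) (x : R) : Snapshot M.Q where
  state := M.start
  head := 0
  tape := fun i n => if i = 0 then x n else false

/-- One step of computation applied to a snapshot. -/
def stepSnap (M : Machine) (s : Snapshot M.Q) : Snapshot M.Q :=
  let t := M.trans (s.state, fun i => s.tape i s.head)
  { state := t.1
    head := if t.2.2 then s.head + 1 else s.head - 1
    tape := fun i n => if n = s.head then t.2.1 i else s.tape i n }

/-- The snapshot of the computation of machine `M` on input `x` at ordinal
stage `α`, defined by transfinite recursion: at stage 0 the initial snapshot,
at successor stages the transition table is applied, and at limit stages the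
head is on cell 0 in the limit state and each cell holds the `limsup` of its
earlier values (1 iff its value was 1 cofinally often below the limit). -/
noncomputable def snap (M : Machine) (x : R) : Ordinal.{0} → Snapshot M.Q :=
  WellFounded.fix Ordinal.lt_wf fun α ih =>
    if _h0 : α = 0 then M.init x
    else if hs : ∃ β, β < α ∧ α = β + 1 then
      M.stepSnap (ih hs.choose hs.choose_spec.1)
    else
      { state := M.limit
        head := 0
        tape := fun i n =>
          decide (∀ β < α, ∃ γ, β ≤ γ ∧ ∃ hγ : γ < α, (ih γ hγ).tape i n = true) }

/-- The machine is in the halt state at stage `α`. -/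
def haltedAt (M : Machine) (x : R) (α : Ordinal) : Prop :=
  (M.snap x α).state = M.halt

/-- The computation of `M` on input `x` halts exactly at stage `α`: stage `α`
is the first stage at which the machine is in the halt state. -/
def haltsAt (M : Machine) (x : R) (α : Ordinal) : Prop :=
  M.haltedAt x α ∧ ∀ β < α, ¬ M.haltedAt x β

/-- The computation of `M` on input `x` halts. -/
def halts (M : Machine) (x : R) : Prop := ∃ α, M.haltedAt x α

/-- The computation of `M` on input `x` halts with output `y`: at the first
stage at which the machine is in the halt state, the output tape reads `y`. -/
def outputs (M : Machine) (x y : R) : Prop :=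
  ∃ α, M.haltsAt x α ∧ (M.snap x α).tape 2 = y

end Machine

/-- Machines are coded by natural numbers. -/
noncomputable instance : Encodable Machine :=
  Encodable.ofEquiv
    (Σ Q : ℕ, (Fin (Q + 1) × Fin (Q + 1) × Fin (Q + 1)) ×
      ((Fin (Q + 1) × (Fin 3 → Bool)) → Fin (Q + 1) × (Fin 3 → Bool) × Bool))
    { toFun := fun M => ⟨M.Q, (M.start, M.limit, M.halt), M.trans⟩
      invFun := fun s => ⟨s.1, s.2.1.1, s.2.1.2.1, s.2.1.2.2, s.2.2⟩
      left_inv := fun _ => rfl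
      right_inv := fun _ => rfl }

/-- The machine coded by the natural number `p`; every natural number codes a
machine, and every machine is coded by some natural number. -/
noncomputable def prog (p : ℕ) : Machine :=
  ((Encodable.decode p : Option Machine)).getD default

/-- `φ_p(x)` halts with output `y`. -/
noncomputable def phiOutputs (p : ℕ) (x y : R) : Prop := (prog p).outputs x y

/-- A set of reals is infinite time decidable when some machine, on any input
`x`, halts with output ⟨1,0,0,...⟩ if `x ∈ A` and output ⟨0,0,0,...⟩ if
`x ∉ A`. -/
def ITTMDecidable (A : Set R) : Prop :=
  ∃ M : Machine, ∀ x : R, (x ∈ A → M.outputs x oneR) ∧ (x ∉ A → M.outputs x zeroR)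

/-- A set of reals is infinite time semi-decidable when it is the halting set
of some machine. -/
def ITTMSemiDecidable (A : Set R) : Prop :=
  ∃ M : Machine, A = {x : R | M.halts x}

/-- The binary relation on ℕ coded by the real `x`:
`n ◁ k ⟺ x(⟨n,k⟩) = 1` where `⟨·,·⟩` is the pairing function. -/
def rel (x : R) (n k : ℕ) : Prop := x (Nat.pair n k) = true

/-- The field of the relation coded by `x`. -/
def field (x : R) : Set ℕ := {n | ∃ k, rel x n k ∨ rel x k n}

/-- The relation coded by `x`, restricted to its field. -/
def relOn (x : R) : field x → field x → Prop := fun a b => rel x a.1 b.1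

/-- The real `x` codes a well-order of (a subset of) ℕ, namely its field. -/
def codesWellOrder (x : R) : Prop := IsWellOrder (field x) (relOn x)

/-- The set of reals coding well-orders. -/
def WO : Set R := {x | codesWellOrder x}

/-- The real `x` codes a well-order of order type `α`. -/
def codesOrdinal (x : R) (α : Ordinal) : Prop :=
  ∃ h : codesWellOrder x, @Ordinal.type _ (relOn x) h = α

/-- An ordinal is clockable when some machine on input 0 halts exactly at
stage `α`. -/
def Clockable (α : Ordinal) : Prop := ∃ M : Machine, M.haltsAt zeroR α

/-- A real is writable when it is the output of some machine on input 0. -/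
def WritableReal (x : R) : Prop := ∃ M : Machine, M.outputs zeroR x

/-- An ordinal is writable when some writable real codes a well-order of that
order type. -/
def WritableOrdinal (α : Ordinal) : Prop :=
  ∃ x : R, WritableReal x ∧ codesOrdinal x α

/-- A real is eventually writable when some machine on input 0 never halts,
but from some stage onward the content of its output tape is exactly `x`. -/
def EventuallyWritableReal (x : R) : Prop :=
  ∃ M : Machine, ¬ M.halts zeroR ∧ ∃ α : Ordinal, ∀ β ≥ α, (M.snap zeroR β).tape 2 = x

/-- An ordinal is eventually writable when some eventually writable real codes
a well-order of that order type. -/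
def EventuallyWritableOrdinal (α : Ordinal) : Prop :=
  ∃ x : R, EventuallyWritableReal x ∧ codesOrdinal x α

end ITTM

namespace ITTM

open Function (update)

/-- The contents of the three tapes. -/
abbrev Tapes := Fin 3 → ℕ → Bool

/-! ### Computations stage by stage -/

namespace Machine

variable (M : Machine) (x : R)

theorem snap_eq (α : Ordinal.{0}) : M.snap x α =
    if _h0 : α = 0 then M.init x
    else if hs : ∃ β, β < α ∧ α = β + 1 then M.stepSnap (M.snap x hs.choose)
    else
      { state := M.limit
        head := 0
        tape := fun i n =>
          decide (∀ β < α, ∃ γ, β ≤ γ ∧ ∃ _ : γ < α, (M.snap x γ).tape i n = true) } := by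
  rw [snap, WellFounded.fix_eq]

theorem snap_zero : M.snap x 0 = M.init x := by
  rw [snap_eq]; simp

theorem snap_succ (α : Ordinal.{0}) : M.snap x (α + 1) = M.stepSnap (M.snap x α) := by
  have h : ∃ β, β < α + 1 ∧ α + 1 = β + 1 := ⟨α, Order.lt_add_one_iff.2 le_rfl, rfl⟩
  have h0 : α + 1 ≠ 0 := by simp
  rw [snap_eq, dif_neg h0, dif_pos h]
  congr 2
  exact (Order.succ_injective (by simpa using h.choose_spec.2)).symm

theorem snap_limit {α : Ordinal.{0}} (hα : Order.IsSuccLimit α) : M.snap x α =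
    { state := M.limit
      head := 0
      tape := fun i n =>
        decide (∀ β < α, ∃ γ, β ≤ γ ∧ γ < α ∧ (M.snap x γ).tape i n = true) } := by
  have h : ¬ ∃ β, β < α ∧ α = β + 1 := by
    rintro ⟨β, hβ, rfl⟩
    exact hα.succ_ne β (by simp)
  have h0 : α ≠ 0 := hα.ne_bot
  rw [snap_eq, dif_neg h0, dif_neg h]
  simp only [exists_prop]

/-- One step from a snapshot that is not halted and whose tapes satisfy `I`. -/
def Step (I : Tapes → Prop) (S S' : Snapshot M.Q) : Prop :=
  S.state ≠ M.halt ∧ I S.tape ∧ S' = M.stepSnap S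

/-- Finitely many steps, at least one, along which `I` holds. -/
abbrev Run (I : Tapes → Prop) : Snapshot M.Q → Snapshot M.Q → Prop :=
  Relation.TransGen (M.Step I)

variable {M x}

theorem Run.mono {I J : Tapes → Prop} (h : ∀ T, I T → J T) {S S' : Snapshot M.Q}
    (hr : M.Run I S S') : M.Run J S S' :=
  Relation.TransGen.mono (fun _ _ hs => ⟨hs.1, h _ hs.2.1, hs.2.2⟩) _ _ hr

theorem Run.stage {I : Tapes → Prop} {S S' : Snapshot M.Q} (hr : M.Run I S S')
    {γ : Ordinal.{0}} (hγ : M.snap x γ = S) :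
    ∃ n : ℕ, 0 < n ∧ M.snap x (γ + n) = S' ∧
      ∀ k < n, (M.snap x (γ + k)).state ≠ M.halt ∧ I (M.snap x (γ + k)).tape := by
  induction hr with
  | single h =>
    refine ⟨1, one_pos, ?_, ?_⟩
    · rw [Nat.cast_one, snap_succ, hγ, h.2.2]
    · intro k hk
      obtain rfl : k = 0 := by omega
      simpa [hγ] using ⟨h.1, h.2.1⟩
  | tail _ h ih =>
    obtain ⟨n, hn, hs, hI⟩ := ih
    refine ⟨n + 1, by omega, ?_, ?_⟩
    · rw [Nat.cast_add, Nat.cast_one, ← add_assoc, snap_succ, hs, h.2.2]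
    · intro k hk
      rcases Nat.lt_succ_iff_lt_or_eq.1 hk with hk | rfl
      · exact hI k hk
      · rw [hs]; exact ⟨h.1, h.2.1⟩

end Machine

theorem exists_nat_of_lt_add {γ ξ : Ordinal.{0}} {n : ℕ} (h1 : γ ≤ ξ) (h2 : ξ < γ + n) :
    ∃ k < n, ξ = γ + k := by
  obtain ⟨δ, rfl⟩ := exists_add_of_le h1
  have hδ : δ < n := by simpa using h2
  obtain ⟨k, rfl⟩ := Ordinal.lt_omega0.1 (hδ.trans (Ordinal.natCast_lt_omega0 n))
  exact ⟨k, by exact_mod_cast hδ, rfl⟩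

/-! ### Program fragments -/

/-- A program fragment: a transition table in which a missing next state means leaving the
fragment. -/
structure Frag where
  σ : Type
  fin : Fintype σ
  entry : σ
  tr : σ → (Fin 3 → Bool) → Option σ × (Fin 3 → Bool) × Bool

/-- The fragment `F` is realised inside `M` through `ι`, with exit state `e`. -/
def Emb (M : Machine) (F : Frag) (ι : F.σ → Fin (M.Q + 1)) (e : Fin (M.Q + 1)) : Prop :=
  ∀ s b, ι s ≠ M.halt ∧ M.trans (ι s, b) = ((F.tr s b).1.elim e ι, (F.tr s b).2)

/-- In every realisation, the fragment `P` leads from head position and tapes `c` to `d`,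
leaving `P`, with `I` true of the tapes along the way. -/
def Exec (I : Tapes → Prop) (P : Frag) (c d : ℕ × Tapes) : Prop :=
  ∀ (M : Machine) (ι : P.σ → Fin (M.Q + 1)) (e : Fin (M.Q + 1)), Emb M P ι e →
    M.Run I ⟨ι P.entry, c.1, c.2⟩ ⟨e, d.1, d.2⟩

/-- Write the bits `b` on the cells scanned at position `h`. -/
def writeAt (T : Tapes) (h : ℕ) (b : Fin 3 → Bool) : Tapes :=
  fun i n => if n = h then b i else T i n

theorem writeAt_self (T : Tapes) (h : ℕ) : writeAt T h (fun i => T i h) = T := by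
  funext i n; unfold writeAt; split_ifs with hn <;> simp [*]

theorem Emb.step {M : Machine} {F : Frag} {ι : F.σ → Fin (M.Q + 1)} {e : Fin (M.Q + 1)}
    (hE : Emb M F ι e) {I : Tapes → Prop} (s : F.σ) (h : ℕ) (T : Tapes) (hI : I T) :
    M.Step I ⟨ι s, h, T⟩
      ⟨(F.tr s fun i => T i h).1.elim e ι,
        if (F.tr s fun i => T i h).2.2 then h + 1 else h - 1,
        writeAt T h (F.tr s fun i => T i h).2.1⟩ := by
  refine ⟨(hE s (fun i => T i h)).1, hI, ?_⟩
  simp [Machine.stepSnap, (hE s _).2]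
  rfl

/-- Rewrite the scanned cells by `f`, then move. -/
def act (f : (Fin 3 → Bool) → (Fin 3 → Bool)) (d : Bool) : Frag where
  σ := Unit
  fin := inferInstance
  entry := ()
  tr _ b := (none, f b, d)

theorem exec_act {I : Tapes → Prop} (f : (Fin 3 → Bool) → (Fin 3 → Bool)) (d : Bool) (h : ℕ)
    (T : Tapes) (hI : I T) :
    Exec I (act f d) (h, T)
      (if d then h + 1 else h - 1, writeAt T h (f fun i => T i h)) :=
  fun _ _ _ hE => .single (hE.step (F := act f d) () h T hI)

/-- Sequential composition. -/
def seq (P Q : Frag) : Frag where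
  σ := P.σ ⊕ Q.σ
  fin := haveI := P.fin; haveI := Q.fin; inferInstance
  entry := .inl P.entry
  tr s b := match s with
    | .inl s => (some ((P.tr s b).1.elim (.inr Q.entry) .inl), (P.tr s b).2)
    | .inr s => ((Q.tr s b).1.map .inr, (Q.tr s b).2)

infixr:60 ";;" => seq

theorem Emb.seq_left {M : Machine} {P Q : Frag} {ι : (seq P Q).σ → Fin (M.Q + 1)}
    {e : Fin (M.Q + 1)} (hE : Emb M (seq P Q) ι e) :
    Emb M P (fun s => ι (.inl s)) (ι (.inr Q.entry)) := by
  intro s b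
  refine ⟨(hE (.inl s) b).1, (hE (.inl s) b).2.trans ?_⟩
  simp only [seq]
  cases (P.tr s b).1 <;> rfl

theorem Emb.seq_right {M : Machine} {P Q : Frag} {ι : (seq P Q).σ → Fin (M.Q + 1)}
    {e : Fin (M.Q + 1)} (hE : Emb M (seq P Q) ι e) :
    Emb M Q (fun s => ι (.inr s)) e := by
  intro s b
  refine ⟨(hE (.inr s) b).1, (hE (.inr s) b).2.trans ?_⟩
  simp only [seq]
  cases (Q.tr s b).1 <;> rfl

theorem Exec.seq {I : Tapes → Prop} {P Q : Frag} {c c' c'' : ℕ × Tapes}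
    (h1 : Exec I P c c') (h2 : Exec I Q c' c'') : Exec I (P ;; Q) c c'' :=
  fun _ _ _ hE => (h1 _ _ _ hE.seq_left).trans (h2 _ _ _ hE.seq_right)

/-- Branch on the scanned cells. -/
def ite (t : (Fin 3 → Bool) → Bool) (P Q : Frag) : Frag where
  σ := Option Bool ⊕ (P.σ ⊕ Q.σ)
  fin := haveI := P.fin; haveI := Q.fin; inferInstance
  entry := .inl none
  tr s b := match s with
    | .inl none => (some (.inl (some (t b))), b, true)
    | .inl (some true) => (some (.inr (.inl P.entry)), b, false)
    | .inl (some false) => (some (.inr (.inr Q.entry)), b, false)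
    | .inr (.inl s) => ((P.tr s b).1.map (.inr ∘ .inl), (P.tr s b).2)
    | .inr (.inr s) => ((Q.tr s b).1.map (.inr ∘ .inr), (Q.tr s b).2)

section ite
variable {M : Machine} {t : (Fin 3 → Bool) → Bool} {P Q : Frag}
  {ι : (ite t P Q).σ → Fin (M.Q + 1)} {e : Fin (M.Q + 1)}

theorem Emb.ite_then (hE : Emb M (ite t P Q) ι e) :
    Emb M P (fun s => ι (.inr (.inl s))) e := by
  intro s b
  refine ⟨(hE (.inr (.inl s)) b).1, (hE (.inr (.inl s)) b).2.trans ?_⟩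
  simp only [ite]
  cases (P.tr s b).1 <;> rfl

theorem Emb.ite_else (hE : Emb M (ite t P Q) ι e) :
    Emb M Q (fun s => ι (.inr (.inr s))) e := by
  intro s b
  refine ⟨(hE (.inr (.inr s)) b).1, (hE (.inr (.inr s)) b).2.trans ?_⟩
  simp only [ite]
  cases (Q.tr s b).1 <;> rfl

theorem Emb.ite_run (hE : Emb M (ite t P Q) ι e) {I : Tapes → Prop} {h : ℕ} {T : Tapes}
    (hI : I T) : M.Run I ⟨ι (.inl none), h, T⟩
      ⟨if t (fun i => T i h) then ι (.inr (.inl P.entry)) else ι (.inr (.inr Q.entry)), h, T⟩ := by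
  have h1 := hE.step (I := I) (.inl none) h T hI
  have h2 := hE.step (I := I) (.inl (some (t fun i => T i h))) (h + 1) T hI
  simp only [ite, Option.elim, if_true, writeAt_self] at h1
  refine .tail (.single h1) ?_
  cases hb : t fun i => T i h <;> rw [hb] at h2 <;>
    simpa [ite, Option.elim, writeAt_self] using h2

end ite

theorem Exec.ite_pos {I : Tapes → Prop} {t : (Fin 3 → Bool) → Bool} {P Q : Frag} {h : ℕ}
    {T : Tapes} {c : ℕ × Tapes} (hI : I T) (ht : t (fun i => T i h) = true)
    (hP : Exec I P (h, T) c) : Exec I (ite t P Q) (h, T) c := by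
  intro M ι e hE
  have := hE.ite_run (h := h) hI
  rw [ht] at this
  exact this.trans (hP _ _ _ hE.ite_then)

theorem Exec.ite_neg {I : Tapes → Prop} {t : (Fin 3 → Bool) → Bool} {P Q : Frag} {h : ℕ}
    {T : Tapes} {c : ℕ × Tapes} (hI : I T) (ht : t (fun i => T i h) = false)
    (hQ : Exec I Q (h, T) c) : Exec I (ite t P Q) (h, T) c := by
  intro M ι e hE
  have := hE.ite_run (h := h) hI
  rw [ht] at this
  exact this.trans (hQ _ _ _ hE.ite_else)

/-- Repeat `P` while the scanned cells pass the test `t`. -/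
def whl (t : (Fin 3 → Bool) → Bool) (P : Frag) : Frag where
  σ := Option Bool ⊕ P.σ
  fin := haveI := P.fin; inferInstance
  entry := .inl none
  tr s b := match s with
    | .inl none => (some (.inl (some (t b))), b, true)
    | .inl (some true) => (some (.inr P.entry), b, false)
    | .inl (some false) => (none, b, false)
    | .inr s => (some ((P.tr s b).1.elim (.inl none) .inr), (P.tr s b).2)

section whl
variable {M : Machine} {t : (Fin 3 → Bool) → Bool} {P : Frag}
  {ι : (whl t P).σ → Fin (M.Q + 1)} {e : Fin (M.Q + 1)}

theorem Emb.whl_body (hE : Emb M (whl t P) ι e) :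
    Emb M P (fun s => ι (.inr s)) (ι (.inl none)) := by
  intro s b
  refine ⟨(hE (.inr s) b).1, (hE (.inr s) b).2.trans ?_⟩
  simp only [whl]
  cases (P.tr s b).1 <;> rfl

theorem Emb.whl_run (hE : Emb M (whl t P) ι e) {I : Tapes → Prop} {h : ℕ} {T : Tapes}
    (hI : I T) : M.Run I ⟨ι (.inl none), h, T⟩
      ⟨if t (fun i => T i h) then ι (.inr P.entry) else e, h, T⟩ := by
  have h1 := hE.step (I := I) (.inl none) h T hI
  have h2 := hE.step (I := I) (.inl (some (t fun i => T i h))) (h + 1) T hI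
  simp only [whl, Option.elim, if_true, writeAt_self] at h1
  refine .tail (.single h1) ?_
  cases hb : t fun i => T i h <;> rw [hb] at h2 <;>
    simpa [whl, Option.elim, writeAt_self] using h2

theorem Emb.whl_iter (hE : Emb M (whl t P) ι e) {I : Tapes → Prop} {h : ℕ} {T : Tapes}
    {c : ℕ × Tapes} (hI : I T) (ht : t (fun i => T i h) = true) (hP : Exec I P (h, T) c) :
    M.Run I ⟨ι (.inl none), h, T⟩ ⟨ι (.inl none), c.1, c.2⟩ := by
  have := hE.whl_run (h := h) hI
  rw [ht] at this
  exact this.trans (hP _ _ _ hE.whl_body)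

theorem Emb.whl_exit (hE : Emb M (whl t P) ι e) {I : Tapes → Prop} {h : ℕ} {T : Tapes}
    (hI : I T) (ht : t (fun i => T i h) = false) :
    M.Run I ⟨ι (.inl none), h, T⟩ ⟨e, h, T⟩ := by
  have := hE.whl_run (h := h) hI
  rwa [ht] at this

end whl

theorem Exec.whl_pos {I : Tapes → Prop} {t : (Fin 3 → Bool) → Bool} {P : Frag} {h : ℕ}
    {T : Tapes} {c c' : ℕ × Tapes} (hI : I T) (ht : t (fun i => T i h) = true)
    (hP : Exec I P (h, T) c) (hW : Exec I (whl t P) c c') : Exec I (whl t P) (h, T) c' :=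
  fun _ _ _ hE => (hE.whl_iter hI ht hP).trans (hW _ _ _ hE)

theorem Exec.whl_neg {I : Tapes → Prop} {t : (Fin 3 → Bool) → Bool} {P : Frag} {h : ℕ}
    {T : Tapes} (hI : I T) (ht : t (fun i => T i h) = false) :
    Exec I (whl t P) (h, T) (h, T) :=
  fun _ _ _ hE => hE.whl_exit hI ht

/-- Move right once. -/
def right : Frag := act id true

/-- Move left once. -/
def left : Frag := act id false

/-- Do nothing. -/
def nop : Frag := right ;; left

/-- Repeat `P` a fixed number of times. -/
def rep (P : Frag) : ℕ → Frag
  | 0 => nop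
  | k + 1 => P ;; rep P k

section moves
variable {I : Tapes → Prop} {T : Tapes} (hI : I T) (h : ℕ)
include hI

theorem exec_right : Exec I right (h, T) (h + 1, T) := by
  have := exec_act id true h T hI
  simpa [writeAt_self, right] using this

theorem exec_left : Exec I left (h + 1, T) (h, T) := by
  have := exec_act id false (h + 1) T hI
  simpa [writeAt_self, left] using this

theorem exec_nop : Exec I nop (h, T) (h, T) := (exec_right hI h).seq (exec_left hI h)

theorem exec_rights (k : ℕ) : Exec I (rep right k) (h, T) (h + k, T) := by
  induction k generalizing h with
  | zero => exact exec_nop hI h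
  | succ k ih =>
    have := (exec_right hI h).seq (ih (h + 1))
    rwa [show h + 1 + k = h + (k + 1) by omega] at this

theorem exec_lefts (k : ℕ) : Exec I (rep left k) (h + k, T) (h, T) := by
  induction k with
  | zero => exact exec_nop hI h
  | succ k ih => exact (exec_left hI (h + k)).seq ih

end moves

/-! ### Registers on the tracks of the scratch tape -/

/-- The tapes `T` in which, for `r ≥ lo`, the cells of the scratch tape that are congruent to `r`
modulo `L` are replaced by the unary representation of `v r`. -/
def put (lo L : ℕ) (T : Tapes) (v : ℕ → ℕ) : Tapes :=
  fun t c => if t = 1 ∧ lo ≤ c % L then decide (c / L < v (c % L)) else T t c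

/-- `T` has a marker on cell `0` of the scratch tape, at the beginning of the blocks of length
`L`, and `I` does not depend on the registers. -/
structure Ctx (I : Tapes → Prop) (lo L : ℕ) (T : Tapes) : Prop where
  pos : 0 < lo
  lt : lo < L
  mark : ∀ n, T 1 (L * n) = decide (n = 0)
  inv : ∀ w, I (put lo L T w)

/-- The fragment `P` changes the contents of the registers from `v` to `v'`. -/
def Does (lo L : ℕ) (P : Frag) (v v' : ℕ → ℕ) : Prop :=
  ∀ I T, Ctx I lo L T → Exec I P (0, put lo L T v) (0, put lo L T v')

section put
variable {lo L : ℕ} {T : Tapes} {v : ℕ → ℕ}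

theorem put_reg {r : ℕ} (h1 : lo ≤ r) (h2 : r < L) (n : ℕ) :
    put lo L T v 1 (L * n + r) = decide (n < v r) := by
  have e1 : (L * n + r) % L = r := by rw [Nat.mul_add_mod, Nat.mod_eq_of_lt h2]
  have e2 : (L * n + r) / L = n := by
    rw [Nat.mul_add_div (by omega), Nat.div_eq_of_lt h2, add_zero]
  simp [put, e1, e2, h1]

theorem put_low {r : ℕ} (h1 : r < lo) (h2 : r < L) (n : ℕ) :
    put lo L T v 1 (L * n + r) = T 1 (L * n + r) := by
  have e1 : (L * n + r) % L = r := by rw [Nat.mul_add_mod, Nat.mod_eq_of_lt h2]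
  simp [put, e1, h1]

theorem put_ne {t : Fin 3} (h : t ≠ 1) (c : ℕ) : put lo L T v t c = T t c := by
  simp [put, h]

/-- Replace the bit on tape `t`. -/
def setBit (t : Fin 3) (b : Bool) (w : Fin 3 → Bool) : Fin 3 → Bool := update w t b

theorem writeAt_setBit (T : Tapes) (t : Fin 3) (h : ℕ) (b : Bool) :
    writeAt T h (setBit t b fun i => T i h) = fun i n => if i = t ∧ n = h then b else T i n := by
  funext i n
  unfold writeAt setBit
  by_cases hn : n = h
  · subst hn
    by_cases hi : i = t
    · subst hi; simp
    · simp [hi]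
  · simp [hn]

theorem put_write {r : ℕ} (h1 : lo ≤ r) (h2 : r < L) {n k : ℕ} {b : Bool}
    (hb : ∀ j, decide (j < k) = if j = n then b else decide (j < v r)) :
    writeAt (put lo L T v) (L * n + r) (setBit 1 b fun i => put lo L T v i (L * n + r)) =
      put lo L T (update v r k) := by
  rw [writeAt_setBit]
  funext t c
  have hc : c = L * n + r ↔ c % L = r ∧ c / L = n := by
    constructor
    · rintro rfl
      rw [Nat.mul_add_mod, Nat.mod_eq_of_lt h2, Nat.mul_add_div (by omega), Nat.div_eq_of_lt h2]
      simp
    · rintro ⟨rfl, rfl⟩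
      exact (Nat.div_add_mod c L).symm
  by_cases ht : t = 1
  · subst ht
    by_cases hr : c % L = r
    · have := hb (c / L)
      simp only [put, hc, hr, h1, true_and, Function.update_self, and_self, if_true]
      simpa using this.symm
    · simp only [put, hc, hr, false_and, and_false, if_false, Function.update_of_ne hr]
  · simp [put, ht]

end put

/-- Test whether the bit scanned on tape `t` is one. -/
def isOne (t : Fin 3) (b : Fin 3 → Bool) : Bool := b t

/-- Test whether the bit scanned on the scratch tape is zero. -/
def isZero (b : Fin 3 → Bool) : Bool := !b 1

/-- Return from the beginning of a block to cell `0`. -/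
def ret (L : ℕ) : Frag := whl isZero (rep left L)

/-- Walk to the first zero of track `r`. -/
def goto (L r : ℕ) : Frag := rep right r ;; whl (isOne 1) (rep right L)

/-- Write `b` on track `r` of tape `t`, starting from offset `r` in some block. -/
def writeRet (L r : ℕ) (t : Fin 3) (b : Bool) : Frag :=
  act (setBit t b) true ;; rep left (r + 1) ;; ret L

/-- Increment register `r`. -/
def inc (L r : ℕ) : Frag := goto L r ;; writeRet L r 1 true

/-- Decrement register `r`, assumed to be positive. -/
def dec (L r : ℕ) : Frag := goto L r ;; rep left L ;; writeRet L r 1 false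

/-- Repeat `P` while register `r` is positive. -/
def whileReg (r : ℕ) (P : Frag) : Frag :=
  rep right r ;; whl (isOne 1) (rep left r ;; P ;; rep right r) ;; rep left r

/-- Execute `P` if register `r` is positive, and `Q` otherwise. -/
def iteReg (r : ℕ) (P Q : Frag) : Frag :=
  rep right r ;; ite (isOne 1) (rep left r ;; P) (rep left r ;; Q)

/-- Copy track `s` of the scratch tape to register `d`, assumed to be zero. -/
def copy (L s d : ℕ) : Frag :=
  rep right s ;;
  whl (isOne 1) (rep left s ;; rep right d ;; act (setBit 1 true) true ;; rep left (d + 1) ;;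
    rep right s ;; rep right L) ;;
  rep left s ;; ret L

section exec
variable {I : Tapes → Prop} {lo L : ℕ} {T : Tapes} (hC : Ctx I lo L T)
include hC

theorem Ctx.put_mark (v : ℕ → ℕ) (n : ℕ) : put lo L T v 1 (L * n) = decide (n = 0) := by
  have := put_low (T := T) (v := v) hC.pos (hC.pos.trans hC.lt) n
  rw [add_zero] at this
  rw [this, hC.mark]

theorem exec_ret (v : ℕ → ℕ) (n : ℕ) :
    Exec I (ret L) (L * n, put lo L T v) (0, put lo L T v) := by
  induction n with
  | zero =>
    refine Exec.whl_neg (hC.inv v) ?_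
    simp only [isZero, hC.put_mark]; simp
  | succ n ih =>
    refine Exec.whl_pos (hC.inv v) ?_ (exec_lefts (hC.inv v) (L * n) L) ih
    simp only [isZero, hC.put_mark]; simp

theorem exec_walk {v : ℕ → ℕ} {s k : ℕ} (hs : ∀ n, put lo L T v 1 (L * n + s) = decide (n < k))
    (d : ℕ) : ∀ n, n + d = k →
    Exec I (whl (isOne 1) (rep right L)) (L * n + s, put lo L T v) (L * k + s, put lo L T v) := by
  induction d with
  | zero =>
    rintro n rfl
    refine Exec.whl_neg (hC.inv v) ?_
    simp [isOne, hs]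
  | succ d ih =>
    rintro n rfl
    refine Exec.whl_pos (hC.inv v) ?_ (exec_rights (hC.inv v) _ L) ?_
    · simp [isOne, hs]
    · have := ih (n + 1) (by omega)
      rwa [show L * (n + 1) + s = L * n + s + L by ring] at this

theorem exec_goto {v : ℕ → ℕ} {s k : ℕ}
    (hs : ∀ n, put lo L T v 1 (L * n + s) = decide (n < k)) :
    Exec I (goto L s) (0, put lo L T v) (L * k + s, put lo L T v) := by
  have h1 := exec_rights (hC.inv v) 0 s
  have h2 := exec_walk hC hs k 0 (by omega)
  rw [Nat.mul_zero] at h2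
  exact h1.seq h2

end exec

theorem exec_writeRet {I : Tapes → Prop} {L lo' r n : ℕ} {t : Fin 3} {b : Bool} {X T' : Tapes} {v' : ℕ → ℕ}
    (hX : I X) (hC' : Ctx I lo' L T')
    (he : (fun i c => if i = t ∧ c = L * n + r then b else X i c) = put lo' L T' v') :
    Exec I (writeRet L r t b) (L * n + r, X) (0, put lo' L T' v') := by
  have h1 := exec_act (setBit t b) true (L * n + r) X hX
  rw [writeAt_setBit, he] at h1
  exact h1.seq ((exec_lefts (hC'.inv v') (L * n) (r + 1)).seq (exec_ret hC' v' n))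

section does
variable {lo L r : ℕ} {v : ℕ → ℕ}

theorem Does.seq {P Q : Frag} {v' v'' : ℕ → ℕ} (h1 : Does lo L P v v') (h2 : Does lo L Q v' v'') :
    Does lo L (P ;; Q) v v'' :=
  fun I T hC => (h1 I T hC).seq (h2 I T hC)

theorem does_nop : Does lo L nop v v := fun _ _ hC => exec_nop (hC.inv v) 0

theorem does_inc (h1 : lo ≤ r) (h2 : r < L) : Does lo L (inc L r) v (update v r (v r + 1)) := by
  intro I T hC
  refine (exec_goto hC (put_reg h1 h2)).seq (exec_writeRet (hC.inv v) hC ?_)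
  rw [← writeAt_setBit]
  refine put_write h1 h2 fun j => ?_
  split_ifs with h
  · simp [h]
  · exact decide_eq_decide.2 (by omega)

theorem does_dec (h1 : lo ≤ r) (h2 : r < L) (hv : 0 < v r) :
    Does lo L (dec L r) v (update v r (v r - 1)) := by
  intro I T hC
  refine (exec_goto hC (put_reg h1 h2)).seq ?_
  obtain ⟨k, hk⟩ : ∃ k, v r = k + 1 := ⟨v r - 1, by omega⟩
  have h3 := exec_lefts (hC.inv v) (L * k + r) L
  rw [show L * k + r + L = L * v r + r by rw [hk]; ring] at h3
  refine h3.seq (exec_writeRet (hC.inv v) hC ?_)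
  rw [← writeAt_setBit]
  refine put_write h1 h2 fun j => ?_
  split_ifs with h
  · simp [h, hk]
  · exact decide_eq_decide.2 (by omega)

theorem exec_iteReg {I : Tapes → Prop} {T : Tapes} {P Q : Frag} {c : ℕ × Tapes}
    (hC : Ctx I lo L T) (h1 : lo ≤ r) (h2 : r < L)
    (hP : 0 < v r → Exec I P (0, put lo L T v) c) (hQ : v r = 0 → Exec I Q (0, put lo L T v) c) :
    Exec I (iteReg r P Q) (0, put lo L T v) c := by
  have hb : put lo L T v 1 r = decide (0 < v r) := by
    simpa using put_reg (T := T) (v := v) h1 h2 0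
  have hl := exec_lefts (hC.inv v) 0 r
  have hr := exec_rights (hC.inv v) 0 r
  rw [zero_add] at hl hr
  rcases Nat.eq_zero_or_pos (v r) with h0 | h0
  · exact hr.seq (Exec.ite_neg (hC.inv v) (by simp [isOne, hb, h0]) (hl.seq (hQ h0)))
  · exact hr.seq (Exec.ite_pos (hC.inv v) (by simp [isOne, hb, h0]) (hl.seq (hP h0)))

theorem exec_whileReg {I : Tapes → Prop} {P : Frag} (h1 : lo ≤ r) (h2 : r < L) (n : ℕ)
    (T : ℕ → Tapes) (w : ℕ → ℕ → ℕ) (hC : ∀ k ≤ n, Ctx I lo L (T k)) (hw : ∀ k < n, 0 < w k r)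
    (hn : w n r = 0)
    (hP : ∀ k < n, Exec I P (0, put lo L (T k) (w k)) (0, put lo L (T (k + 1)) (w (k + 1)))) :
    Exec I (whileReg r P) (0, put lo L (T 0) (w 0)) (0, put lo L (T n) (w n)) := by
  have hb (k) : put lo L (T k) (w k) 1 r = decide (0 < w k r) := by
    simpa using put_reg (T := T k) (v := w k) h1 h2 0
  have hl (k) (hk : k ≤ n) := exec_lefts ((hC k hk).inv (w k)) 0 r
  have hr (k) (hk : k ≤ n) := exec_rights ((hC k hk).inv (w k)) 0 r
  simp only [zero_add] at hl hr
  refine (hr 0 (Nat.zero_le _)).seq (Exec.seq ?_ (hl n le_rfl))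
  suffices ∀ d k, k + d = n → Exec I (whl (isOne 1) (rep left r ;; P ;; rep right r))
      (r, put lo L (T k) (w k)) (r, put lo L (T n) (w n)) from this n 0 (by omega)
  intro d
  induction d with
  | zero =>
    rintro k rfl
    exact Exec.whl_neg ((hC _ le_rfl).inv _) (by
      rw [add_zero] at hn
      simp [isOne, hb, hn])
  | succ d ih =>
    intro k hk
    exact Exec.whl_pos ((hC _ (by omega)).inv _) (by simp [isOne, hb, hw k (by omega)])
      ((hl k (by omega)).seq ((hP k (by omega)).seq (hr (k + 1) (by omega)))) (ih (k + 1) (by omega))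

theorem does_whileReg {P : Frag} (h1 : lo ≤ r) (h2 : r < L) (n : ℕ) (w : ℕ → ℕ → ℕ)
    (hw : ∀ k < n, 0 < w k r) (hn : w n r = 0) (hP : ∀ k < n, Does lo L P (w k) (w (k + 1))) :
    Does lo L (whileReg r P) (w 0) (w n) :=
  fun I T hC => exec_whileReg h1 h2 n (fun _ => T) w (fun _ _ => hC) hw hn
    fun k hk => hP k hk I T hC

/-- Set register `r` to zero. -/
def zero (L r : ℕ) : Frag := whileReg r (dec L r)

theorem does_zero (h1 : lo ≤ r) (h2 : r < L) : Does lo L (zero L r) v (update v r 0) := by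
  have := does_whileReg (P := dec L r) h1 h2 (v r) (fun k => update v r (v r - k))
    (fun k hk => by simp; omega) (by simp) fun k hk => by
      have := does_dec (v := update v r (v r - k)) h1 h2 (by simp; omega)
      simpa [Nat.sub_sub] using this
  simpa [zero] using this

theorem exec_copy {I : Tapes → Prop} {T : Tapes} {s d k : ℕ} (hC : Ctx I lo L T)
    (h1 : lo ≤ d) (h2 : d < L) (hd : v d = 0)
    (hs : ∀ j n, put lo L T (update v d j) 1 (L * n + s) = decide (n < k)) :
    Exec I (copy L s d) (0, put lo L T v) (0, put lo L T (update v d k)) := by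
  have hr := exec_rights (hC.inv v) 0 s
  rw [zero_add] at hr
  refine hr.seq (Exec.seq ?_ ((exec_lefts (hC.inv _) (L * k) s).seq (exec_ret hC _ k)))
  suffices ∀ e n, n + e = k → Exec I (whl (isOne 1) (rep left s ;; rep right d ;;
      act (setBit 1 true) true ;; rep left (d + 1) ;; rep right s ;; rep right L))
      (L * n + s, put lo L T (update v d n)) (L * k + s, put lo L T (update v d k)) by
    have := this k 0 (by omega)
    rwa [Nat.mul_zero, zero_add, ← hd, Function.update_eq_self] at this
  intro e
  induction e with
  | zero =>
    rintro n rfl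
    exact Exec.whl_neg (hC.inv _) (by simp [isOne, hs])
  | succ e ih =>
    rintro n rfl
    refine Exec.whl_pos (hC.inv _) (by simp [isOne, hs]) ?_ (ih (n + 1) (by omega))
    have ha := exec_act (setBit 1 true) true (L * n + d) _ (hC.inv (update v d n))
    rw [put_write h1 h2 (k := n + 1)] at ha
    · rw [Function.update_idem] at ha
      refine (exec_lefts (hC.inv _) (L * n) s).seq ((exec_rights (hC.inv _) (L * n) d).seq
        (ha.seq ((exec_lefts (hC.inv _) (L * n) (d + 1)).seq ((exec_rights (hC.inv _) (L * n) s).seq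
          ?_))))
      have := exec_rights (hC.inv (update v d (n + 1))) (L * n + s) L
      rwa [show L * n + s + L = L * (n + 1) + s by ring] at this
    · intro j
      rw [Function.update_self]
      split_ifs with h
      · simp [h]
      · exact decide_eq_decide.2 (by omega)

theorem does_copy {s d : ℕ} (h1 : lo ≤ d) (h2 : d < L) (hd : v d = 0) (h3 : lo ≤ s) (h4 : s < L)
    (hsd : s ≠ d) : Does lo L (copy L s d) v (update v d (v s)) := by
  intro I T hC
  refine exec_copy hC h1 h2 hd fun j n => ?_
  rw [put_reg h3 h4, Function.update_of_ne hsd]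

end does

/-! ### Primitive recursive functions on registers -/

/-- The fragment `P` adds to register `o` (assumed to be zero) the value of `f` at the registers
`a`, provided that all registers from `b` on are zero. -/
def Computes (lo L : ℕ) {n : ℕ} (f : List.Vector ℕ n → ℕ) (a : Fin n → ℕ) (o b : ℕ) (P : Frag) :
    Prop :=
  ∀ v : ℕ → ℕ, v o = 0 → (∀ r, b ≤ r → v r = 0) →
    Does lo L P v (update v o (f (List.Vector.ofFn fun i => v (a i))))

/-- The function `f` is computed by a fragment that uses at most `c` auxiliary registers. -/
def Comp {n : ℕ} (f : List.Vector ℕ n → ℕ) (c : ℕ) : Prop :=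
  ∀ (lo L : ℕ) (a : Fin n → ℕ) (o b : ℕ), (∀ i, lo ≤ a i ∧ a i < b ∧ a i ≠ o) → lo ≤ o → o < b →
    b + c ≤ L → ∃ P, Computes lo L f a o b P

theorem does_zeros {lo L b : ℕ} (hb : lo ≤ b) (k : ℕ) (hk : b + k ≤ L) :
    ∃ P, ∀ v, Does lo L P v (fun r => if b ≤ r ∧ r < b + k then 0 else v r) := by
  induction k with
  | zero =>
    refine ⟨nop, fun v => ?_⟩
    convert does_nop using 1
    funext r
    rw [if_neg (by omega)]
  | succ k ih =>
    obtain ⟨P, hP⟩ := ih (by omega)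
    refine ⟨P ;; zero L (b + k), fun v => ?_⟩
    convert (hP v).seq (does_zero (r := b + k) (by omega) (by omega)) using 1
    funext r
    by_cases hr : r = b + k
    · subst hr; simp
    · rw [Function.update_of_ne hr]
      exact if_congr (by omega) rfl rfl

theorem Comp.comp {m n : ℕ} {f : List.Vector ℕ n → ℕ} (g : Fin n → List.Vector ℕ m → ℕ)
    {cf : ℕ} {cg : Fin n → ℕ} (hf : Comp f cf) (hg : ∀ i, Comp (g i) (cg i)) :
    Comp (fun a => f (List.Vector.ofFn fun i => g i a)) (n + (cf + ∑ i, cg i)) := by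
  intro lo L a o b ha ho hob hL
  have hcg (i) : cg i ≤ ∑ i, cg i := Finset.single_le_sum (fun _ _ => Nat.zero_le _) (Finset.mem_univ i)
  have hlob : lo ≤ b := by omega
  have key : ∀ k, ∀ hk : k ≤ n, ∃ P, ∀ v : ℕ → ℕ, (∀ r, b ≤ r → v r = 0) → Does lo L P v
      (fun r => if h : b ≤ r ∧ r < b + k then
        g ⟨r - b, by omega⟩ (List.Vector.ofFn fun i => v (a i)) else v r) := by
    intro k
    induction k with
    | zero =>
      refine fun _ => ⟨nop, fun v _ => ?_⟩
      convert does_nop using 1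
      funext r
      rw [dif_neg (by omega)]
    | succ k ih =>
      intro hk
      obtain ⟨P, hP⟩ := ih (by omega)
      obtain ⟨Q, hQ⟩ := hg ⟨k, hk⟩ lo L a (b + k) (b + n)
        (fun i => ⟨(ha i).1, by have := ha i; omega, by have := ha i; omega⟩) (by omega) (by omega)
        (by have := hcg ⟨k, hk⟩; omega)
      refine ⟨P ;; Q, fun v hv => ?_⟩
      convert (hP v hv).seq (hQ _ ?_ ?_) using 1
      · have : (List.Vector.ofFn fun i => if h : b ≤ a i ∧ a i < b + k then
            g ⟨a i - b, by omega⟩ (List.Vector.ofFn fun i => v (a i)) else v (a i)) =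
            List.Vector.ofFn fun i => v (a i) := by
          congr 1; funext i
          rw [dif_neg (by have := ha i; omega)]
        rw [this]
        funext r
        by_cases hr : r = b + k
        · subst hr; simp
        · rw [Function.update_of_ne hr]
          by_cases h : b ≤ r ∧ r < b + k
          · rw [dif_pos h, dif_pos (by omega)]
          · rw [dif_neg h, dif_neg (by omega)]
      · simp [hv]
      · intro r hr
        rw [dif_neg (by omega), hv r (by omega)]
  obtain ⟨P, hP⟩ := key n le_rfl
  obtain ⟨Q, hQ⟩ := hf lo L (fun i => b + i) o (b + n)
    (fun i => ⟨by omega, by omega, by omega⟩) ho (by omega) (by omega)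
  obtain ⟨Z, hZ⟩ := does_zeros (L := L) hlob n (by omega)
  refine ⟨P ;; Q ;; Z, fun v hvo hv => ?_⟩
  convert (hP v hv).seq ((hQ _ ?_ ?_).seq (hZ _)) using 1
  · funext r
    by_cases hr : r = o
    · subst hr
      rw [if_neg (by omega)]; simp
    · rw [Function.update_of_ne hr, Function.update_of_ne hr]
      by_cases h : b ≤ r ∧ r < b + n
      · rw [if_pos h, hv r h.1]
      · rw [if_neg h, dif_neg h]
  · rw [dif_neg (by omega), hvo]
  · intro r hr
    rw [dif_neg (by omega), hv r (by omega)]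

theorem Comp.prec {n : ℕ} {f : List.Vector ℕ n → ℕ} {g : List.Vector ℕ (n + 2) → ℕ} {cf cg : ℕ}
    (hf : Comp f cf) (hg : Comp g cg) :
    Comp (fun v : List.Vector ℕ (n + 1) =>
      v.head.rec (f v.tail) fun y IH => g (y ::ᵥ IH ::ᵥ v.tail)) (3 + (cf + cg)) := by
  intro lo L a o b ha ho hob hL
  obtain ⟨P, hP⟩ := hf lo L (fun i => a i.succ) o (b + 3)
    (fun i => ⟨(ha _).1, by have := ha i.succ; omega, (ha _).2.2⟩) ho (by omega) (by omega)
  obtain ⟨Q, hQ⟩ := hg lo L (Fin.cons b (Fin.cons o fun i => a i.succ)) (b + 2) (b + 3)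
    (by
      intro i
      refine Fin.cases ?_ (fun i => Fin.cases ?_ (fun i => ?_) i) i
      · simp; omega
      · simp; omega
      · have := ha i.succ
        simp; omega) (by omega) (by omega) (by omega)
  refine ⟨copy L (a 0) (b + 1) ;; P ;;
    whileReg (b + 1) (Q ;; zero L o ;; copy L (b + 2) o ;; zero L (b + 2) ;; inc L b ;;
      dec L (b + 1)) ;; zero L b, fun v hvo hv => ?_⟩
  have ha0 := ha 0
  set t : List.Vector ℕ n := List.Vector.ofFn fun i => v (a i.succ) with ht
  set F : ℕ → ℕ := fun k => k.rec (f t) fun y IH => g (y ::ᵥ IH ::ᵥ t) with hF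
  set N := v (a 0) with hN
  let w : ℕ → ℕ → ℕ := fun k => update (update (update v o (F k)) b k) (b + 1) (N - k)
  have h1 : Does lo L (copy L (a 0) (b + 1)) v (update v (b + 1) N) :=
    does_copy (by omega) (by omega) (hv _ (by omega)) (by omega) (by omega) (by omega)
  have h2 : Does lo L P (update v (b + 1) N) (w 0) := by
    convert hP _ ?_ ?_ using 1
    · have : (List.Vector.ofFn fun i : Fin n => update v (b + 1) N (a i.succ)) = t := by
        rw [ht]; congr 1; funext i
        rw [Function.update_of_ne (by have := ha i.succ; omega)]
      rw [this]
      funext r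
      simp only [w, Function.update_apply, hF]
      have := hv b le_rfl
      split_ifs <;> first | omega | simp_all
    · rw [Function.update_of_ne (by omega), hvo]
    · intro r hr
      rw [Function.update_of_ne (by omega), hv r (by omega)]
  have h3 : ∀ k < N, Does lo L (Q ;; zero L o ;; copy L (b + 2) o ;; zero L (b + 2) ;; inc L b ;;
      dec L (b + 1)) (w k) (w (k + 1)) := by
    intro k hk
    have hob1 : o ≠ b := by omega
    have hob2 : o ≠ b + 1 := by omega
    have hob3 : o ≠ b + 2 := by omega
    have hQ' : Does lo L Q (w k) (update (w k) (b + 2) (F (k + 1))) := by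
      convert hQ (w k) ?_ ?_ using 1
      · have : (List.Vector.ofFn fun i : Fin (n + 2) =>
            w k ((Fin.cons b (Fin.cons o fun i => a i.succ) : Fin (n + 2) → ℕ) i)) =
            k ::ᵥ F k ::ᵥ t := by
          rw [List.Vector.ofFn, List.Vector.ofFn]
          simp only [Fin.cons_zero, Fin.cons_succ, ht]
          congr 1
          · simp [w]
          congr 1
          · simp [w, hob1, hob2]
          · congr 1; funext i
            have := ha i.succ
            simp only [w, Function.update_apply]
            split_ifs <;> omega
        rw [this]
      · simp [w, hob3.symm, hv]
      · intro r hr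
        simp only [w, Function.update_apply]
        rw [if_neg (by omega), if_neg (by omega), if_neg (by omega), hv r (by omega)]
    convert hQ'.seq ((does_zero (r := o) ?_ ?_).seq ((does_copy (s := b + 2) (d := o)
      ?_ ?_ ?_ ?_ ?_ ?_).seq ((does_zero (r := b + 2) ?_ ?_).seq ((does_inc (r := b) ?_ ?_).seq
        (does_dec (r := b + 1) ?_ ?_ ?_))))) using 1
    · funext r
      simp only [w, Function.update_apply]
      have := hv (b + 2) (by omega)
      split_ifs <;> first | omega | simp_all
    all_goals first | omega | simp
    simp [w, hob2.symm]
    omega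
  have h4 := does_whileReg (lo := lo) (L := L) (r := b + 1) (by omega) (by omega) N w
    (fun k hk => by simp [w]; omega) (by simp [w]) h3
  convert h1.seq (h2.seq (h4.seq (does_zero (r := b) (by omega) (by omega)))) using 1
  have : (List.Vector.ofFn fun i => v (a i)) = N ::ᵥ t := by
    rw [List.Vector.ofFn]
  simp only [this, List.Vector.head_cons, List.Vector.tail_cons]
  funext r
  simp only [w, Function.update_apply, hF]
  have := hv b le_rfl
  have := hv (b + 1) (by omega)
  split_ifs <;> first | omega | simp_all

theorem exists_comp {n : ℕ} {f : List.Vector ℕ n → ℕ} (hf : Nat.Primrec' f) : ∃ c, Comp f c := by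
  induction hf with
  | zero =>
    refine ⟨0, fun lo L a o b ha ho hob hL => ⟨nop, fun v hvo hv => ?_⟩⟩
    convert does_nop using 1
    exact Function.update_eq_iff.2 ⟨hvo.symm, fun _ _ => rfl⟩
  | succ =>
    refine ⟨0, fun lo L a o b ha ho hob hL => ⟨copy L (a 0) o ;; inc L o, fun v hvo hv => ?_⟩⟩
    have ha0 := ha 0
    convert (does_copy (lo := lo) (L := L) (v := v) (s := a 0) (d := o) ?_ ?_ ?_ ?_ ?_ ?_).seq
      (does_inc ?_ ?_) using 1
    · simp [List.Vector.ofFn]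
    all_goals omega
  | get i =>
    refine ⟨0, fun lo L a o b ha ho hob hL => ⟨copy L (a i) o, fun v hvo hv => ?_⟩⟩
    have ha0 := ha i
    simp only [List.Vector.get_ofFn]
    exact does_copy (by omega) (by omega) hvo (by omega) (by omega) (by omega)
  | comp g _ _ ihf ihg =>
    obtain ⟨cf, hf⟩ := ihf
    choose cg hg using ihg
    exact ⟨_, hf.comp g hg⟩
  | prec _ _ ihf ihg =>
    obtain ⟨cf, hf⟩ := ihf
    obtain ⟨cg, hg⟩ := ihg
    exact ⟨_, hf.prec hg⟩

/-! ### Simulating a computation through limit stages -/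

/-- From stage `γ₀` on, the machine `U` on input `y` simulates `N` on input `x`: the snapshot `σ`
of `N` is represented by the snapshot `rep σ` of `U`, in which each cell satisfying `K` holds a
constant or a bit of the tapes of `σ`, as specified by `enc`. -/
structure Simulation (U N : Machine) (y x : R) (γ₀ : Ordinal.{0}) (K : Fin 3 → ℕ → Prop)
    (enc : Tapes → Tapes) (rep : Snapshot N.Q → Snapshot U.Q) : Prop where
  init : U.snap y γ₀ = rep (N.snap x 0)
  kept : ∀ σ t c, K t c → (rep σ).tape t c = enc σ.tape t c
  flag : ∀ σ, (rep σ).tape 1 1 = true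
  cell : ∀ t c, K t c → (∃ b, ∀ A, enc A t c = b) ∨ ∃ i h, ∀ A, enc A t c = A i h
  step : ∀ σ, σ.state ≠ N.halt → U.Run (fun X => ∀ t c, K t c →
    X t c = enc σ.tape t c ∨ X t c = enc (N.stepSnap σ).tape t c) (rep σ) (rep (N.stepSnap σ))
  limit : ∀ A X δ, U.snap y δ = ⟨U.limit, 0, X⟩ → (∀ t c, K t c → X t c = enc A t c) →
    X 1 1 = true → ∃ γ, δ ≤ γ ∧ U.snap y γ = rep ⟨N.limit, 0, A⟩ ∧
      ∀ ξ, δ ≤ ξ → ξ < γ → (U.snap y ξ).state ≠ U.halt ∧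
        ∀ t c, K t c → (U.snap y ξ).tape t c = enc A t c

namespace Simulation

variable {U N : Machine} {y x : R} {γ₀ : Ordinal.{0}} {K : Fin 3 → ℕ → Prop}
    {enc : Tapes → Tapes} {rep : Snapshot N.Q → Snapshot U.Q}

variable (U N y x K enc rep) in
/-- At stage `γ` of `U` stage `α` of `N` has been simulated, and this took place between
stages `δ` and `γ`. -/
def Reaches (α δ γ : Ordinal.{0}) : Prop :=
  δ ≤ γ ∧ U.snap y γ = rep (N.snap x α) ∧ ∀ ξ, δ ≤ ξ → ξ < γ → (U.snap y ξ).state ≠ U.halt ∧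
    ∀ t c, K t c → ∃ β, β ≤ α ∧ α ≤ β + 1 ∧ (U.snap y ξ).tape t c = enc (N.snap x β).tape t c

variable (U N y x γ₀ K enc rep) in
/-- The stage of `U` at which the simulation of stage `α` of `N` is complete. -/
noncomputable def stage : Ordinal.{0} → Ordinal.{0} :=
  WellFounded.fix Ordinal.lt_wf fun α ih =>
    if h : ∃ γ, Reaches U N y x K enc rep α (max γ₀ (⨆ β : Set.Iio α, ih β.1 β.2 + 1)) γ
    then h.choose else 0

variable (U N y x γ₀ K enc rep) in
/-- The first stage of `U` after the simulation of the stages of `N` before `α`. -/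
noncomputable def base (α : Ordinal.{0}) : Ordinal.{0} :=
  max γ₀ (⨆ β : Set.Iio α, stage U N y x γ₀ K enc rep β.1 + 1)

local notation "G" => stage U N y x γ₀ K enc rep
local notation "D" => base U N y x γ₀ K enc rep
local notation "E" => Reaches U N y x K enc rep

theorem reaches_stage {α γ : Ordinal.{0}} (h : E α (D α) γ) : E α (D α) (G α) := by
  have h' : ∃ γ, E α (D α) γ := ⟨γ, h⟩
  have : G α = h'.choose := by
    rw [stage, WellFounded.fix_eq]
    exact dif_pos h'
  rw [this]
  exact h'.choose_spec

theorem lt_base {α ξ : Ordinal.{0}} : ξ < D α ↔ ξ < γ₀ ∨ ∃ β < α, ξ ≤ G β := by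
  rw [base, lt_max_iff, Ordinal.lt_iSup_iff]
  simp only [Subtype.exists, Set.mem_Iio, Order.lt_add_one_iff, exists_prop]

theorem stage_lt {α β : Ordinal.{0}} (hα : E α (D α) (G α)) (h : β < α) : G β < G α :=
  (lt_base.2 (.inr ⟨β, h, le_rfl⟩)).trans_le hα.1

theorem le_stage {α : Ordinal.{0}} (hα : ∀ β ≤ α, E β (D β) (G β)) : α ≤ G α := by
  induction α using WellFoundedLT.induction with
  | ind α ih =>
    by_contra! hlt
    exact ((ih _ hlt fun β hβ => hα β (hβ.trans hlt.le)).not_gt (stage_lt (hα α le_rfl) hlt))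

theorem cover {α ξ : Ordinal.{0}} (h0 : γ₀ ≤ ξ) (h : ξ < G α) :
    ∃ β ≤ α, (D β ≤ ξ ∧ ξ < G β) ∨ (ξ = G β ∧ β < α) := by
  induction α using WellFoundedLT.induction with
  | ind α ih =>
    rcases le_or_gt (D α) ξ with hD | hD
    · exact ⟨α, le_rfl, .inl ⟨hD, h⟩⟩
    rcases lt_base.1 hD with h' | ⟨β, hβ, hξ⟩
    · exact absurd h' h0.not_gt
    rcases hξ.eq_or_lt with rfl | hξ
    · exact ⟨β, hβ.le, .inr ⟨rfl, hβ⟩⟩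
    · obtain ⟨β', h1, h2 | h2⟩ := ih β hβ hξ
      · exact ⟨β', h1.trans hβ.le, .inl h2⟩
      · exact ⟨β', h1.trans hβ.le, .inr ⟨h2.1, h2.2.trans hβ⟩⟩

theorem cover_kept {α ξ : Ordinal.{0}} (hE : ∀ β < α, E β (D β) (G β)) (h0 : γ₀ ≤ ξ)
    {α₀ α₁ : Ordinal.{0}} (h1 : α₁ < α) (h : ξ < G α₁) (h2 : α₀ < α) (hα₀ : G α₀ ≤ ξ)
    (hkept : ∀ σ t c, K t c → (rep σ).tape t c = enc σ.tape t c) {t : Fin 3} {c : ℕ} (hK : K t c) :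
    ∃ β, α₀ ≤ β ∧ β < α ∧ (U.snap y ξ).tape t c = enc (N.snap x β).tape t c := by
  obtain ⟨α', hle, h3 | h3⟩ := cover h0 h
  · obtain ⟨β, hβ1, hβ2, hβ3⟩ := ((hE α' (hle.trans_lt h1)).2.2 ξ h3.1 h3.2).2 t c hK
    refine ⟨β, ?_, hβ1.trans_lt (hle.trans_lt h1), hβ3⟩
    by_contra! hlt
    have : α' ≤ α₀ := hβ2.trans (Order.add_one_le_iff.2 hlt)
    rcases this.eq_or_lt with rfl | this
    · exact h3.2.not_ge hα₀
    · exact (h3.2.trans (stage_lt (hE α₀ h2) this)).not_ge hα₀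
  · refine ⟨α', ?_, hle.trans_lt h1, ?_⟩
    · by_contra! hlt
      exact (stage_lt (hE α₀ h2) hlt).not_ge (h3.1 ▸ hα₀)
    · rw [h3.1, (hE α' (hle.trans_lt h1)).2.1, hkept _ _ _ hK]

variable (hS : Simulation U N y x γ₀ K enc rep)
include hS

theorem enc_limit {α : Ordinal.{0}} (hα : Order.IsSuccLimit α) {t : Fin 3} {c : ℕ} (hK : K t c) :
    enc (N.snap x α).tape t c =
      decide (∀ β < α, ∃ γ, β ≤ γ ∧ γ < α ∧ enc (N.snap x γ).tape t c = true) := by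
  rcases hS.cell t c hK with ⟨b, hb⟩ | ⟨i, h, hb⟩
  · simp only [hb]
    cases b
    · simpa using ⟨0, hα.bot_lt⟩
    · simpa using fun β hβ => ⟨β, le_rfl, hβ⟩
  · simp only [hb]
    rw [N.snap_limit x hα]

theorem reaches {α : Ordinal.{0}} (h : ∀ β < α, (N.snap x β).state ≠ N.halt) :
    E α (D α) (G α) := by
  induction α using WellFoundedLT.induction with
  | ind α ih =>
    replace ih : ∀ β < α, E β (D β) (G β) := fun β hβ => ih β hβ fun δ hδ => h δ (hδ.trans hβ)
    have h0 : ∀ β < α, γ₀ ≤ G β := fun β hβ => (le_max_left _ _).trans (ih β hβ).1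
    rcases Ordinal.zero_or_succ_or_isSuccLimit α with rfl | ⟨β, rfl⟩ | hα
    · refine reaches_stage (γ := γ₀) ⟨?_, hS.init, fun ξ h1 h2 => ?_⟩
      · refine le_of_forall_lt fun ξ hξ => ?_
        rcases lt_base.1 hξ with h | ⟨β, hβ, -⟩
        · exact h
        · exact absurd hβ (by simp)
      · exact absurd h2 (((le_max_left _ _).trans h1).not_gt)
    · simp only [Order.succ_eq_add_one] at h ih h0 ⊢
      have hβ : β < β + 1 := Order.lt_add_one_iff.2 le_rfl
      have hD : D (β + 1) = G β + 1 := by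
        refine le_antisymm (le_of_forall_lt fun ξ hξ => ?_)
          (Order.add_one_le_iff.2 (lt_base.2 (.inr ⟨β, hβ, le_rfl⟩)))
        rw [Order.lt_add_one_iff]
        rcases lt_base.1 hξ with h | ⟨β', hβ', h'⟩
        · exact h.le.trans (h0 β hβ)
        · rcases (Order.lt_add_one_iff.1 hβ').eq_or_lt with rfl | hlt
          · exact h'
          · exact h'.trans (stage_lt (ih β hβ) hlt).le
      obtain ⟨n, hn, hs, hI⟩ := (hS.step _ (h β hβ)).stage (ih β hβ).2.1
      refine reaches_stage (γ := G β + n) ⟨?_, ?_, fun ξ h1 h2 => ?_⟩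
      · rw [hD]
        gcongr
        exact_mod_cast hn
      · rw [hs, N.snap_succ]
      · obtain ⟨k, hk, rfl⟩ := exists_nat_of_lt_add ((le_self_add).trans (hD ▸ h1)) h2
        refine ⟨(hI k hk).1, fun t c hK => ?_⟩
        rcases (hI k hk).2 t c hK with h | h
        · exact ⟨β, hβ.le, le_rfl, h⟩
        · exact ⟨β + 1, le_rfl, le_self_add, by rw [h, N.snap_succ]⟩
    · have hlt : ∀ ξ < D α, ∃ β < α, ξ < G β := by
        intro ξ hξ
        rcases lt_base.1 hξ with h | ⟨β, hβ, h'⟩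
        · exact ⟨0, hα.bot_lt, h.trans_le (h0 0 hα.bot_lt)⟩
        · have := hα.succ_lt hβ
          exact ⟨_, this, h'.trans_lt (stage_lt (ih _ this) (Order.lt_succ β))⟩
      have hGD : ∀ β < α, G β < D α := fun β hβ => lt_base.2 (.inr ⟨β, hβ, le_rfl⟩)
      have hlim : Order.IsSuccLimit (D α) := by
        rw [Order.isSuccLimit_iff, Order.isSuccPrelimit_iff_succ_lt]
        refine ⟨not_isMin_of_lt (hGD 0 hα.bot_lt), fun ξ hξ => ?_⟩
        obtain ⟨β, hβ, h⟩ := hlt ξ hξ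
        exact (Order.succ_le_of_lt h).trans_lt (hGD β hβ)
      have hsnap := U.snap_limit y hlim
      have hA : N.snap x α = ⟨N.limit, 0, (N.snap x α).tape⟩ := by
        rw [N.snap_limit x hα]
      have hkept : ∀ t c, K t c → (U.snap y (D α)).tape t c = enc (N.snap x α).tape t c := by
        intro t c hK
        rw [hS.enc_limit hα hK, hsnap]
        refine decide_eq_decide.2 ⟨fun H β hβ => ?_, fun H ξ hξ => ?_⟩
        · obtain ⟨ξ, h1, h2, h3⟩ := H _ (hGD β hβ)
          obtain ⟨α₁, h4, h5⟩ := hlt ξ h2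
          obtain ⟨β', h6, h7, h8⟩ := cover_kept ih ((h0 β hβ).trans h1) h4 h5 hβ h1 hS.kept hK
          exact ⟨β', h6, h7, h8 ▸ h3⟩
        · obtain ⟨β, hβ, h⟩ := hlt ξ hξ
          obtain ⟨β', h6, h7, h8⟩ := H β hβ
          refine ⟨G β', h.le.trans ?_, hGD β' h7, ?_⟩
          · rcases h6.eq_or_lt with rfl | h6
            · exact le_rfl
            · exact (stage_lt (ih β' h7) h6).le
          · rw [(ih β' h7).2.1, hS.kept _ _ _ hK, h8]
      have hflag : (U.snap y (D α)).tape 1 1 = true := by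
        rw [hsnap]
        refine decide_eq_true fun ξ hξ => ?_
        obtain ⟨β, hβ, h⟩ := hlt ξ hξ
        exact ⟨G β, h.le, hGD β hβ, by rw [(ih β hβ).2.1, hS.flag]⟩
      obtain ⟨γ, h1, h2, h3⟩ := hS.limit (N.snap x α).tape _ _ (by rw [hsnap]) hkept hflag
      refine reaches_stage (γ := γ) ⟨h1, by rw [h2, ← hA], fun ξ h4 h5 => ?_⟩
      exact ⟨(h3 ξ h4 h5).1, fun t c hK => ⟨α, le_rfl, le_self_add, (h3 ξ h4 h5).2 t c hK⟩⟩

/-- As long as `N` has not halted, its stages are simulated by `U`. -/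
theorem exists_stage {α : Ordinal.{0}} (h : ∀ β < α, (N.snap x β).state ≠ N.halt) :
    ∃ γ, α ≤ γ ∧ γ₀ ≤ γ ∧ U.snap y γ = rep (N.snap x α) ∧
      ∀ ξ, γ₀ ≤ ξ → ξ < γ → (U.snap y ξ).state ≠ U.halt := by
  have hE : ∀ β ≤ α, E β (D β) (G β) := fun β hβ =>
    hS.reaches fun δ hδ => h δ (hδ.trans_le hβ)
  refine ⟨G α, le_stage hE, (le_max_left _ _).trans (hE α le_rfl).1, (hE α le_rfl).2.1,
    fun ξ h0 hξ => ?_⟩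
  obtain ⟨β, hβ, h1 | h1⟩ := cover h0 hξ
  · exact ((hE β hβ).2.2 ξ h1.1 h1.2).1
  · rw [h1.1, (hE β hβ).2.1]
    obtain ⟨S, hS', -⟩ := Relation.TransGen.head'_iff.1 (hS.step _ (h β h1.2))
    exact hS'.1

end Simulation

/-! ### Random access to the cells of a simulated tape -/

/-- The position of cell `h` of a simulated tape: in mode `0` cells are stored consecutively, in
mode `j > 0` they are stored on track `j`. -/
def addr (L mode h : ℕ) : ℕ := if mode = 0 then h else L * h + mode

/-- The block of `addr L mode h`. -/
def blockOf (L mode h : ℕ) : ℕ := if mode = 0 then h / L else h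

/-- The track of `addr L mode h`. -/
def trackOf (L mode h : ℕ) : ℕ := if mode = 0 then h % L else mode

theorem addr_eq (L mode h : ℕ) : addr L mode h = L * blockOf L mode h + trackOf L mode h := by
  unfold addr blockOf trackOf
  split_ifs
  · exact (Nat.div_add_mod h L).symm
  · rfl

theorem trackOf_lt {L mode h : ℕ} (hL : mode < L) : trackOf L mode h < L := by
  unfold trackOf
  split_ifs
  · exact Nat.mod_lt _ (by omega)
  · exact hL

theorem exists_compute {n : ℕ} {f : List.Vector ℕ n → ℕ} (hf : Primrec f) :
    ∃ C, ∀ L ≥ C, ∀ (lo : ℕ) (a : Fin n → ℕ) (o : ℕ), (∀ i, lo ≤ a i ∧ a i < 24 ∧ a i ≠ o) →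
      lo ≤ o → o < 24 → ∃ P, Computes lo L f a o 24 P := by
  obtain ⟨c, hc⟩ := exists_comp (Nat.Primrec'.prim_iff.2 hf)
  exact ⟨24 + c, fun L hL lo a o ha h1 h2 => hc lo L a o 24 ha h1 h2 hL⟩

/-- Execute `X j`, where `j` is the value of register `18`, which is set to zero. -/
def select (L : ℕ) (X : ℕ → Frag) : ℕ → ℕ → Frag
  | 0, _ => nop
  | n + 1, j => iteReg 18 (dec L 18 ;; select L X n (j + 1)) (X j)

theorem exec_select {I : Tapes → Prop} {lo L : ℕ} {T : Tapes} (hC : Ctx I lo L T) (h1 : lo ≤ 18)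
    (h2 : 18 < L) {X : ℕ → Frag} {c : ℕ × Tapes} {n : ℕ} : ∀ {j : ℕ} {v : ℕ → ℕ}, v 18 < n →
    Exec I (X (j + v 18)) (0, put lo L T (update v 18 0)) c →
    Exec I (select L X n j) (0, put lo L T v) c := by
  induction n with
  | zero => intro j v h; omega
  | succ n ih =>
    intro j v hv hX
    refine exec_iteReg hC h1 h2 (fun h => ?_) (fun h => ?_)
    · refine (does_dec h1 h2 h I T hC).seq (ih ?_ ?_)
      · simp; omega
      · simpa [show j + 1 + (v 18 - 1) = j + v 18 by omega] using hX
    · have e : update v 18 0 = v := Function.update_eq_iff.2 ⟨h.symm, fun _ _ => rfl⟩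
      rwa [h, add_zero, e] at hX

/-- Registers in which the block length is stored and those used to access a cell are zero. -/
structure Ready (L : ℕ) (v : ℕ → ℕ) : Prop where
  len : v 8 = L
  block : v 17 = 0
  track : v 18 = 0
  high : ∀ r, 24 ≤ r → v r = 0

theorem exists_access {mode : ℕ} (hmode : mode < 8) : ∃ C, ∀ L ≥ C, ∀ lo, lo ≤ 8 → ∀ X : ℕ → Frag,
    ∃ P, ∀ I T v c, Ctx I lo L T → Ready L v →
      Exec I (X (trackOf L mode (v 11)))
        (addr L mode (v 11), put lo L T (update v 17 (blockOf L mode (v 11)))) c →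
      Exec I P (0, put lo L T v) c := by
  have hk : Primrec fun v : List.Vector ℕ 2 => blockOf (v.get 0) mode (v.get 1) := by
    unfold blockOf
    split_ifs
    · exact Primrec.nat_div.comp (Primrec.vector_get.comp .id (.const 1))
        (Primrec.vector_get.comp .id (.const 0))
    · exact Primrec.vector_get.comp .id (.const 1)
  have hd : Primrec fun v : List.Vector ℕ 2 => trackOf (v.get 0) mode (v.get 1) := by
    unfold trackOf
    split_ifs
    · exact Primrec.nat_mod.comp (Primrec.vector_get.comp .id (.const 1))
        (Primrec.vector_get.comp .id (.const 0))
    · exact Primrec.const _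
  obtain ⟨C₁, h₁⟩ := exists_compute hk
  obtain ⟨C₂, h₂⟩ := exists_compute hd
  refine ⟨24 + C₁ + C₂, fun L hL lo hlo X => ?_⟩
  obtain ⟨P₁, hP₁⟩ := h₁ L (by omega) lo ![8, 11] 17
    (by intro i; fin_cases i <;> simp <;> omega) (by omega) (by omega)
  obtain ⟨P₂, hP₂⟩ := h₂ L (by omega) lo ![8, 11] 18
    (by intro i; fin_cases i <;> simp <;> omega) (by omega) (by omega)
  refine ⟨P₁ ;; P₂ ;; select L (fun j => goto L 17 ;; rep left 17 ;; rep right j ;; X j) L 0,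
    fun I T v c hC hv hX => ?_⟩
  have e₁ := hP₁ v hv.block hv.high I T hC
  have e₂ := hP₂ (update v 17 (blockOf L mode (v 11))) (by simpa using hv.track)
    (fun r hr => by rw [Function.update_of_ne (by omega)]; exact hv.high r hr) I T hC
  simp only [List.Vector.get_ofFn] at e₁ e₂
  simp [hv.len] at e₁ e₂
  refine e₁.seq (e₂.seq (exec_select hC (by omega) (by omega) ?_ ?_))
  · simp only [Function.update_self]
    exact trackOf_lt (by omega)
  · simp only [Function.update_self, zero_add, Function.update_idem]
    set k := blockOf L mode (v 11)
    set w := update v 17 k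
    have hw : update w 18 0 = w :=
      Function.update_eq_iff.2 ⟨by simp [w, hv.track], fun _ _ => rfl⟩
    rw [hw]
    have e₃ := exec_goto hC (put_reg (T := T) (v := w) (show lo ≤ 17 by omega)
      (show 17 < L by omega))
    have hwk : w 17 = k := by simp [w]
    rw [hwk] at e₃
    rw [addr_eq] at hX
    exact e₃.seq ((exec_lefts (hC.inv w) _ 17).seq ((exec_rights (hC.inv w) _ _).seq hX))

theorem put_addr {lo L mode h : ℕ} {T : Tapes} {v : ℕ → ℕ} {t : Fin 3} (hL : lo ≤ L)
    (ht : t = 1 → 0 < mode ∧ mode < lo) : put lo L T v t (addr L mode h) = T t (addr L mode h) := by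
  by_cases h1 : t = 1
  · obtain ⟨h2, h3⟩ := ht h1
    subst h1
    rw [addr, if_neg h2.ne']
    exact put_low h3 (by omega) h
  · exact put_ne h1 _

theorem exists_read {mode : ℕ} (hmode : mode < 8) : ∃ C, ∀ L ≥ C, ∀ lo, lo ≤ 8 →
    ∀ (t : Fin 3) (o : ℕ), (t = 1 → 0 < mode ∧ mode < lo) → lo ≤ o → o < 17 →
    ∃ P, ∀ I T v, Ctx I lo L T → Ready L v → Exec I P (0, put lo L T v)
      (0, put lo L T (update v o (v o + (T t (addr L mode (v 11))).toNat))) := by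
  obtain ⟨C, hC⟩ := exists_access hmode
  refine ⟨C + 24, fun L hL lo hlo t o ht ho1 ho2 => ?_⟩
  obtain ⟨P, hP⟩ := hC L (by omega) lo hlo fun j =>
    ite (isOne t) (rep left j ;; ret L ;; zero L 17 ;; inc L o) (rep left j ;; ret L ;; zero L 17)
  refine ⟨P, fun I T v hC hv => hP I T v _ hC hv ?_⟩
  set w := update v 17 (blockOf L mode (v 11)) with hw
  have hw' : update w 17 0 = v :=
    Function.update_eq_iff.2 ⟨hv.block.symm, fun r hr => by simp [w, hr]⟩
  have e₁ : Exec I (rep left (trackOf L mode (v 11))) (addr L mode (v 11), put lo L T w)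
      (L * blockOf L mode (v 11), put lo L T w) := by
    rw [addr_eq]
    exact exec_lefts (hC.inv w) _ _
  have e₂ := exec_ret hC w (blockOf L mode (v 11))
  have e₃ := does_zero (v := w) (show lo ≤ 17 by omega) (show 17 < L by omega) I T hC
  rw [hw'] at e₃
  have hb := put_addr (L := L) (h := v 11) (T := T) (v := w) (by omega) ht
  cases h : T t (addr L mode (v 11))
  · refine Exec.ite_neg (hC.inv w) (by rw [isOne, hb, h]) ?_
    simpa using e₁.seq (e₂.seq e₃)
  · refine Exec.ite_pos (hC.inv w) (by rw [isOne, hb, h]) ?_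
    exact e₁.seq (e₂.seq (e₃.seq (does_inc ho1 (by omega) I T hC)))

/-- Write the bit `b` on cell `c` of tape `t`. -/
def writeCell (T : Tapes) (t : Fin 3) (c : ℕ) (b : Bool) : Tapes :=
  fun i n => if i = t ∧ n = c then b else T i n

theorem exists_write {mode : ℕ} (hmode : mode < 8) : ∃ C, ∀ L ≥ C, ∀ lo, lo ≤ 8 →
    ∀ (t : Fin 3) (b : Bool), (t = 1 → 0 < mode ∧ mode < lo) →
    ∃ P, ∀ I T v, Ctx I lo L T → Ctx I lo L (writeCell T t (addr L mode (v 11)) b) → Ready L v →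
      Exec I P (0, put lo L T v) (0, put lo L (writeCell T t (addr L mode (v 11)) b) v) := by
  obtain ⟨C, hC⟩ := exists_access hmode
  refine ⟨C + 24, fun L hL lo hlo t b ht => ?_⟩
  obtain ⟨P, hP⟩ := hC L (by omega) lo hlo fun j => writeRet L j t b ;; zero L 17
  refine ⟨P, fun I T v hC hC' hv => hP I T v _ hC hv ?_⟩
  set w := update v 17 (blockOf L mode (v 11)) with hw
  have hw' : update w 17 0 = v :=
    Function.update_eq_iff.2 ⟨hv.block.symm, fun r hr => by simp [w, hr]⟩
  have e₃ := does_zero (v := w) (show lo ≤ 17 by omega) (show 17 < L by omega) I _ hC'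
  rw [hw'] at e₃
  refine Exec.seq ?_ e₃
  have e := exec_writeRet (r := trackOf L mode (v 11)) (n := blockOf L mode (v 11)) (t := t)
    (b := b) (v' := w) (hC.inv w) hC' ?_
  · rwa [← addr_eq] at e
  rw [← addr_eq]
  funext i c
  have hb := put_addr (L := L) (h := v 11) (T := writeCell T t (addr L mode (v 11)) b) (v := w)
    (by omega) ht
  by_cases h : i = t ∧ c = addr L mode (v 11)
  · rw [if_pos h, h.1, h.2, hb]
    simp [writeCell]
  · rw [if_neg h]
    simp only [put, writeCell, if_neg h]

section Coding

open Encodable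

/-- The states of `M` as states of the machine `M.prefixed n`. -/
def Machine.shift (M : Machine) (n : ℕ) (s : Fin (M.Q + 1)) : Fin (M.Q + n + 1 + 1) :=
  ⟨s + n + 1, by omega⟩

/-- The machine that writes the number `n` on the output tape before it continues with the
limit state of `M`. -/
def Machine.prefixed (M : Machine) (n : ℕ) : Machine where
  Q := M.Q + n + 1
  start := 0
  limit := M.shift n M.limit
  halt := M.shift n M.halt
  trans p := if h : (p.1 : ℕ) < n then (⟨p.1 + 1, by omega⟩, setBit 2 true p.2, true)
    else if h' : (p.1 : ℕ) = n then (p.1, p.2, true)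
    else
      let t := M.trans (⟨p.1 - (n + 1), by omega⟩, p.2)
      (M.shift n t.1, t.2)

/-- The transition table of the program `m`. -/
noncomputable def transOf (m s : ℕ) (b : Fin 3 → Bool) :
    Fin ((prog m).Q + 1) × (Fin 3 → Bool) × Bool :=
  (prog m).trans (Fin.ofNat _ s, b)

/-- The state that program `m` enters. -/
noncomputable def nextOf (m s : ℕ) (b : Fin 3 → Bool) : ℕ := (transOf m s b).1

/-- The bits that program `m` writes. -/
noncomputable def writeOf (m s : ℕ) (b : Fin 3 → Bool) : Fin 3 → Bool := (transOf m s b).2.1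

/-- The direction in which program `m` moves. -/
noncomputable def moveOf (m s : ℕ) (b : Fin 3 → Bool) : Bool := (transOf m s b).2.2

/-- The start state of program `m`. -/
noncomputable def startOf (m : ℕ) : ℕ := (prog m).start

/-- The limit state of program `m`. -/
noncomputable def limitOf (m : ℕ) : ℕ := (prog m).limit

/-- The halt state of program `m`. -/
noncomputable def haltOf (m : ℕ) : ℕ := (prog m).halt

/-- The bits represented by three numbers. -/
def bitsOf (b : Fin 3 → ℕ) : Fin 3 → Bool := fun i => decide (0 < b i)

/-- The three bits in positions `2`, `3`, `4` of a vector. -/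
def vecBits {n : ℕ} (v : List.Vector ℕ (n + 5)) : Fin 3 → Bool :=
  bitsOf ![v.get 2, v.get 3, v.get 4]


/-- Every number that decodes to an element of `α` is the code of that element. -/
def Canonical (α : Type*) [Encodable α] : Prop :=
  ∀ n, ∀ a ∈ (decode n : Option α), encode a = n

theorem canonical_nat : Canonical ℕ := fun n a h => by simpa using h.symm

theorem canonical_bool : Canonical Bool := by
  intro n a h
  match n with
  | 0 => rw [decode_zero] at h; cases h; rfl
  | 1 => rw [decode_one] at h; cases h; rfl
  | n + 2 => rw [decode_ge_two _ (by omega)] at h; cases h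

theorem canonical_ofEquiv {α β : Type*} [Encodable α] (e : β ≃ α) (h : Canonical α) :
    @Canonical β (ofEquiv α e) := by
  intro n b hb
  obtain ⟨a, ha, rfl⟩ : ∃ a, decode n = some a ∧ e.symm a = b := by
    simpa [decode_ofEquiv] using hb
  rw [encode_ofEquiv, e.apply_symm_apply]
  exact h n a ha

theorem canonical_subtype {α : Type*} [Encodable α] {p : α → Prop} {_ : DecidablePred p}
    (h : Canonical α) : Canonical {a // p a} := by
  intro n b hb
  have : decodeSubtype n = some b := hb
  simp only [decodeSubtype, Option.bind_eq_some_iff] at this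
  obtain ⟨a, ha, hab⟩ := this
  split_ifs at hab with hp
  cases hab
  exact h n a ha

theorem canonical_sigma {α : Type*} {β : α → Type*} [Encodable α] [∀ a, Encodable (β a)]
    (h : Canonical α) (h' : ∀ a, Canonical (β a)) : Canonical (Σ a, β a) := by
  intro n b hb
  have : (decode n.unpair.1).bind (fun a => (decode n.unpair.2).map (Sigma.mk a)) = some b := by
    rw [← decode_sigma_val]; exact hb
  simp only [Option.bind_eq_some_iff, Option.map_eq_some_iff] at this
  obtain ⟨a, ha, c, hc, rfl⟩ := this
  rw [encode_sigma_val, h _ a ha, h' a _ c hc, Nat.pair_unpair]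

theorem canonical_prod {α β : Type*} [Encodable α] [Encodable β]
    (h : Canonical α) (h' : Canonical β) : Canonical (α × β) := by
  intro n b hb
  simp only [decode_prod_val, Option.mem_def, Option.bind_eq_some_iff,
    Option.map_eq_some_iff] at hb
  obtain ⟨a, ha, c, hc, rfl⟩ := hb
  rw [encode_prod_val, h _ a ha, h' _ c hc, Nat.pair_unpair]

theorem canonical_list {α : Type*} [Encodable α] (h : Canonical α) : Canonical (List α) := by
  intro n
  induction n using Nat.strong_induction_on with
  | _ n ih =>
    intro l hl
    match n with
    | 0 => rw [decode_list_zero] at hl; cases hl; rfl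
    | n + 1 =>
      have hl' : (fun a l => a :: l) <$> decode n.unpair.1 <*> decode n.unpair.2 = some l := by
        rw [← decode_list_succ]; exact hl
      simp only [Option.map_eq_map, Seq.seq, Option.bind_eq_some_iff,
        Option.map_eq_some_iff] at hl'
      obtain ⟨_, ⟨a, ha, rfl⟩, t, ht, rfl⟩ := hl'
      rw [encode_list_cons, h _ a ha, ih _ (Nat.lt_succ_of_le (Nat.unpair_right_le n)) t ht,
        Nat.pair_unpair]

theorem canonical_fin (n : ℕ) : Canonical (Fin n) :=
  canonical_ofEquiv _ (canonical_subtype canonical_nat)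

theorem canonical_finArrow {n : ℕ} {α : Type*} [Encodable α] (h : Canonical α) :
    @Canonical (Fin n → α) finArrow :=
  canonical_ofEquiv _ <| canonical_subtype <| canonical_list h

theorem canonical_finPi {n : ℕ} {π : Fin n → Type*} [∀ i, Encodable (π i)]
    (h : ∀ i, Canonical (π i)) : @Canonical (∀ i, π i) (finPi n π) :=
  @canonical_ofEquiv _ _ (_) _ <| @canonical_subtype _ (_) _ _ <|
    canonical_finArrow <| canonical_sigma (canonical_fin n) h

theorem canonical_machine : Canonical Machine :=
  canonical_ofEquiv _ <| canonical_sigma canonical_nat fun _ =>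
    canonical_prod (canonical_prod (canonical_fin _) (canonical_prod (canonical_fin _)
      (canonical_fin _))) <| canonical_ofEquiv _ <| canonical_finPi fun _ =>
        canonical_prod (canonical_fin _) <| canonical_prod
          (canonical_finPi fun _ => canonical_bool) canonical_bool

theorem prog_encode (M : Machine) : prog (encode M) = M := by simp [prog]

theorem prog_of_not_mem_range {m : ℕ} (h : ∀ M : Machine, encode M ≠ m) : prog m = default := by
  rw [prog]
  cases e : (decode m : Option Machine) with
  | none => rfl
  | some M => exact absurd (canonical_machine m M e) (h M)

/-- The codes of the pairs of a state and three bits, in the order in which transition tables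
list them. -/
noncomputable def keys (Q : ℕ) : List ℕ :=
  (sortedUniv (Fin (Q + 1) × (Fin 3 → Bool))).map encode

/-- The table that lists the values of `g` on `keys Q`. -/
noncomputable def table (Q : ℕ) (g : ℕ → ℕ) : List ℕ :=
  (List.range (keys Q).length).map fun i => Nat.pair i (g ((keys Q).getD i 0))

theorem encode_list_map {α : Type*} [Encodable α] (l : List α) :
    encode l = encode (l.map encode) := by
  induction l with
  | nil => rfl
  | cons a l ih => simp [ih]

theorem encode_finPi {n : ℕ} {β : Type*} [Encodable β] (f : Fin n → β) :
    @encode _ (finPi n fun _ => β) f =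
      encode (List.ofFn fun i => Nat.pair i (encode (f i))) := by
  change encode (List.Vector.ofFn fun i : Fin n => (⟨i, f i⟩ : Σ _ : Fin n, β)).toList = _
  rw [List.Vector.toList_ofFn, encode_list_map, List.map_ofFn]
  rfl

theorem fintypeEquivFin_symm_apply {α : Type*} [Fintype α] [Encodable α]
    (i : Fin (Fintype.card α)) :
    fintypeEquivFin.symm i = (sortedUniv α)[(i : ℕ)]'(by simp) := by
  have cast_val {n k : ℕ} (h : n = k) (i : Fin n) : ((cast (congrArg Fin h) i : Fin k) : ℕ) = i := by
    subst h; rfl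
  have h : ((Equiv.cast (congrArg Fin (length_sortedUniv α))).symm i : ℕ) = i :=
    cast_val (length_sortedUniv α).symm i
  simp only [fintypeEquivFin, Equiv.symm_trans_apply, Equiv.symm_symm,
    List.Nodup.getEquivOfForallMemList_apply, List.get_eq_getElem, h]

theorem encode_arrow {Q : ℕ} {β : Type*} [Encodable β] (f : Fin (Q + 1) × (Fin 3 → Bool) → β)
    (g : ℕ → ℕ) (h : ∀ p, g (encode p) = encode (f p)) : encode f = encode (table Q g) := by
  change @encode _ (finPi _ fun _ => β) (fun i => f (fintypeEquivFin.symm i)) = _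
  rw [encode_finPi]
  congr 1
  apply List.ext_getElem
  · simp only [table, keys, List.length_ofFn, List.length_map, List.length_range, length_sortedUniv]
  · intro i h1 h2
    simp only [List.getElem_ofFn, table, List.getElem_map, List.getElem_range]
    have h3 : i < (sortedUniv (Fin (Q + 1) × (Fin 3 → Bool))).length := by
      rwa [List.length_ofFn, ← length_sortedUniv] at h1
    rw [keys, List.getD_eq_getElem _ _ (by simpa using h3), List.getElem_map, h]
    rw [fintypeEquivFin_symm_apply]

theorem Machine.encode_eq (M : Machine) (g : ℕ → ℕ)
    (h : ∀ p, g (encode p) = encode (M.trans p)) :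
    encode M = Nat.pair M.Q (Nat.pair (Nat.pair M.start (Nat.pair M.limit M.halt))
      (encode (table M.Q g))) := by
  rw [← encode_arrow M.trans g h]
  rfl

theorem keys_nodup (Q : ℕ) : (keys Q).Nodup :=
  (sortedUniv_nodup _).map encode_injective

theorem encode_mem_keys {Q : ℕ} (p : Fin (Q + 1) × (Fin 3 → Bool)) : encode p ∈ keys Q :=
  List.mem_map_of_mem (mem_sortedUniv p)

theorem mem_keys {Q k : ℕ} : k ∈ keys Q ↔ ∃ p : Fin (Q + 1) × (Fin 3 → Bool), encode p = k := by
  simp only [keys, List.mem_map, mem_sortedUniv, true_and]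

/-- The number that the machine with code `m` has in its transition table at the key `k`. -/
noncomputable def look (m k : ℕ) : ℕ :=
  ((Denumerable.ofNat (List ℕ) m.unpair.2.unpair.2).getD ((keys m.unpair.1).idxOf k) 0).unpair.2

theorem table_getD {Q k : ℕ} (g : ℕ → ℕ) (h : k ∈ keys Q) :
    ((table Q g).getD ((keys Q).idxOf k) 0).unpair.2 = g k := by
  have h' : (keys Q).idxOf k < (keys Q).length := List.idxOf_lt_length_of_mem h
  rw [List.getD_eq_getElem _ _ (by simpa [table] using h')]
  simp [table, List.getElem?_eq_getElem h']

theorem look_encode (M : Machine) (p : Fin (M.Q + 1) × (Fin 3 → Bool)) :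
    look (encode M) (encode p) = encode (M.trans p) := by
  obtain ⟨g, hg⟩ : ∃ g : ℕ → ℕ, ∀ p, g (encode p) = encode (M.trans p) := by
    refine ⟨fun k => if h : ∃ p : Fin (M.Q + 1) × (Fin 3 → Bool), encode p = k then
      encode (M.trans h.choose) else 0, fun p => ?_⟩
    have h : ∃ q : Fin (M.Q + 1) × (Fin 3 → Bool), encode q = encode p := ⟨p, rfl⟩
    simp only [dif_pos h, encode_injective h.choose_spec]
  rw [look, M.encode_eq _ hg]
  simp only [Nat.unpair_pair, Denumerable.ofNat_encode]
  rw [table_getD _ (encode_mem_keys p)]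
  exact hg p

/-- The codes of triples of bits. -/
noncomputable def bitCodes : List ℕ := (Finset.univ : Finset (Fin 3 → Bool)).toList.map encode

theorem mem_bitCodes {c : ℕ} : c ∈ bitCodes ↔ ∃ b : Fin 3 → Bool, encode b = c := by
  simp [bitCodes]

/-- The numbers that code an entry of a transition table with largest state `Q`. -/
def IsEntry (Q t : ℕ) : Prop :=
  t.unpair.1 ≤ Q ∧ t.unpair.2.unpair.1 ∈ bitCodes ∧ t.unpair.2.unpair.2 < 2

theorem isEntry_iff {Q t : ℕ} :
    IsEntry Q t ↔ ∃ e : Fin (Q + 1) × (Fin 3 → Bool) × Bool, encode e = t := by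
  constructor
  · rintro ⟨h1, h2, h3⟩
    obtain ⟨b, hb⟩ := mem_bitCodes.1 h2
    refine ⟨(⟨t.unpair.1, by omega⟩, b, decide (t.unpair.2.unpair.2 = 1)), ?_⟩
    have h4 : encode (decide (t.unpair.2.unpair.2 = 1)) = t.unpair.2.unpair.2 := by
      have : t.unpair.2.unpair.2 = 0 ∨ t.unpair.2.unpair.2 = 1 := by omega
      rcases this with h | h <;> simp [h]
    rw [encode_prod_val, encode_prod_val, hb, h4, Nat.pair_unpair]
    exact Nat.pair_unpair t
  · rintro ⟨⟨s, b, v⟩, rfl⟩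
    simp only [IsEntry, encode_prod_val, Nat.unpair_pair]
    refine ⟨Nat.lt_succ_iff.1 s.2, mem_bitCodes.2 ⟨b, rfl⟩, ?_⟩
    cases v <;> simp

/-- The numbers that code a machine. -/
def IsCode (m : ℕ) : Prop :=
  (m.unpair.2.unpair.1.unpair.1 ≤ m.unpair.1 ∧ m.unpair.2.unpair.1.unpair.2.unpair.1 ≤ m.unpair.1 ∧
    m.unpair.2.unpair.1.unpair.2.unpair.2 ≤ m.unpair.1) ∧
  m.unpair.2.unpair.2 = encode (table m.unpair.1 (look m)) ∧
  ∀ k ∈ keys m.unpair.1, IsEntry m.unpair.1 (look m k)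

theorem exists_encode_eq {Q s l h : ℕ} {g : ℕ → ℕ} (hs : s ≤ Q) (hl : l ≤ Q) (hh : h ≤ Q)
    (hg : ∀ k ∈ keys Q, IsEntry Q (g k)) :
    ∃ M : Machine, encode M = Nat.pair Q (Nat.pair (Nat.pair s (Nat.pair l h))
      (encode (table Q g))) := by
  have h6 : ∀ p : Fin (Q + 1) × (Fin 3 → Bool), ∃ e : Fin (Q + 1) × (Fin 3 → Bool) × Bool,
      encode e = g (encode p) := fun p => isEntry_iff.1 (hg _ (encode_mem_keys p))
  choose f hf using h6
  exact ⟨⟨Q, ⟨s, Nat.lt_succ_iff.2 hs⟩, ⟨l, Nat.lt_succ_iff.2 hl⟩, ⟨h, Nat.lt_succ_iff.2 hh⟩, f⟩,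
    Machine.encode_eq _ g fun p => (hf p).symm⟩

theorem isCode_iff {m : ℕ} : IsCode m ↔ ∃ M : Machine, encode M = m := by
  constructor
  · rintro ⟨⟨h1, h2, h3⟩, h4, h5⟩
    obtain ⟨M, hM⟩ := exists_encode_eq h1 h2 h3 h5
    refine ⟨M, ?_⟩
    rw [hM, ← h4]
    simp only [Nat.pair_unpair]
  · rintro ⟨M, rfl⟩
    have e := M.encode_eq (look (encode M)) (look_encode M)
    have e1 : (encode M).unpair.1 = M.Q := by rw [e]; simp
    have e2 : (encode M).unpair.2.unpair.1 =
      Nat.pair M.start (Nat.pair M.limit M.halt) := by rw [e]; simp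
    have e3 : (encode M).unpair.2.unpair.2 = encode (table M.Q (look (encode M))) := by
      conv_lhs => rw [e]
      simp
    rw [IsCode, e1, e2, e3]
    simp only [Nat.unpair_pair]
    refine ⟨⟨Nat.lt_succ_iff.1 M.start.2, Nat.lt_succ_iff.1 M.limit.2,
      Nat.lt_succ_iff.1 M.halt.2⟩, trivial, fun k hk => ?_⟩
    obtain ⟨p, rfl⟩ := mem_keys.1 hk
    exact isEntry_iff.2 ⟨_, (look_encode M p).symm⟩

theorem sortedLT_keys (Q : ℕ) : (keys Q).Pairwise (· < ·) := by
  have h : (sortedUniv (Fin (Q + 1) × (Fin 3 → Bool))).Pairwise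
      (encode' (Fin (Q + 1) × (Fin 3 → Bool)) ⁻¹'o (· ≤ ·)) := Finset.pairwise_sort _ _
  have h' : (keys Q).Pairwise (· ≤ ·) := by
    rw [keys, List.pairwise_map]
    exact h
  exact (h'.and (keys_nodup Q)).imp fun h => lt_of_le_of_ne h.1 h.2

theorem exists_keys_eq_filter : ∃ B, ∀ Q, keys Q =
    (List.range ((Q + B + 1) * (Q + B + 1))).filter
      fun k => decide (k.unpair.1 ≤ Q ∧ k.unpair.2 ∈ bitCodes) := by
  obtain ⟨B, hB⟩ : ∃ B, ∀ c ∈ bitCodes, c ≤ B :=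
    ⟨bitCodes.sum, fun c hc => List.le_sum_of_mem hc⟩
  refine ⟨B, fun Q => ?_⟩
  refine List.Perm.eq_of_pairwise' (r := (· < ·)) (sortedLT_keys Q)
    (List.Pairwise.filter _ List.pairwise_lt_range) ?_
  refine (List.perm_ext_iff_of_nodup (keys_nodup Q) (List.nodup_range.filter _)).2 fun k => ?_
  simp only [mem_keys, List.mem_filter, List.mem_range, decide_eq_true_eq]
  constructor
  · rintro ⟨⟨s, b⟩, rfl⟩
    rw [encode_prod_val, Nat.unpair_pair]
    have hb : encode b ∈ bitCodes := mem_bitCodes.2 ⟨b, rfl⟩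
    have hs : encode s ≤ Q := Nat.lt_succ_iff.1 s.2
    refine ⟨?_, hs, hb⟩
    refine (Nat.pair_lt_max_add_one_sq _ _).trans_le ?_
    have := hB _ hb
    rw [sq]
    apply Nat.mul_le_mul <;> omega
  · rintro ⟨-, hs, hb⟩
    obtain ⟨b, hb⟩ := mem_bitCodes.1 hb
    refine ⟨(⟨k.unpair.1, Nat.lt_succ_iff.2 hs⟩, b), ?_⟩
    rw [encode_prod_val, hb]
    exact Nat.pair_unpair k

theorem primrecPred_mem {α : Type*} [Primcodable α] (l : List α) : PrimrecPred (· ∈ l) := by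
  refine ((Primrec.nat_lt.comp (Primrec.list_idxOf₁ l) (.const l.length))).of_eq fun a => ?_
  exact List.idxOf_lt_length_iff

section

variable {α : Type*} [Primcodable α] {f : α → ℕ}

theorem primrec_fst (hf : Primrec f) : Primrec fun a => (f a).unpair.1 :=
  Primrec.fst.comp (Primrec.unpair.comp hf)

theorem primrec_snd (hf : Primrec f) : Primrec fun a => (f a).unpair.2 :=
  Primrec.snd.comp (Primrec.unpair.comp hf)

end

theorem primrec_keys : Primrec keys := by
  obtain ⟨B, hB⟩ := exists_keys_eq_filter
  have hB1 : Primrec fun Q => Q + B + 1 :=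
    Primrec.succ.comp (Primrec.nat_add.comp .id (.const B))
  have hR : PrimrecRel fun k Q : ℕ => k.unpair.1 ≤ Q ∧ k.unpair.2 ∈ bitCodes :=
    (Primrec.nat_le.comp (primrec_fst .fst) .snd).and
      ((primrecPred_mem bitCodes).comp (primrec_snd .fst))
  exact (hR.listFilter.comp (Primrec.list_range.comp (Primrec.nat_mul.comp hB1 hB1)) .id).of_eq
    fun Q => (hB Q).symm

theorem primrec_table {α : Type*} [Primcodable α] {Q : α → ℕ} {g : α → ℕ → ℕ} (hQ : Primrec Q)
    (hg : Primrec₂ g) : Primrec fun a => table (Q a) (g a) := by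
  have hK := primrec_keys.comp hQ
  refine Primrec.list_map (Primrec.list_range.comp (Primrec.list_length.comp hK)) ?_
  exact Primrec₂.natPair.comp .snd (hg.comp .fst
    ((Primrec.list_getD 0).comp (hK.comp .fst) .snd))

theorem primrec_look : Primrec₂ look := by
  refine primrec_snd ((Primrec.list_getD 0).comp ((Primrec.ofNat (List ℕ)).comp
    (primrec_snd (primrec_snd .fst))) ?_)
  exact Primrec.list_idxOf.comp .snd (primrec_keys.comp (primrec_fst .fst))

theorem primrec_isEntry : PrimrecRel IsEntry :=
  (Primrec.nat_le.comp (primrec_fst .snd) .fst).and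
    (((primrecPred_mem bitCodes).comp (primrec_fst (primrec_snd .snd))).and
      (Primrec.nat_lt.comp (primrec_snd (primrec_snd .snd)) (.const 2)))

theorem primrec_isCode : PrimrecPred IsCode := by
  have hQ : Primrec fun m : ℕ => m.unpair.1 := primrec_fst .id
  have h1 : Primrec fun m : ℕ => m.unpair.2.unpair.1 := primrec_fst (primrec_snd .id)
  refine ((Primrec.nat_le.comp (primrec_fst h1) hQ).and ((Primrec.nat_le.comp
    (primrec_fst (primrec_snd h1)) hQ).and (Primrec.nat_le.comp
      (primrec_snd (primrec_snd h1)) hQ))).and (.and ?_ ?_)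
  · exact Primrec.eq.comp (primrec_snd (primrec_snd .id))
      (Primrec.encode.comp (primrec_table hQ primrec_look))
  · have hR : PrimrecRel fun k m : ℕ => IsEntry m.unpair.1 (look m k) :=
      primrec_isEntry.comp (primrec_fst .snd) (primrec_look.comp .snd .fst)
    exact hR.forall_mem_list.comp (primrec_keys.comp hQ) .id

/-- The code of the transition of the program `m` at the key `k`. -/
noncomputable def transCode (m k : ℕ) : ℕ :=
  if IsCode m then look m k else encode ((default : Machine).trans default)

theorem primrec_transCode : Primrec₂ transCode :=
  Primrec.ite (primrec_isCode.comp .fst) primrec_look (.const _)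

theorem transCode_encode (m : ℕ) (p : Fin ((prog m).Q + 1) × (Fin 3 → Bool)) :
    transCode m (encode p) = encode ((prog m).trans p) := by
  by_cases h : IsCode m
  · obtain ⟨M, rfl⟩ := isCode_iff.1 h
    rw [transCode, if_pos h]
    revert p
    rw [prog_encode]
    exact look_encode M
  · have hd : prog m = default := prog_of_not_mem_range fun M hM => h (isCode_iff.2 ⟨M, hM⟩)
    rw [transCode, if_neg h]
    revert p
    rw [hd]
    exact fun _ => rfl

theorem primrec_of_isCode {v : Machine → ℕ} {g : ℕ → ℕ} (hg : Primrec g)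
    (h : ∀ M, g (encode M) = v M) : Primrec fun m => v (prog m) := by
  refine (Primrec.ite primrec_isCode hg (.const (v default))).of_eq fun m => ?_
  split_ifs with hm
  · obtain ⟨M, rfl⟩ := isCode_iff.1 hm
    rw [prog_encode, h]
  · rw [prog_of_not_mem_range fun M hM => hm (isCode_iff.2 ⟨M, hM⟩)]

theorem primrec_prog_Q : Primrec fun m => (prog m).Q :=
  primrec_of_isCode (primrec_fst .id) fun M => by
    rw [M.encode_eq _ (look_encode M)]; simp

theorem primrec_startOf : Primrec startOf :=
  primrec_of_isCode (v := fun M => M.start) (primrec_fst (primrec_fst (primrec_snd .id))) fun M => by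
    rw [M.encode_eq _ (look_encode M)]; simp

theorem primrec_limitOf : Primrec limitOf :=
  primrec_of_isCode (v := fun M => M.limit)
    (primrec_fst (primrec_snd (primrec_fst (primrec_snd .id)))) fun M => by
      rw [M.encode_eq _ (look_encode M)]; simp

theorem primrec_haltOf : Primrec haltOf :=
  primrec_of_isCode (v := fun M => M.halt)
    (primrec_snd (primrec_snd (primrec_fst (primrec_snd .id)))) fun M => by
      rw [M.encode_eq _ (look_encode M)]; simp

theorem exists_primrec_encode_bits (F : (Fin 3 → Bool) → ℕ) :
    ∃ G : ℕ → ℕ, Primrec G ∧ ∀ b : Fin 3 → Bool, G (encode b) = F b := by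
  refine ⟨fun c => ((Finset.univ : Finset (Fin 3 → Bool)).toList.map F).getD
    (bitCodes.idxOf c) 0, ?_, fun b => ?_⟩
  · exact (Primrec.list_getD 0).comp (.const _) (Primrec.list_idxOf₁ _)
  · have h : bitCodes.idxOf (encode b) < bitCodes.length :=
      List.idxOf_lt_length_of_mem (mem_bitCodes.2 ⟨b, rfl⟩)
    have h' : bitCodes.idxOf (encode b) < (Finset.univ : Finset (Fin 3 → Bool)).toList.length := by
      simpa only [bitCodes, List.length_map] using h
    beta_reduce
    rw [List.getD_eq_getElem _ _ (by simpa only [List.length_map] using h'), List.getElem_map]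
    have e : bitCodes[bitCodes.idxOf (encode b)] = encode b := List.getElem_idxOf h
    rw [encode_injective ((List.getElem_map encode (h := h)).symm.trans e)]

theorem primrec_encode_bitsOf {α : Type*} [Primcodable α] {x y z : α → ℕ} (hx : Primrec x)
    (hy : Primrec y) (hz : Primrec z) :
    Primrec fun a => encode (bitsOf ![x a, y a, z a]) := by
  have hd {x : α → ℕ} (hx : Primrec x) : Primrec fun a => decide (0 < x a) :=
    (Primrec.nat_lt.comp (.const 0) hx).decide
  refine ((Primrec.dom_finite fun p : Bool × Bool × Bool => encode ![p.1, p.2.1, p.2.2]).comp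
    ((hd hx).pair ((hd hy).pair (hd hz)))).of_eq fun a => ?_
  congr 1
  funext i
  fin_cases i <;> rfl

theorem primrec_start : Primrec fun v : List.Vector ℕ 1 => startOf (v.get 0) :=
  primrec_startOf.comp (Primrec.vector_get.comp .id (.const 0))

theorem primrec_limit : Primrec fun v : List.Vector ℕ 1 => limitOf (v.get 0) :=
  primrec_limitOf.comp (Primrec.vector_get.comp .id (.const 0))

theorem primrec_running : Primrec fun v : List.Vector ℕ 2 =>
    if v.get 1 = haltOf (v.get 0) then 0 else 1 :=
  Primrec.ite (Primrec.eq.comp (Primrec.vector_get.comp .id (.const 1))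
    (primrec_haltOf.comp (Primrec.vector_get.comp .id (.const 0)))) (.const 0) (.const 1)

theorem primrec_encode_transOf {n : ℕ} : Primrec fun v : List.Vector ℕ (n + 5) =>
    encode (transOf (v.get 0) (v.get 1) (vecBits v)) := by
  have hv (i : Fin (n + 5)) : Primrec fun v : List.Vector ℕ (n + 5) => v.get i :=
    Primrec.vector_get.comp .id (.const i)
  have hs : Primrec fun v : List.Vector ℕ (n + 5) => v.get 1 % ((prog (v.get 0)).Q + 1) :=
    Primrec.nat_mod.comp (hv 1) (Primrec.succ.comp (primrec_prog_Q.comp (hv 0)))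
  refine (primrec_transCode.comp (hv 0) (Primrec₂.natPair.comp hs
    (primrec_encode_bitsOf (hv 2) (hv 3) (hv 4)))).of_eq fun v => ?_
  rw [transOf, ← transCode_encode]
  rfl

theorem primrec_next : Primrec fun v : List.Vector ℕ 5 =>
    nextOf (v.get 0) (v.get 1) (vecBits v) :=
  (primrec_fst (primrec_encode_transOf (n := 0))).of_eq fun v => by
    rw [encode_prod_val, Nat.unpair_pair]
    rfl

theorem primrec_write (i : Fin 3) : Primrec fun v : List.Vector ℕ 5 =>
    (writeOf (v.get 0) (v.get 1) (vecBits v) i).toNat := by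
  obtain ⟨G, hG, hG'⟩ := exists_primrec_encode_bits fun b => (b i).toNat
  refine (hG.comp (primrec_fst (primrec_snd (primrec_encode_transOf (n := 0))))).of_eq fun v => ?_
  rw [encode_prod_val, Nat.unpair_pair, encode_prod_val, Nat.unpair_pair, hG']
  rfl

theorem primrec_head : Primrec fun v : List.Vector ℕ 6 =>
    if moveOf (v.get 0) (v.get 1) (vecBits v) then v.get 5 + 1 else v.get 5 - 1 := by
  have h5 : Primrec fun v : List.Vector ℕ 6 => v.get 5 := Primrec.vector_get.comp .id (.const 5)
  refine (Primrec.ite (Primrec.eq.comp (primrec_snd (primrec_snd (primrec_encode_transOf (n := 1))))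
    (.const 1)) (Primrec.succ.comp h5) (Primrec.pred.comp h5)).of_eq fun v => ?_
  rw [encode_prod_val, Nat.unpair_pair, encode_prod_val, Nat.unpair_pair, moveOf]
  cases (transOf (v.get 0) (v.get 1) (vecBits v)).2.2 <;> rfl

/-- The code of the program `n` that is prefixed by its own code. -/
noncomputable def diag (n : ℕ) : ℕ := encode ((prog n).prefixed n)

theorem Machine.pair_shift (M : Machine) (n : ℕ) (t : Fin (M.Q + 1) × (Fin 3 → Bool) × Bool) :
    Nat.pair ((encode t).unpair.1 + n + 1) (encode t).unpair.2 =
      encode (M.shift n t.1, t.2) := by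
  rw [encode_prod_val, encode_prod_val, Nat.unpair_pair]
  rfl

theorem primrec_diag : Primrec fun v : List.Vector ℕ 1 => diag (v.get 0) := by
  suffices h : Primrec diag from h.comp (Primrec.vector_get.comp .id (.const 0))
  obtain ⟨G, hG, hG'⟩ := exists_primrec_encode_bits fun b => encode (setBit 2 true b)
  let g (n k : ℕ) : ℕ :=
    if k.unpair.1 < n then Nat.pair (k.unpair.1 + 1) (Nat.pair (G k.unpair.2) 1)
    else if k.unpair.1 = n then Nat.pair k.unpair.1 (Nat.pair k.unpair.2 1)
    else Nat.pair ((transCode n (Nat.pair (k.unpair.1 - (n + 1)) k.unpair.2)).unpair.1 + n + 1)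
      (transCode n (Nat.pair (k.unpair.1 - (n + 1)) k.unpair.2)).unpair.2
  have hg : Primrec₂ g := by
    have h1 : Primrec fun p : ℕ × ℕ => p.2.unpair.1 := primrec_fst .snd
    have h2 : Primrec fun p : ℕ × ℕ => p.2.unpair.2 := primrec_snd .snd
    have h3 : Primrec fun p : ℕ × ℕ =>
        transCode p.1 (Nat.pair (p.2.unpair.1 - (p.1 + 1)) p.2.unpair.2) :=
      primrec_transCode.comp .fst (Primrec₂.natPair.comp
        (Primrec.nat_sub.comp h1 (Primrec.succ.comp .fst)) h2)
    refine Primrec.ite (Primrec.nat_lt.comp h1 .fst) (Primrec₂.natPair.comp (Primrec.succ.comp h1)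
      (Primrec₂.natPair.comp (hG.comp h2) (.const 1))) ?_
    refine Primrec.ite (Primrec.eq.comp h1 .fst) (Primrec₂.natPair.comp h1
      (Primrec₂.natPair.comp h2 (.const 1))) ?_
    exact Primrec₂.natPair.comp (Primrec.succ.comp (Primrec.nat_add.comp (primrec_fst h3) .fst))
      (primrec_snd h3)
  have hk (n : ℕ) (p : Fin (((prog n).prefixed n).Q + 1) × (Fin 3 → Bool)) :
      g n (encode p) = encode (((prog n).prefixed n).trans p) := by
    have e1 : (encode p).unpair.1 = (p.1 : ℕ) := by rw [encode_prod_val, Nat.unpair_pair]; rfl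
    have e2 : (encode p).unpair.2 = encode p.2 := by rw [encode_prod_val, Nat.unpair_pair]
    simp only [g, e1, e2]
    by_cases h : (p.1 : ℕ) < n
    · rw [if_pos h, hG', show ((prog n).prefixed n).trans p = _ from dif_pos h]
      rfl
    by_cases h' : (p.1 : ℕ) = n
    · rw [if_neg h, if_pos h',
        show ((prog n).prefixed n).trans p = _ from (dif_neg h).trans (dif_pos h')]
      rfl
    · have hp : (p.1 : ℕ) - (n + 1) < (prog n).Q + 1 := by
        have := p.1.2
        simp only [Machine.prefixed] at this
        omega
      have e : transCode n (Nat.pair ((p.1 : ℕ) - (n + 1)) (encode p.2)) =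
          encode ((prog n).trans (⟨(p.1 : ℕ) - (n + 1), hp⟩, p.2)) :=
        transCode_encode n (⟨(p.1 : ℕ) - (n + 1), hp⟩, p.2)
      rw [if_neg h, if_neg h', e, show ((prog n).prefixed n).trans p = _ from
        (dif_neg h).trans (dif_neg h')]
      exact Machine.pair_shift _ n _
  have hQ : Primrec fun n => (prog n).Q + n + 1 :=
    Primrec.succ.comp (Primrec.nat_add.comp primrec_prog_Q .id)
  have hS {f : ℕ → ℕ} (hf : Primrec f) : Primrec fun n => f n + n + 1 :=
    Primrec.succ.comp (Primrec.nat_add.comp hf .id)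
  refine (Primrec₂.natPair.comp hQ (Primrec₂.natPair.comp (Primrec₂.natPair.comp (.const 0)
    (Primrec₂.natPair.comp (hS primrec_limitOf) (hS primrec_haltOf)))
      (Primrec.encode.comp (primrec_table hQ hg)))).of_eq fun n => ?_
  exact (Machine.encode_eq _ (g n) (hk n)).symm

end Coding

/-! ### Simulating one step -/

/-- The registers of the simulation. -/
structure Regs where
  len : ℕ := 0
  code : ℕ := 0
  state : ℕ := 0
  head : ℕ := 0
  run : ℕ := 0
  b₀ : ℕ := 0
  b₁ : ℕ := 0
  b₂ : ℕ := 0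
  state' : ℕ := 0
  head' : ℕ := 0
  bit : ℕ := 0

namespace Regs

/-- The contents of the registers as a function. -/
def val (R : Regs) : ℕ → ℕ := fun r =>
  if r = 8 then R.len else if r = 9 then R.code else if r = 10 then R.state else
  if r = 11 then R.head else if r = 12 then R.run else if r = 13 then R.b₀ else
  if r = 14 then R.b₁ else if r = 15 then R.b₂ else if r = 19 then R.state' else
  if r = 20 then R.head' else if r = 21 then R.bit else 0

variable (R : Regs) (k : ℕ)

@[simp] theorem val_len : R.val 8 = R.len := rfl

@[simp] theorem val_code : R.val 9 = R.code := rfl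

@[simp] theorem val_state : R.val 10 = R.state := rfl

@[simp] theorem val_head : R.val 11 = R.head := rfl

@[simp] theorem val_run : R.val 12 = R.run := rfl

@[simp] theorem val_b₀ : R.val 13 = R.b₀ := rfl

@[simp] theorem val_b₁ : R.val 14 = R.b₁ := rfl

@[simp] theorem val_b₂ : R.val 15 = R.b₂ := rfl

@[simp] theorem val_state' : R.val 19 = R.state' := rfl

@[simp] theorem val_head' : R.val 20 = R.head' := rfl

@[simp] theorem val_bit : R.val 21 = R.bit := rfl

theorem update_len : update R.val 8 k = { R with len := k }.val := by
  refine Function.update_eq_iff.2 ⟨rfl, fun r hr => ?_⟩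
  simp only [val, if_neg hr]

theorem update_code : update R.val 9 k = { R with code := k }.val := by
  refine Function.update_eq_iff.2 ⟨rfl, fun r hr => ?_⟩
  simp only [val, if_neg hr]

theorem update_state : update R.val 10 k = { R with state := k }.val := by
  refine Function.update_eq_iff.2 ⟨rfl, fun r hr => ?_⟩
  simp only [val, if_neg hr]

theorem update_head : update R.val 11 k = { R with head := k }.val := by
  refine Function.update_eq_iff.2 ⟨rfl, fun r hr => ?_⟩
  simp only [val, if_neg hr]

theorem update_run : update R.val 12 k = { R with run := k }.val := by
  refine Function.update_eq_iff.2 ⟨rfl, fun r hr => ?_⟩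
  simp only [val, if_neg hr]

theorem update_b₀ : update R.val 13 k = { R with b₀ := k }.val := by
  refine Function.update_eq_iff.2 ⟨rfl, fun r hr => ?_⟩
  simp only [val, if_neg hr]

theorem update_b₁ : update R.val 14 k = { R with b₁ := k }.val := by
  refine Function.update_eq_iff.2 ⟨rfl, fun r hr => ?_⟩
  simp only [val, if_neg hr]

theorem update_b₂ : update R.val 15 k = { R with b₂ := k }.val := by
  refine Function.update_eq_iff.2 ⟨rfl, fun r hr => ?_⟩
  simp only [val, if_neg hr]

theorem update_state' : update R.val 19 k = { R with state' := k }.val := by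
  refine Function.update_eq_iff.2 ⟨rfl, fun r hr => ?_⟩
  simp only [val, if_neg hr]

theorem update_head' : update R.val 20 k = { R with head' := k }.val := by
  refine Function.update_eq_iff.2 ⟨rfl, fun r hr => ?_⟩
  simp only [val, if_neg hr]

theorem update_bit : update R.val 21 k = { R with bit := k }.val := by
  refine Function.update_eq_iff.2 ⟨rfl, fun r hr => ?_⟩
  simp only [val, if_neg hr]

theorem high {r : ℕ} (hr : 24 ≤ r) : R.val r = 0 := by
  unfold val
  iterate 11 rw [if_neg (by omega)]

theorem ready {L : ℕ} (h : R.len = L) : Ready L R.val :=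
  ⟨h, rfl, rfl, fun _ => R.high⟩

attribute [irreducible] val

end Regs

/-- A layout assigns to each simulated tape a tape and a mode. -/
structure Layout where
  tape : Fin 3 → Fin 3
  mode : Fin 3 → ℕ
  mode_lt : ∀ i, mode i < 7
  low : ∀ i, tape i = 1 → 3 ≤ mode i
  inj : ∀ i j, tape i = tape j → mode i = mode j ∨ mode i = 0 ∨ mode j = 0 → i = j

namespace Layout

variable (Y : Layout) (L : ℕ)

theorem mode_lt_eight (i : Fin 3) : Y.mode i < 8 := (Y.mode_lt i).trans (by omega)

/-- The cell that stores cell `h` of the simulated tape `i`. -/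
def cell (p : Fin 3 × ℕ) : Fin 3 × ℕ := (Y.tape p.1, addr L (Y.mode p.1) p.2)

/-- The tapes that agree with `T` except that they store the simulated tapes `A`. -/
noncomputable def enc (T A : Tapes) : Tapes :=
  fun t c => Function.extend (Y.cell L) (fun p => A p.1 p.2) (fun q => T q.1 q.2) (t, c)

variable {Y L} (hL : 8 ≤ L)
include hL

theorem cell_injective : Function.Injective (Y.cell L) := by
  rintro ⟨i, h⟩ ⟨j, k⟩ e
  simp only [cell, Prod.mk.injEq] at e
  obtain ⟨e1, e2⟩ := e
  have hi := Y.mode_lt i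
  have hj := Y.mode_lt j
  have key : i = j := by
    refine Y.inj i j e1 ?_
    by_contra! hne
    rw [addr, addr, if_neg hne.2.1, if_neg hne.2.2] at e2
    have := congrArg (· % L) e2
    simp only [Nat.mul_add_mod] at this
    rw [Nat.mod_eq_of_lt (by omega), Nat.mod_eq_of_lt (by omega)] at this
    exact hne.1 this
  subst key
  refine Prod.ext rfl ?_
  unfold addr at e2
  split_ifs at e2
  · exact e2
  · exact Nat.eq_of_mul_eq_mul_left (by omega) (by omega : L * h = L * k)

theorem enc_cell (T A : Tapes) (i : Fin 3) (h : ℕ) :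
    Y.enc L T A (Y.tape i) (addr L (Y.mode i) h) = A i h :=
  (cell_injective hL).extend_apply _ _ (i, h)

theorem enc_write (T A : Tapes) (i : Fin 3) (h : ℕ) (b : Bool) :
    writeCell (Y.enc L T A) (Y.tape i) (addr L (Y.mode i) h) b =
      Y.enc L T (writeCell A i h b) := by
  funext t c
  by_cases hc : ∃ p, Y.cell L p = (t, c)
  · obtain ⟨⟨j, k⟩, hp⟩ := hc
    obtain ⟨rfl, rfl⟩ := Prod.mk.inj hp
    have : (Y.tape j = Y.tape i ∧ addr L (Y.mode j) k = addr L (Y.mode i) h) ↔ (j = i ∧ k = h) := by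
      have := (cell_injective (Y := Y) hL).eq_iff (a := (j, k)) (b := (i, h))
      simpa [cell] using this
    simp only [writeCell, this, enc_cell hL]
  · have : ¬ (t = Y.tape i ∧ c = addr L (Y.mode i) h) := by
      rintro ⟨rfl, rfl⟩
      exact hc ⟨(i, h), rfl⟩
    simp only [writeCell, if_neg this, enc, Function.extend_apply' _ _ _ hc]

theorem enc_low (T A : Tapes) {c : ℕ} (hc : c % L < 3 ∨ c % L = 7) : Y.enc L T A 1 c = T 1 c := by
  refine Function.extend_apply' _ _ _ ?_
  rintro ⟨⟨i, h⟩, hp⟩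
  obtain ⟨e1, rfl⟩ := Prod.mk.inj hp
  dsimp only at e1 hc
  have h3 := Y.low i e1
  have h8 := Y.mode_lt i
  rw [addr, if_neg (by omega), Nat.mul_add_mod, Nat.mod_eq_of_lt (by omega)] at hc
  omega

end Layout

namespace Layout

variable {Y : Layout} {L : ℕ}

theorem enc_or (T : Tapes) {A A' B : Tapes} (h : ∀ i n, B i n = A i n ∨ B i n = A' i n) (t : Fin 3)
    (c : ℕ) : Y.enc L T B t c = Y.enc L T A t c ∨ Y.enc L T B t c = Y.enc L T A' t c := by
  unfold enc Function.extend
  split_ifs with hc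
  · exact h _ _
  · exact .inl rfl

end Layout

/-- The registers between the simulations of two steps. -/
noncomputable def simRegs (L m s h : ℕ) : Regs where
  len := L
  code := m
  state := s
  head := h
  run := if s = haltOf m then 0 else 1

theorem transOf_val {m : ℕ} (s : Fin ((prog m).Q + 1)) (b : Fin 3 → Bool) :
    transOf m s (bitsOf ![(b 0).toNat, (b 1).toNat, (b 2).toNat]) = (prog m).trans (s, b) := by
  have h1 : bitsOf ![(b 0).toNat, (b 1).toNat, (b 2).toNat] = b := by
    funext i
    fin_cases i
    · cases h : b 0 <;> simp [bitsOf, h]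
    · cases h : b 1 <;> simp [bitsOf, h]
    · cases h : b 2 <;> simp [bitsOf, h]
  rw [transOf, h1, Fin.ofNat_val_eq_self]

theorem exists_read_bits (Y : Layout) : ∃ C, ∀ L ≥ C, ∃ P : Frag, ∀ I T A (R : Regs),
    Ctx I 8 L (Y.enc L T A) → R.len = L → R.b₀ = 0 → R.b₁ = 0 → R.b₂ = 0 →
    Exec I P (0, put 8 L (Y.enc L T A) R.val) (0, put 8 L (Y.enc L T A)
      { R with b₀ := (A 0 R.head).toNat, b₁ := (A 1 R.head).toNat, b₂ := (A 2 R.head).toNat }.val) := by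
  choose C hC using fun i => exists_read (Y.mode_lt_eight i)
  refine ⟨24 + C 0 + C 1 + C 2, fun L hL => ?_⟩
  have hlow (i : Fin 3) (hi : Y.tape i = 1) : 0 < Y.mode i ∧ Y.mode i < 8 :=
    ⟨by have := Y.low i hi; omega, Y.mode_lt_eight i⟩
  obtain ⟨P₀, h₀⟩ := hC 0 L (by omega) 8 le_rfl (Y.tape 0) 13 (hlow 0) (by omega) (by omega)
  obtain ⟨P₁, h₁⟩ := hC 1 L (by omega) 8 le_rfl (Y.tape 1) 14 (hlow 1) (by omega) (by omega)
  obtain ⟨P₂, h₂⟩ := hC 2 L (by omega) 8 le_rfl (Y.tape 2) 15 (hlow 2) (by omega) (by omega)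
  refine ⟨P₀ ;; P₁ ;; P₂, ?_⟩
  rintro I T A ⟨l, m, s, h, r, b₀, b₁, b₂, s', h', b⟩ hX rfl (rfl : b₀ = 0) (rfl : b₁ = 0)
    (rfl : b₂ = 0)
  have e₀ := h₀ I _ _ hX (Regs.ready ⟨l, m, s, h, r, 0, 0, 0, s', h', b⟩ rfl)
  rw [Regs.update_b₀] at e₀
  have e₁ := h₁ I _ _ hX (Regs.ready ⟨l, m, s, h, r, (A 0 h).toNat, 0, 0, s', h', b⟩ rfl)
  rw [Regs.update_b₁] at e₁
  have e₂ := h₂ I _ _ hX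
    (Regs.ready ⟨l, m, s, h, r, (A 0 h).toNat, (A 1 h).toNat, 0, s', h', b⟩ rfl)
  rw [Regs.update_b₂] at e₂
  simp only [Regs.val_head, Regs.val_b₀, Regs.val_b₁, Regs.val_b₂, zero_add,
    Layout.enc_cell (Y := Y) (show 8 ≤ l by simp only at hL; omega)] at e₀ e₁ e₂
  exact e₀.seq (e₁.seq e₂)


/-- The tapes after the first `k` of the three bits `w` have been written on cell `h`. -/
def writeUpTo (A : Tapes) (h : ℕ) (w : Fin 3 → Bool) (k : ℕ) : Tapes :=
  fun i n => if n = h ∧ (i : ℕ) < k then w i else A i n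

theorem exists_write_bit (Y : Layout) (i : Fin 3) : ∃ C, ∀ L ≥ C, ∃ P : Frag,
    ∀ I T A (s : Fin 3 → Bool) (R : Regs), (∀ k ≤ 3, Ctx I 8 L (Y.enc L T (writeUpTo A R.head s k))) →
      R.len = L → R.bit = 0 →
      s = writeOf R.code R.state (bitsOf ![R.b₀, R.b₁, R.b₂]) →
      Exec I P (0, put 8 L (Y.enc L T (writeUpTo A R.head s i)) R.val)
        (0, put 8 L (Y.enc L T (writeUpTo A R.head s (i + 1))) R.val) := by
  obtain ⟨C₁, hC₁⟩ := exists_compute (primrec_write i)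
  obtain ⟨C₂, hC₂⟩ := exists_write (Y.mode_lt_eight i)
  refine ⟨24 + C₁ + C₂, fun L hL => ?_⟩
  have hlow (hi : Y.tape i = 1) : 0 < Y.mode i ∧ Y.mode i < 8 :=
    ⟨by have := Y.low i hi; omega, Y.mode_lt_eight i⟩
  obtain ⟨P, hP⟩ := hC₁ L (by omega) 8 ![9, 10, 13, 14, 15] 21
    (by intro i; fin_cases i <;> simp) (by omega) (by omega)
  obtain ⟨W₁, hW₁⟩ := hC₂ L (by omega) 8 le_rfl (Y.tape i) true hlow
  obtain ⟨W₀, hW₀⟩ := hC₂ L (by omega) 8 le_rfl (Y.tape i) false hlow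
  refine ⟨P ;; iteReg 21 W₁ W₀ ;; zero L 21, ?_⟩
  intro I T A w R hX hlen hbit hw
  have e₁ := hP R.val (by simpa using hbit) (fun _ => R.high) I _ (hX i (by omega))
  simp only [Regs.update_bit, List.Vector.get_ofFn, vecBits, Matrix.cons_val, Regs.val_code,
    Regs.val_state, Regs.val_b₀, Regs.val_b₁, Regs.val_b₂] at e₁
  rw [← hw] at e₁
  have hupd : writeCell (Y.enc L T (writeUpTo A R.head w i)) (Y.tape i) (addr L (Y.mode i) R.head)
      (w i) = Y.enc L T (writeUpTo A R.head w (i + 1)) := by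
    rw [Layout.enc_write (by omega)]
    congr 1
    funext j n
    simp only [writeCell, writeUpTo]
    by_cases hn : n = R.head
    · by_cases hj : j = i
      · simp [hn, hj]
      · have : (j : ℕ) ≠ i := fun e => hj (Fin.ext e)
        simp only [hn, hj, true_and, false_and, if_false]
        by_cases h1 : (j : ℕ) < i
        · rw [if_pos h1, if_pos (by omega)]
        · rw [if_neg h1, if_neg (by omega)]
    · simp [hn]
  have hc' := hX (i + 1) (by omega)
  have hr := Regs.ready { R with bit := (w i).toNat } hlen
  refine e₁.seq (Exec.seq (exec_iteReg (c := (0, put 8 L (Y.enc L T (writeUpTo A R.head w (i + 1)))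
    { R with bit := (w i).toNat }.val)) (hX i (by omega)) (by omega) (by omega) (fun h => ?_)
      fun h => ?_) ?_)
  · have hwi : w i = true := by
      cases hh : w i
      · simp [hh] at h
      · rfl
    rw [hwi] at hupd hr ⊢
    have := hW₁ I (Y.enc L T (writeUpTo A R.head w i)) _ (hX i (by omega)) (by rwa [Regs.val_head, hupd]) hr
    simpa only [Regs.val_head, hupd] using this
  · have hwi : w i = false := by simpa using h
    rw [hwi] at hupd hr ⊢
    have := hW₀ I (Y.enc L T (writeUpTo A R.head w i)) _ (hX i (by omega)) (by rwa [Regs.val_head, hupd]) hr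
    simpa only [Regs.val_head, hupd] using this
  · have := does_zero (v := { R with bit := (w i).toNat }.val)
      (show 8 ≤ 21 by omega) (show 21 < L by omega) I _ hc'
    rw [Regs.update_bit] at this
    have hR : { R with bit := 0 } = R := by rw [← hbit]
    rwa [hR] at this

theorem exists_next : ∃ C, ∀ L ≥ C, ∃ P : Frag, ∀ R : Regs, R.state' = 0 → R.head' = 0 →
    Does 8 L P R.val { R with
      state' := nextOf R.code R.state (bitsOf ![R.b₀, R.b₁, R.b₂])
      head' := if moveOf R.code R.state (bitsOf ![R.b₀, R.b₁, R.b₂]) then R.head + 1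
        else R.head - 1 }.val := by
  obtain ⟨C₂, hC₂⟩ := exists_compute primrec_next
  obtain ⟨C₃, hC₃⟩ := exists_compute primrec_head
  refine ⟨24 + C₂ + C₃, fun L hL => ?_⟩
  obtain ⟨P₂, h₂⟩ := hC₂ L (by omega) 8 ![9, 10, 13, 14, 15] 19
    (by intro i; fin_cases i <;> simp) (by omega) (by omega)
  obtain ⟨P₃, h₃⟩ := hC₃ L (by omega) 8 ![9, 10, 13, 14, 15, 11] 20
    (by intro i; fin_cases i <;> simp) (by omega) (by omega)
  refine ⟨P₂ ;; P₃, fun R hs hh => ?_⟩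
  have e₂ := h₂ R.val (by simpa using hs) (fun _ => R.high)
  simp only [Regs.update_state', List.Vector.get_ofFn, vecBits, Matrix.cons_val, Regs.val_code,
    Regs.val_state, Regs.val_b₀, Regs.val_b₁, Regs.val_b₂] at e₂
  have e₃ := h₃ { R with state' := nextOf R.code R.state (bitsOf ![R.b₀, R.b₁, R.b₂]) }.val
    (by simpa using hh) (fun _ => Regs.high _)
  simp only [Regs.update_head', List.Vector.get_ofFn, vecBits, Matrix.cons_val, Regs.val_code,
    Regs.val_state, Regs.val_b₀, Regs.val_b₁, Regs.val_b₂, Regs.val_head] at e₃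
  exact e₂.seq e₃

theorem exists_shift : ∃ C, ∀ L ≥ C, ∃ P : Frag, ∀ R : Regs, R.len = L → R.bit = 0 →
    Does 8 L P R.val (simRegs L R.code R.state' R.head').val := by
  obtain ⟨C, hC⟩ := exists_compute primrec_running
  refine ⟨24 + C, fun L hL => ?_⟩
  obtain ⟨P, hP⟩ := hC L (by omega) 8 ![9, 10] 12
    (by intro i; fin_cases i <;> simp) (by omega) (by omega)
  refine ⟨zero L 10 ;; copy L 19 10 ;; zero L 11 ;; copy L 20 11 ;; zero L 12 ;; zero L 13 ;;
    zero L 14 ;; zero L 15 ;; zero L 19 ;; zero L 20 ;; P, ?_⟩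
  rintro ⟨l, m, s, h, r, b₀, b₁, b₂, s', h', b⟩ (rfl : l = L) (rfl : b = 0)
  have z (r : ℕ) (h8 : 8 ≤ r) (hr : r < 24) (v : ℕ → ℕ) := does_zero (v := v) h8 (show r < l by omega)
  have f₁ := z 10 (by omega) (by omega) (Regs.val ⟨l, m, s, h, r, b₀, b₁, b₂, s', h', 0⟩)
  have f₂ := does_copy (v := Regs.val ⟨l, m, 0, h, r, b₀, b₁, b₂, s', h', 0⟩) (show 8 ≤ 10 by omega)
    (show 10 < l by omega) (by simp) (show 8 ≤ 19 by omega) (show 19 < l by omega) (by omega)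
  have f₃ := z 11 (by omega) (by omega) (Regs.val ⟨l, m, s', h, r, b₀, b₁, b₂, s', h', 0⟩)
  have f₄ := does_copy (v := Regs.val ⟨l, m, s', 0, r, b₀, b₁, b₂, s', h', 0⟩) (show 8 ≤ 11 by omega)
    (show 11 < l by omega) (by simp) (show 8 ≤ 20 by omega) (show 20 < l by omega) (by omega)
  have f₅ := z 12 (by omega) (by omega) (Regs.val ⟨l, m, s', h', r, b₀, b₁, b₂, s', h', 0⟩)
  have f₆ := z 13 (by omega) (by omega) (Regs.val ⟨l, m, s', h', 0, b₀, b₁, b₂, s', h', 0⟩)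
  have f₇ := z 14 (by omega) (by omega) (Regs.val ⟨l, m, s', h', 0, 0, b₁, b₂, s', h', 0⟩)
  have f₈ := z 15 (by omega) (by omega) (Regs.val ⟨l, m, s', h', 0, 0, 0, b₂, s', h', 0⟩)
  have f₉ := z 19 (by omega) (by omega) (Regs.val ⟨l, m, s', h', 0, 0, 0, 0, s', h', 0⟩)
  have f₁₀ := z 20 (by omega) (by omega) (Regs.val ⟨l, m, s', h', 0, 0, 0, 0, 0, h', 0⟩)
  have f₁₁ := hP (Regs.val ⟨l, m, s', h', 0, 0, 0, 0, 0, 0, 0⟩) (by simp) (fun _ => Regs.high _)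
  simp only [Regs.update_state, Regs.update_head, Regs.update_run, Regs.update_b₀, Regs.update_b₁,
    Regs.update_b₂, Regs.update_state', Regs.update_head', Regs.val_state', Regs.val_head',
    List.Vector.get_ofFn, Matrix.cons_val, Regs.val_code, Regs.val_state]
    at f₁ f₂ f₃ f₄ f₅ f₆ f₇ f₈ f₉ f₁₀ f₁₁
  exact f₁.seq (f₂.seq (f₃.seq (f₄.seq (f₅.seq (f₆.seq (f₇.seq (f₈.seq (f₉.seq (f₁₀.seq f₁₁)))))))))

theorem exists_step (Y : Layout) : ∃ C, ∀ L ≥ C, ∃ B : Frag,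
    ∀ (I : Tapes → Prop) (T : Tapes) (m : ℕ) (σ : Snapshot (prog m).Q),
    (∀ n, T 1 (L * n) = decide (n = 0)) →
    (∀ X, (∀ t c, ¬ (t = 1 ∧ 8 ≤ c % L) → X t c = Y.enc L T σ.tape t c ∨
      X t c = Y.enc L T ((prog m).stepSnap σ).tape t c) → I X) →
    Exec I B (0, put 8 L (Y.enc L T σ.tape) (simRegs L m σ.state σ.head).val)
      (0, put 8 L (Y.enc L T ((prog m).stepSnap σ).tape)
        (simRegs L m ((prog m).stepSnap σ).state ((prog m).stepSnap σ).head).val) := by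
  obtain ⟨C₁, hC₁⟩ := exists_read_bits Y
  obtain ⟨C₂, hC₂⟩ := exists_next
  choose C₃ hC₃ using exists_write_bit Y
  obtain ⟨C₄, hC₄⟩ := exists_shift
  refine ⟨24 + C₁ + C₂ + C₃ 0 + C₃ 1 + C₃ 2 + C₄, fun L hL => ?_⟩
  obtain ⟨P₁, h₁⟩ := hC₁ L (by omega)
  obtain ⟨P₂, h₂⟩ := hC₂ L (by omega)
  obtain ⟨W₀, k₀⟩ := hC₃ 0 L (by omega)
  obtain ⟨W₁, k₁⟩ := hC₃ 1 L (by omega)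
  obtain ⟨W₂, k₂⟩ := hC₃ 2 L (by omega)
  obtain ⟨P₃, h₃⟩ := hC₄ L (by omega)
  refine ⟨P₁ ;; P₂ ;; W₀ ;; W₁ ;; W₂ ;; P₃, fun I T m σ hT hI => ?_⟩
  obtain ⟨s, h, A⟩ := σ
  set b : Fin 3 → Bool := fun i => A i h with hb
  rcases htr : (prog m).trans (s, b) with ⟨s', w, d⟩
  have hstep : (prog m).stepSnap ⟨s, h, A⟩ =
      ⟨s', if d then h + 1 else h - 1, writeUpTo A h w 3⟩ := by
    simp only [Machine.stepSnap, ← hb, htr, Snapshot.mk.injEq, true_and]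
    funext i n
    simp [writeUpTo, i.is_lt]
  have hbits := transOf_val s b
  rw [htr] at hbits
  have hnext : nextOf m s (bitsOf ![(b 0).toNat, (b 1).toNat, (b 2).toNat]) = s' := by
    rw [nextOf, hbits]
  have hwrite : writeOf m s (bitsOf ![(b 0).toNat, (b 1).toNat, (b 2).toNat]) = w := by
    rw [writeOf, hbits]
  have hmove : moveOf m s (bitsOf ![(b 0).toNat, (b 1).toNat, (b 2).toNat]) = d := by
    rw [moveOf, hbits]
  rw [hstep] at hI ⊢
  dsimp only at hI ⊢
  have hX (k : ℕ) : Ctx I 8 L (Y.enc L T (writeUpTo A h w k)) := by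
    refine ⟨by omega, by omega, fun n => ?_, fun v => hI _ fun t c htc => ?_⟩
    · rw [Layout.enc_low (by omega) _ _ (.inl (by simp)), hT]
    · rw [put, if_neg htc]
      refine Layout.enc_or T (fun i n => ?_) t c
      unfold writeUpTo
      split_ifs <;> simp_all
  have hA : writeUpTo A h w 0 = A := by
    funext i n
    simp [writeUpTo]
  have hX₀ := hX 0
  rw [hA] at hX₀
  have e₁ := h₁ I T A (simRegs L m s h) hX₀ rfl rfl rfl rfl
  have e₂ := h₂ { simRegs L m s h with
    b₀ := (A 0 (simRegs L m s h).head).toNat, b₁ := (A 1 (simRegs L m s h).head).toNat, b₂ := (A 2 (simRegs L m s h).head).toNat } rfl rfl I _ hX₀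
  generalize hR : ({ simRegs L m s h with
    b₀ := (A 0 (simRegs L m s h).head).toNat, b₁ := (A 1 (simRegs L m s h).head).toNat, b₂ := (A 2 (simRegs L m s h).head).toNat } : Regs) = R at e₁ e₂
  have hcode : R.code = m := by rw [← hR]; rfl
  have hhead : R.head = h := by rw [← hR]; rfl
  have hlen : R.len = L := by rw [← hR]; rfl
  have hbit : R.bit = 0 := by rw [← hR]; rfl
  rw [show nextOf R.code R.state (bitsOf ![R.b₀, R.b₁, R.b₂]) = s' by rw [← hR]; exact hnext,
    show moveOf R.code R.state (bitsOf ![R.b₀, R.b₁, R.b₂]) = d by rw [← hR]; exact hmove,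
    hhead] at e₂
  have hw : w = writeOf R.code R.state (bitsOf ![R.b₀, R.b₁, R.b₂]) := by
    rw [← hR]; exact hwrite.symm
  generalize (if d = true then h + 1 else h - 1) = h' at e₂
  have w₀ := k₀ I T A w { R with state' := s', head' := h' } (fun k _ => hhead ▸ hX k) hlen hbit hw
  have w₁ := k₁ I T A w { R with state' := s', head' := h' } (fun k _ => hhead ▸ hX k) hlen hbit hw
  have w₂ := k₂ I T A w { R with state' := s', head' := h' } (fun k _ => hhead ▸ hX k) hlen hbit hw
  rw [hcode] at e₂
  have e₃ := h₃ { R with state' := s', head' := h' } hlen hbit I _ (hX 3)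
  simp only [hhead, hcode, Fin.isValue, Fin.val_zero, Fin.val_one, Fin.val_two, zero_add,
    Nat.reduceAdd, hA] at w₀ w₁ w₂ e₃
  exact e₁.seq (e₂.seq (w₀.seq (w₁.seq (w₂.seq e₃))))

namespace Machine

variable {M : Machine} {x : R}

theorem snap_add_omega {δ : Ordinal.{0}} {S : ℕ → Snapshot M.Q} (hS : ∀ k : ℕ, M.snap x (δ + k) = S k)
    {X : Tapes} (hX : ∀ i n, ∃ N, ∀ k ≥ N, (S k).tape i n = X i n) :
    M.snap x (δ + Ordinal.omega0) = ⟨M.limit, 0, X⟩ := by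
  have hlim : Order.IsSuccLimit (δ + Ordinal.omega0) :=
    Ordinal.isSuccLimit_add δ Ordinal.isSuccLimit_omega0
  rw [snap_limit _ _ hlim]
  congr 1
  funext i n
  obtain ⟨N, hN⟩ := hX i n
  have hlt (k : ℕ) : δ + k < δ + Ordinal.omega0 := by
    simp
  cases hb : X i n
  · rw [decide_eq_false_iff_not]
    intro h
    obtain ⟨γ, h1, h2, h3⟩ := h _ (hlt N)
    obtain ⟨ε, rfl⟩ := exists_add_of_le ((le_self_add).trans h1)
    obtain ⟨k, rfl⟩ := Ordinal.lt_omega0.1 (by simpa using h2)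
    rw [hS, hN k (by simpa using h1), hb] at h3
    exact absurd h3 (by simp)
  · rw [decide_eq_true_eq]
    intro β hβ
    rcases le_total β δ with h | h
    · exact ⟨δ + N, h.trans le_self_add, hlt N, by rw [hS, hN N le_rfl, hb]⟩
    · obtain ⟨ε, rfl⟩ := exists_add_of_le h
      obtain ⟨k, rfl⟩ := Ordinal.lt_omega0.1 (by simpa using hβ)
      refine ⟨δ + (max k N : ℕ), ?_, hlt _, by rw [hS, hN _ (le_max_right _ _), hb]⟩
      simp

variable (M x) in
/-- Between stages `δ` and `γ` the computation does not halt and `I` is true of the tapes. -/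
structure Stays (I : Tapes → Prop) (δ γ : Ordinal.{0}) : Prop where
  le : δ ≤ γ
  stays : ∀ ξ, δ ≤ ξ → ξ < γ → (M.snap x ξ).state ≠ M.halt ∧ I (M.snap x ξ).tape

theorem Stays.trans {I : Tapes → Prop} {α β γ : Ordinal.{0}} (h1 : M.Stays x I α β)
    (h2 : M.Stays x I β γ) : M.Stays x I α γ :=
  ⟨h1.le.trans h2.le, fun ξ ha hb => (lt_or_ge ξ β).elim (h1.stays ξ ha) fun h => h2.stays ξ h hb⟩

theorem Run.stays {I : Tapes → Prop} {S S' : Snapshot M.Q} (hr : M.Run I S S')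
    {γ : Ordinal.{0}} (hγ : M.snap x γ = S) : ∃ δ, M.Stays x I γ δ ∧ M.snap x δ = S' := by
  obtain ⟨n, -, hn, h⟩ := hr.stage hγ
  refine ⟨γ + n, ⟨le_self_add, fun ξ h1 h2 => ?_⟩, hn⟩
  obtain ⟨k, hk, rfl⟩ := exists_nat_of_lt_add h1 h2
  exact h k hk

end Machine

/-- Walk to the right forever, clearing the registers from `8` on, for blocks of length `n + 1`. -/
def sweep (n : ℕ) : Frag where
  σ := Fin (n + 1)
  fin := inferInstance
  entry := 0
  tr j b := (some (j + 1), if 8 ≤ (j : ℕ) then setBit 1 false b else b, true)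

/-- The tapes after `k` steps of a sweep. -/
def swept (L : ℕ) (X : Tapes) (k : ℕ) : Tapes :=
  fun t c => if t = 1 ∧ 8 ≤ c % L ∧ c < k then false else X t c

theorem sweep_stays {M : Machine} {x : R} {n : ℕ} {ι : Fin (n + 1) → Fin (M.Q + 1)}
    {e : Fin (M.Q + 1)} (hE : Emb M (sweep n) ι e) {I : Tapes → Prop} {X : Tapes}
    (hI : ∀ k, I (swept (n + 1) X k)) {δ : Ordinal.{0}} (hδ : M.snap x δ = ⟨ι 0, 0, X⟩) :
    M.Stays x I δ (δ + Ordinal.omega0) ∧ M.snap x (δ + Ordinal.omega0) =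
      ⟨M.limit, 0, put 8 (n + 1) X fun _ => 0⟩ := by
  have hS (k : ℕ) : M.snap x (δ + k) = ⟨ι (Fin.ofNat _ k), k, swept (n + 1) X k⟩ := by
    induction k with
    | zero =>
      rw [Nat.cast_zero, add_zero, hδ]
      congr 1
      funext t c
      simp [swept]
    | succ k ih =>
      have h := (hE.step (Fin.ofNat _ k) k _ (hI k)).2.2
      rw [Nat.cast_add, Nat.cast_one, ← add_assoc, Machine.snap_succ, ih, ← h]
      simp only [sweep, Option.elim_some, if_true, Snapshot.mk.injEq, true_and]
      constructor
      · congr 1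
        ext
        simp [Fin.val_add]
      · funext t c
        simp only [writeAt, swept, Fin.ofNat]
        by_cases hc : c = k
        · subst hc
          simp only [if_true, lt_irrefl, and_false, if_false, Nat.lt_succ_self, and_true]
          by_cases h8 : 8 ≤ c % (n + 1)
          · by_cases ht : t = 1 <;> simp [h8, ht, setBit]
          · simp [h8]
        · rw [if_neg hc]
          simp only [show c < k + 1 ↔ c < k by omega]
  refine ⟨⟨le_self_add, fun ξ h1 h2 => ?_⟩, Machine.snap_add_omega hS fun t c => ⟨c + 1, fun k hk => ?_⟩⟩
  · obtain ⟨ε, rfl⟩ := exists_add_of_le h1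
    obtain ⟨k, rfl⟩ := Ordinal.lt_omega0.1 (by simpa using h2)
    rw [hS]
    exact ⟨(hE (Fin.ofNat _ k) fun _ => false).1, hI k⟩
  · simp only [swept, put, show c < k by omega, and_true, Nat.not_lt_zero, decide_false]

theorem Emb.ite_run_pos {M : Machine} {t : (Fin 3 → Bool) → Bool} {P Q : Frag}
    {ι : (ite t P Q).σ → Fin (M.Q + 1)} {e : Fin (M.Q + 1)} (hE : Emb M (ite t P Q) ι e)
    {I : Tapes → Prop} {h : ℕ} {T : Tapes} (hI : I T) (ht : t (fun i => T i h) = true) :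
    M.Run I ⟨ι (.inl none), h, T⟩ ⟨ι (.inr (.inl P.entry)), h, T⟩ := by
  have := hE.ite_run (h := h) hI
  rwa [ht] at this

theorem Emb.ite_run_neg {M : Machine} {t : (Fin 3 → Bool) → Bool} {P Q : Frag}
    {ι : (ite t P Q).σ → Fin (M.Q + 1)} {e : Fin (M.Q + 1)} (hE : Emb M (ite t P Q) ι e)
    {I : Tapes → Prop} {h : ℕ} {T : Tapes} (hI : I T) (ht : t (fun i => T i h) = false) :
    M.Run I ⟨ι (.inl none), h, T⟩ ⟨ι (.inr (.inr Q.entry)), h, T⟩ := by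
  have := hE.ite_run (h := h) hI
  rwa [ht] at this

theorem does_incs {lo L r : ℕ} {v : ℕ → ℕ} (h1 : lo ≤ r) (h2 : r < L) (k : ℕ) :
    Does lo L (rep (inc L r) k) v (update v r (v r + k)) := by
  induction k generalizing v with
  | zero => simpa [rep] using does_nop
  | succ k ih =>
    have := (does_inc (v := v) h1 h2).seq (ih (v := update v r (v r + 1)))
    simpa [rep, add_assoc, add_comm 1 k] using this

theorem Regs.val_default : Regs.val {} = fun _ => 0 := by
  funext r
  unfold Regs.val
  simp

theorem exists_boot {g : ℕ → ℕ} (hg : Primrec fun v : List.Vector ℕ 1 => g (v.get 0)) :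
    ∃ C, ∀ L ≥ C, ∃ P, ∀ I T m, Ctx I 8 L T → (∀ n, T 1 (L * n + 7) = decide (n < m)) →
      Exec I P (0, put 8 L T fun _ => 0) (0, put 8 L T (simRegs L m (g m) 0).val) := by
  obtain ⟨C₁, hC₁⟩ := exists_compute hg
  obtain ⟨C₂, hC₂⟩ := exists_compute primrec_running
  refine ⟨24 + C₁ + C₂, fun L hL => ?_⟩
  obtain ⟨P₁, h₁⟩ := hC₁ L (by omega) 8 ![9] 10
    (by intro i; fin_cases i; simp) (by omega) (by omega)
  obtain ⟨P₂, h₂⟩ := hC₂ L (by omega) 8 ![9, 10] 12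
    (by intro i; fin_cases i <;> simp) (by omega) (by omega)
  refine ⟨rep (inc L 8) L ;; copy L 7 9 ;; P₁ ;; P₂, fun I T m hC hm => ?_⟩
  have e₁ := does_incs (v := Regs.val {}) (le_refl 8) (show 8 < L by omega) L I T hC
  have e₂ := exec_copy (v := Regs.val { len := L }) (s := 7) (d := 9) (k := m) hC (by omega) (by omega)
    (by simp) fun j n => by rw [put_low (by omega) (by omega), hm]
  have e₃ := h₁ (Regs.val { len := L, code := m }) (by simp) (fun _ => Regs.high _) I T hC
  have e₄ := h₂ (Regs.val { len := L, code := m, state := g m }) (by simp) (fun _ => Regs.high _) I T hC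
  simp only [Regs.update_len, Regs.val_len, zero_add, Regs.update_code, Regs.update_state,
    Regs.update_run, List.Vector.get_ofFn, Matrix.cons_val, Regs.val_code, Regs.val_state]
    at e₁ e₂ e₃ e₄
  rw [← Regs.val_default]
  exact e₁.seq (e₂.seq (e₃.seq e₄))

/-- The cells that hold no registers, apart from the flag. -/
def Kept (L : ℕ) (t : Fin 3) (c : ℕ) : Prop := ¬ (t = 1 ∧ 8 ≤ c % L) ∧ ¬ (t = 1 ∧ c = 1)

/-- The program that simulates a first program with steps `Bq` and then a second one with steps `Bm`,
where `P` prepares the first simulation, `N` the second one, and `S` prepares the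
simulation of a limit stage after the registers have been swept. -/
def host (L : ℕ) (Bq Bm S P N : Frag) : Frag :=
  ite (isOne 1)
    (right ;; ite (isOne 1) (act (setBit 1 false) false ;; sweep (L - 1))
      (act (setBit 1 true) false ;; S)) P ;;
  rep right 2 ;; ite (isOne 1) (rep left 2) (rep left 2 ;; whileReg 12 Bq ;; N) ;; whileReg 12 Bm

/-- The state of `host` after the preparations. -/
def hostReady (L : ℕ) (Bq Bm S P N : Frag) : (host L Bq Bm S P N).σ := .inr (.inl (rep right 2).entry)

/-- The tapes and registers that represent the snapshot `σ` of program `m`. -/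
noncomputable def Layout.tapes (Y : Layout) (L : ℕ) (T : Tapes) {m : ℕ} (σ : Snapshot (prog m).Q) :
    Tapes :=
  put 8 L (Y.enc L T σ.tape) (simRegs L m σ.state σ.head).val

/-- The data around a simulation of program `m`. -/
structure Frame (L m : ℕ) (T : Tapes) : Prop where
  mark : ∀ n, T 1 (L * n) = decide (n = 0)
  flag : T 1 1 = true
  code : ∀ n, T 1 (L * n + 7) = decide (n < m)

section host

variable {U : Machine} {y : R} {L m : ℕ} {T : Tapes} {Bq Bm S P N : Frag}
  {ι : (host L Bq Bm S P N).σ → Fin (U.Q + 1)} {e : Fin (U.Q + 1)}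

theorem Frame.ctx (hF : Frame L m T) (hL : 8 < L) (Y : Layout) (A : Tapes) :
    Ctx (fun X => ∀ t c, Kept L t c → X t c = Y.enc L T A t c) 8 L (Y.enc L T A) := by
  refine ⟨by omega, hL, fun n => ?_, fun w t c h => ?_⟩
  · rw [Layout.enc_low (by omega) _ _ (.inl (by simp)), hF.mark]
  · rw [put, if_neg h.1]

theorem host_limit (hE : Emb U (host L Bq Bm S P N) ι e) (hlim : U.limit = ι (host L Bq Bm S P N).entry)
    (hL : 8 < L) (hF : Frame L m T) (Y : Layout)
    (hS : ∀ I T, Ctx I 8 L T → (∀ n, T 1 (L * n + 7) = decide (n < m)) →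
      Exec I S (0, put 8 L T fun _ => 0) (0, put 8 L T (simRegs L m (limitOf m) 0).val))
    {A X : Tapes} {δ : Ordinal.{0}} (hδ : U.snap y δ = ⟨U.limit, 0, X⟩)
    (hX : ∀ t c, Kept L t c → X t c = Y.enc L T A t c) (hX1 : X 1 1 = true) :
    ∃ γ, U.Stays y (fun X => ∀ t c, Kept L t c → X t c = Y.enc L T A t c) δ γ ∧
      U.snap y γ = ⟨ι (hostReady L Bq Bm S P N), 0,
        Y.tapes L T (⟨(prog m).limit, 0, A⟩ : Snapshot (prog m).Q)⟩ := by
  obtain ⟨n, rfl⟩ : ∃ n, L = n + 1 := ⟨L - 1, by omega⟩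
  have hE₁ := hE.seq_left
  have hE₂ := hE₁.ite_then
  have hE₃ := hE₂.seq_right
  have hm0 : (0 : ℕ) % (n + 1) = 0 := by simp
  have hm1 : (1 : ℕ) % (n + 1) = 1 := Nat.mod_eq_of_lt (by omega)
  have hk0 : Kept (n + 1) 1 0 := by simp [Kept, hm0]
  have hZ {X : Tapes} (hX : ∀ t c, Kept (n + 1) t c → X t c = Y.enc (n + 1) T A t c) : X 1 0 = true := by
    rw [hX _ _ hk0, Layout.enc_low (by omega) _ _ (.inl (by simp))]
    simpa using hF.mark 0
  set I : Tapes → Prop := fun X => ∀ t c, Kept (n + 1) t c → X t c = Y.enc (n + 1) T A t c with hIdef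
  have hIk {X X' : Tapes} (hX : I X) (h : ∀ t c, Kept (n + 1) t c → X' t c = X t c) : I X' :=
    fun t c hk => (h t c hk).trans (hX t c hk)
  have hIw {X : Tapes} (hX : I X) (b : Bool) : I (writeCell X 1 1 b) :=
    hIk hX fun t c hk => by rw [writeCell, if_neg hk.2]
  have hIp {X : Tapes} (hX : I X) : I (put 8 (n + 1) X fun _ => 0) :=
    hIk hX fun t c hk => by rw [put, if_neg hk.1]
  have hrun (X : Tapes) (hX : I X) : U.Run I ⟨U.limit, 0, X⟩ ⟨_, 1, X⟩ :=
    hlim ▸ (hE₁.ite_run_pos (h := 0) hX (hZ hX)).trans (exec_right hX 0 _ _ _ hE₂.seq_left)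
  -- the flag is set: clear it and sweep
  have a₁ := exec_act (I := I) (setBit 1 false) false 1 X hX _ _ _ hE₃.ite_then.seq_left
  obtain ⟨δ₁, s₁, hδ₁⟩ := Machine.Run.stays
    (((hrun X hX).trans (hE₃.ite_run_pos (h := 1) hX hX1)).trans a₁) hδ
  rw [writeAt_setBit] at hδ₁
  obtain ⟨s₂, hδ₂⟩ := sweep_stays hE₃.ite_then.seq_right (I := I) (X := writeCell X 1 1 false)
    (fun k => hIk (hIw hX false) fun t c hk => by
      rw [swept, if_neg fun h => hk.1 ⟨h.1, h.2.1⟩]) hδ₁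
  -- the flag is not set: set it and prepare the simulation
  set X' := put 8 (n + 1) (writeCell X 1 1 false) fun _ => 0 with hX'
  have hIX' : I X' := hIp (hIw hX false)
  have hX'1 : X' 1 1 = false := by simp [hX', put, hm1, writeCell]
  have a₂ := exec_act (I := I) (setBit 1 true) false 1 X' hIX' _ _ _ hE₃.ite_else.seq_left
  have hw : writeAt X' 1 (setBit 1 true fun i => X' i 1) =
      put 8 (n + 1) (Y.enc (n + 1) T A) fun _ => 0 := by
    rw [writeAt_setBit]
    funext t c
    by_cases h1 : t = 1 ∧ c = 1
    · obtain ⟨rfl, rfl⟩ := h1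
      simp [put, hm1, Layout.enc_low (Y := Y) (show 8 ≤ n + 1 by omega) T A (c := 1)
        (.inl (by omega)), hF.flag]
    · rw [if_neg h1, hX', put, put]
      split_ifs with h2
      · rfl
      · rw [writeCell, if_neg h1]
        exact hX t c ⟨h2, h1⟩
  rw [hw] at a₂
  have a₃ := hS I (Y.enc (n + 1) T A) (hF.ctx hL Y A)
    (fun k => by rw [Layout.enc_low (by omega) _ _
      (.inr (by rw [Nat.mul_add_mod, Nat.mod_eq_of_lt (by omega)])), hF.code])
    _ _ _ hE₃.ite_else.seq_right
  obtain ⟨δ₃, s₃, hδ₃⟩ := Machine.Run.stays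
    ((((hrun X' hIX').trans (hE₃.ite_run_neg (h := 1) hIX' hX'1)).trans a₂).trans a₃) hδ₂
  exact ⟨δ₃, (s₁.trans s₂).trans s₃, hδ₃⟩

end host

/-- The fragment `B` simulates one step of any program. -/
def Steps (Y : Layout) (L : ℕ) (B : Frag) : Prop :=
  ∀ (I : Tapes → Prop) (T : Tapes) (m : ℕ) (σ : Snapshot (prog m).Q),
    (∀ n, T 1 (L * n) = decide (n = 0)) →
    (∀ X, (∀ t c, ¬ (t = 1 ∧ 8 ≤ c % L) → X t c = Y.enc L T σ.tape t c ∨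
      X t c = Y.enc L T ((prog m).stepSnap σ).tape t c) → I X) →
    Exec I B (0, Y.tapes L T σ) (0, Y.tapes L T ((prog m).stepSnap σ))

/-- The fragment `S` sets up the registers for the simulation of a program that is in the state given
by `g`. -/
def Boots (g : ℕ → ℕ) (L : ℕ) (S : Frag) : Prop :=
  ∀ I T m, Ctx I 8 L T → (∀ n, T 1 (L * n + 7) = decide (n < m)) →
    Exec I S (0, put 8 L T fun _ => 0) (0, put 8 L T (simRegs L m (g m) 0).val)

/-- The loop of the simulation. -/
def simLoop (B : Frag) : Frag := whl (isOne 1) (rep left 12 ;; B ;; rep right 12)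

section simulation

variable {U : Machine} {x y : R} {L m : ℕ} {T : Tapes} {Bq Bm S P N B : Frag} {Y : Layout}
  {ι : (host L Bq Bm S P N).σ → Fin (U.Q + 1)} {e : Fin (U.Q + 1)}
  {κ : (simLoop B).σ → Fin (U.Q + 1)} {e' : Fin (U.Q + 1)}

theorem Layout.tapes_run (hL : 12 < L) (σ : Snapshot (prog m).Q) :
    Y.tapes L T σ 1 12 = decide (σ.state ≠ (prog m).halt) := by
  have := put_reg (T := Y.enc L T σ.tape) (v := (simRegs L m σ.state σ.head).val)
    (show 8 ≤ 12 by omega) hL 0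
  rw [Layout.tapes, ← show L * 0 + 12 = 12 by omega, this, Regs.val_run, simRegs]
  by_cases h : σ.state = (prog m).halt
  · simp [haltOf, h]
  · simp [haltOf, Fin.val_inj, h]

theorem Layout.tapes_kept (σ : Snapshot (prog m).Q) {t : Fin 3} {c : ℕ} (h : ¬ (t = 1 ∧ 8 ≤ c % L)) :
    Y.tapes L T σ t c = Y.enc L T σ.tape t c := by
  rw [Layout.tapes, put, if_neg h]

theorem host_simulation (hE : Emb U (host L Bq Bm S P N) ι e)
    (hlim : U.limit = ι (host L Bq Bm S P N).entry) (hL : 12 < L) (hF : Frame L m T)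
    (hS : Boots limitOf L S) (hB : Steps Y L B) (hκ : Emb U (simLoop B) κ e')
    (hready : ∀ A (σ : Snapshot (prog m).Q), σ.tape = A →
      U.Run (fun X => ∀ t c, Kept L t c → X t c = Y.enc L T A t c)
        ⟨ι (hostReady L Bq Bm S P N), 0, Y.tapes L T σ⟩ ⟨κ (simLoop B).entry, 12, Y.tapes L T σ⟩)
    {γ₀ : Ordinal.{0}}
    (hγ₀ : U.snap y γ₀ = ⟨κ (simLoop B).entry, 12, Y.tapes L T ((prog m).init x)⟩) :
    Simulation U (prog m) y x γ₀ (Kept L) (Y.enc L T)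
      (fun σ => ⟨κ (simLoop B).entry, 12, Y.tapes L T σ⟩) where
  init := by rw [hγ₀, Machine.snap_zero]
  kept σ t c h := Layout.tapes_kept σ h.1
  flag σ := by
    have h1 : 1 % L = 1 := Nat.mod_eq_of_lt (by omega)
    change Y.tapes L T σ 1 1 = true
    rw [Layout.tapes_kept σ (by omega), Layout.enc_low (by omega) _ _ (.inl (by omega)), hF.flag]
  cell t c _ := by
    unfold Layout.enc Function.extend
    by_cases h : ∃ p, Y.cell L p = (t, c)
    · simp only [dif_pos h]
      exact .inr ⟨_, _, fun _ => rfl⟩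
    · simp only [dif_neg h]
      exact .inl ⟨_, fun _ => rfl⟩
  step σ hσ := by
    set I : Tapes → Prop := fun X => ∀ t c, Kept L t c →
      X t c = Y.enc L T σ.tape t c ∨ X t c = Y.enc L T ((prog m).stepSnap σ).tape t c
    have hI : ∀ X : Tapes, (∀ t c, ¬ (t = 1 ∧ 8 ≤ c % L) → X t c = Y.enc L T σ.tape t c ∨
        X t c = Y.enc L T ((prog m).stepSnap σ).tape t c) → I X :=
      fun X h t c hk => h t c hk.1
    have h1 := exec_lefts (I := I) (hI (Y.tapes L T σ) fun t c h => .inl (Layout.tapes_kept σ h)) 0 12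
    have h2 := hB _ T m σ hF.mark hI
    have h3 := exec_rights (I := I) (hI (Y.tapes L T ((prog m).stepSnap σ))
      fun t c h => .inr (Layout.tapes_kept _ h)) 0 12
    rw [zero_add] at h1 h3
    exact hκ.whl_iter (hI _ fun t c h => .inl (Layout.tapes_kept σ h))
      (by simp [isOne, Layout.tapes_run hL, hσ]) (h1.seq (h2.seq h3))
  limit A X δ hδ hX hX1 := by
    obtain ⟨γ, s, hγ⟩ := host_limit hE hlim (by omega) hF Y
      (fun I T hC hT => hS I T m hC hT) hδ hX hX1
    obtain ⟨γ', s', hγ'⟩ := Machine.Run.stays (hready A _ rfl) hγ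
    have := s.trans s'
    exact ⟨γ', this.le, hγ', this.stays⟩

end simulation

/-- The tapes with the marker and the flag on the scratch tape. -/
def flagged (x z : R) : Tapes := ![x, fun c => decide (c < 2), z]

/-- The contents of the tracks that store the first two numbers. -/
def tracks (k q : ℕ) : ℕ → ℕ := fun r => if r = 6 then k else if r = 7 then q else 0

theorem ctx_flagged {lo L : ℕ} (h0 : 0 < lo) (h1 : lo < L) (x z : R) :
    Ctx (fun _ => True) lo L (flagged x z) := by
  refine ⟨h0, h1, fun n => ?_, fun _ => trivial⟩
  simp only [flagged, Matrix.cons_val]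
  congr 1
  rcases n with - | n
  · simp
  · have : L ≤ L * (n + 1) := Nat.le_mul_of_pos_right _ (by omega)
    simp; nlinarith

theorem put_eq_put {lo lo' L : ℕ} {T : Tapes} {v : ℕ → ℕ} (h : lo ≤ lo')
    (hL : 0 < L) (hv : ∀ r, lo' ≤ r → r < L → v r = 0) :
    put lo L T v = put lo' L (put lo L T v) fun _ => 0 := by
  funext t c
  unfold put
  by_cases h1 : t = 1 ∧ lo' ≤ c % L
  · rw [if_pos h1, if_pos ⟨h1.1, h.trans h1.2⟩, hv _ h1.2 (Nat.mod_lt _ hL)]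
  · rw [if_neg h1]

theorem exists_count : ∃ C, ∀ L ≥ C, ∃ P, ∀ x n,
    Exec (fun _ => True) P (0, put 6 L (flagged x (natR n)) (Regs.val { len := L }))
      (0, put 6 L (flagged x zeroR) (Regs.val { len := L, head := n })) := by
  obtain ⟨C₁, hC₁⟩ := exists_read (show 0 < 8 by omega)
  obtain ⟨C₂, hC₂⟩ := exists_write (show 0 < 8 by omega)
  refine ⟨24 + C₁ + C₂, fun L hL => ?_⟩
  obtain ⟨P₁, h₁⟩ := hC₁ L (by omega) 6 (by omega) 2 13 (by simp) (by omega) (by omega)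
  obtain ⟨P₂, h₂⟩ := hC₂ L (by omega) 6 (by omega) 2 false (by simp)
  refine ⟨P₁ ;; whileReg 13 (dec L 13 ;; P₂ ;; inc L 11 ;; P₁), fun x n => ?_⟩
  set T : ℕ → Tapes := fun k => flagged x fun c => decide (k ≤ c ∧ c < n) with hT
  have hC (k) : Ctx (fun _ => True) 6 L (T k) := ctx_flagged (by omega) (by omega) _ _
  have hb (k) : T k 2 (addr L 0 k) = decide (k < n) := by simp [hT, flagged, addr]
  have hw (k) : writeCell (T k) 2 (addr L 0 k) false = T (k + 1) := by
    funext t c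
    fin_cases t <;> simp [hT, flagged, addr, writeCell]
    · grind
  have e₁ (k) := h₁ _ (T k) (Regs.val { len := L, head := k }) (hC k) (Regs.ready _ rfl)
  have e₂ (k) := does_dec (L := L) (v := Regs.val { len := L, head := k, b₀ := 1 })
    (show 6 ≤ 13 by omega) (by omega) (by simp) _ (T k) (hC k)
  have e₃ (k) := h₂ _ (T k) (Regs.val { len := L, head := k }) (hC k)
    (by rw [Regs.val_head, hw]; exact hC _) (Regs.ready _ rfl)
  have e₄ (k) := does_inc (L := L) (v := Regs.val { len := L, head := k })
    (show 6 ≤ 11 by omega) (by omega) _ (T (k + 1)) (hC _)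
  simp only [Regs.update_b₀, Regs.val_b₀, Regs.update_head, Regs.val_head, hb, hw, zero_add,
    Nat.sub_self] at e₁ e₂ e₃ e₄
  have hl := exec_whileReg (I := fun _ => True) (L := L) (lo := 6) (r := 13)
    (P := dec L 13 ;; P₂ ;; inc L 11 ;; P₁) (by omega) (by omega) n T
    (fun k => Regs.val { len := L, head := k, b₀ := (decide (k < n)).toNat })
    (fun k _ => hC k) (fun k hk => by simp [hk]) (by simp) fun k hk => by
      rw [decide_eq_true hk]
      exact (e₂ k).seq ((e₃ k).seq ((e₄ k).seq (e₁ (k + 1))))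
  have h0 : T 0 = flagged x (natR n) := by
    simp only [hT]; congr; funext c; simp [natR]
  have hn : T n = flagged x zeroR := by
    simp only [hT]; congr; funext c; simp [zeroR]
  have := (e₁ 0).seq hl
  simp only [h0, hn, lt_irrefl, decide_false, Bool.toNat_false] at this
  exact this

theorem exists_init {g : ℕ → ℕ} (hg : Primrec fun v : List.Vector ℕ 1 => g (v.get 0)) (q : ℕ) :
    ∃ C, ∀ L ≥ C, ∃ P, ∀ x n,
    Exec (fun _ => True) P (0, ![x, fun _ => false, natR n])
      (0, put 8 L (put 6 L (flagged x zeroR) (tracks (g n) q))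
        (simRegs L q (startOf q) 0).val) := by
  obtain ⟨C₁, hC₁⟩ := exists_count
  obtain ⟨C₂, hC₂⟩ := exists_compute hg
  obtain ⟨C₃, hC₃⟩ := exists_boot primrec_start
  refine ⟨24 + C₁ + C₂ + C₃, fun L hL => ?_⟩
  obtain ⟨P₁, h₁⟩ := hC₁ L (by omega)
  obtain ⟨P₂, h₂⟩ := hC₂ L (by omega) 6 ![11] 6
    (by intro i; fin_cases i; simp) (by omega) (by omega)
  obtain ⟨P₃, h₃⟩ := hC₃ L (by omega)
  obtain ⟨P₄, h₄⟩ := does_zeros (lo := 6) (L := L) (b := 8) (by omega) (L - 8) (by omega)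
  refine ⟨act (setBit 1 true) true ;; act (setBit 1 true) false ;; rep (inc L 8) L ;; P₁ ;; P₂ ;;
    rep (inc L 7) q ;; P₄ ;; P₃, fun x n => ?_⟩
  have hC (z : R) : Ctx (fun _ => True) 6 L (flagged x z) :=
    ctx_flagged (by omega) (by omega) _ _
  have a₁ := exec_act (I := fun _ => True) (setBit 1 true) true 0 ![x, fun _ => false, natR n] trivial
  have a₂ := exec_act (I := fun _ => True) (setBit 1 true) false 1
    (writeAt ![x, fun _ => false, natR n] 0 (setBit 1 true fun i => ![x, fun _ => false, natR n] i 0))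
    trivial
  have hput : put 6 L (flagged x (natR n)) (fun _ => 0) = flagged x (natR n) := by
    funext t c
    unfold put
    split_ifs with h
    · obtain ⟨rfl, h⟩ := h
      have := Nat.mod_le c L
      simp [flagged]
      omega
    · rfl
  have hw : writeAt (writeAt ![x, fun _ => false, natR n] 0
      (setBit 1 true fun i => ![x, fun _ => false, natR n] i 0)) 1 (setBit 1 true fun i =>
      writeAt ![x, fun _ => false, natR n] 0
      (setBit 1 true fun i => ![x, fun _ => false, natR n] i 0) i 1) = 
      put 6 L (flagged x (natR n)) (Regs.val {}) := by
    rw [Regs.val_default, hput, writeAt_setBit, writeAt_setBit]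
    funext t c
    fin_cases t <;> simp [flagged]
    grind
  rw [hw] at a₂
  have a₃ := does_incs (v := Regs.val {}) (show 6 ≤ 8 by omega) (show 8 < L by omega) L _ _
    (hC (natR n))
  rw [Regs.update_len, Regs.val_len, zero_add] at a₃
  have h6 (R : Regs) : R.val 6 = 0 := by unfold Regs.val; simp
  have h7 (R : Regs) : R.val 7 = 0 := by unfold Regs.val; simp
  have a₄ := h₂ (Regs.val { len := L, head := n }) (h6 _) (fun _ => Regs.high _) _ _ (hC zeroR)
  simp only [List.Vector.get_ofFn, Matrix.cons_val, Regs.val_head] at a₄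
  have a₅ := does_incs (v := update (Regs.val { len := L, head := n }) 6 (g n))
    (show 6 ≤ 7 by omega) (show 7 < L by omega) q _ _ (hC zeroR)
  rw [Function.update_of_ne (by omega), h7, zero_add] at a₅
  have a₆ := h₄ (update (update (Regs.val { len := L, head := n }) 6 (g n)) 7 q) _ _ (hC zeroR)
  have htr : put 6 L (flagged x zeroR) (fun r => if 8 ≤ r ∧ r < 8 + (L - 8) then 0 else
      update (update (Regs.val { len := L, head := n }) 6 (g n)) 7 q r) =
      put 8 L (put 6 L (flagged x zeroR) (tracks (g n) q)) fun _ => 0 := by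
    rw [← put_eq_put (by omega) (by omega) fun r h _ => by
      rw [tracks, if_neg (by omega), if_neg (by omega)]]
    funext t c
    unfold put
    split_ifs with h
    · have := Nat.mod_lt c (show 0 < L by omega)
      congr 2
      beta_reduce
      by_cases h8 : 8 ≤ c % L
      · rw [if_pos (by omega), tracks, if_neg (by omega), if_neg (by omega)]
      · obtain h' | h' : c % L = 6 ∨ c % L = 7 := by omega
        all_goals simp [h', tracks]
    · rfl
  rw [htr] at a₆
  have a₇ := h₃ (fun _ => True) (put 6 L (flagged x zeroR) (tracks (g n) q)) q
    ⟨by omega, by omega, fun k => by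
      rw [← add_zero (L * k), put_low (by omega) (by omega)]; exact (hC zeroR).mark k,
      fun _ => trivial⟩
    fun k => by rw [put_reg (by omega) (by omega)]; simp [tracks]
  exact a₁.seq (a₂.seq (a₃.seq ((h₁ x n).seq (a₄.seq (a₅.seq (a₆.seq a₇))))))

/-- The tapes for the second simulation, of program `m`. -/
def secondBase (L : ℕ) (T : Tapes) (m : ℕ) : Tapes :=
  put 7 L (writeCell T 1 2 true) fun r => if r = 7 then m else 0

theorem put_seven {L q : ℕ} {T : Tapes} {v : ℕ → ℕ} (hT : ∀ n, T 1 (L * n + 7) = decide (n < q)) :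
    put 8 L T v = put 7 L T (update v 7 q) := by
  funext t c
  unfold put
  by_cases h : t = 1 ∧ 8 ≤ c % L
  · rw [if_pos h, if_pos ⟨h.1, by omega⟩, Function.update_of_ne (by omega)]
  · rw [if_neg h]
    split_ifs with h'
    · obtain ⟨rfl, h'⟩ := h'
      have h7 : c % L = 7 := by omega
      rw [h7, Function.update_self, ← hT, ← h7, Nat.div_add_mod]
    · rfl

theorem exists_mid : ∃ C, ∀ L ≥ C, ∃ N, ∀ T q m v, Frame L q T →
    (∀ n, T 1 (L * n + 4) = decide (n < m)) →
    Exec (fun _ => True) N (0, put 8 L T v)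
      (0, put 8 L (secondBase L T m) (simRegs L m (startOf m) 0).val) := by
  obtain ⟨C, hC⟩ := exists_boot primrec_start
  refine ⟨24 + C, fun L hL => ?_⟩
  obtain ⟨P₁, h₁⟩ := hC L (by omega)
  obtain ⟨P₂, h₂⟩ := does_zeros (lo := 7) (L := L) (b := 7) (by omega) (L - 7) (by omega)
  refine ⟨rep right 2 ;; act (setBit 1 true) true ;; rep left 3 ;; P₂ ;; copy L 4 7 ;; P₁,
    fun T q m v hF hm => ?_⟩
  have hm2 : 2 % L = 2 := Nat.mod_eq_of_lt (by omega)
  have h2 (r n : ℕ) (h0 : r ≠ 2) (hr : r < L) : writeCell T 1 2 true 1 (L * n + r) = T 1 (L * n + r) := by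
    rw [writeCell, if_neg]
    rintro ⟨-, h⟩
    have := congrArg (· % L) h
    simp only [Nat.mul_add_mod, hm2, Nat.mod_eq_of_lt hr] at this
    exact h0 this
  have hX : Ctx (fun _ => True) 7 L (writeCell T 1 2 true) :=
    ⟨by omega, by omega, fun n => by
      have := h2 0 n (by omega) (by omega)
      rw [add_zero] at this
      rw [this, hF.mark], fun _ => trivial⟩
  have a₁ := exec_rights (I := fun _ => True) (T := put 8 L T v) trivial 0 2
  have a₂ := exec_act (I := fun _ => True) (setBit 1 true) true 2 (put 8 L T v) trivial
  have hw : writeAt (put 8 L T v) 2 (setBit 1 true fun i => put 8 L T v i 2) =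
      put 7 L (writeCell T 1 2 true) (update v 7 q) := by
    rw [writeAt_setBit, ← put_seven fun n => by rw [h2 7 n (by omega) (by omega), hF.code]]
    funext t c
    by_cases h : t = 1 ∧ c = 2
    · obtain ⟨rfl, rfl⟩ := h
      simp [put, hm2, writeCell]
    · rw [if_neg h, put, put, writeCell, if_neg h]
  rw [hw] at a₂
  have a₃ := exec_lefts (I := fun _ => True)
    (T := put 7 L (writeCell T 1 2 true) (update v 7 q)) trivial 0 3
  have a₄ := h₂ (update v 7 q) _ _ hX
  have hz : put 7 L (writeCell T 1 2 true) (fun r => if 7 ≤ r ∧ r < 7 + (L - 7) then 0 else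
      update v 7 q r) = put 7 L (writeCell T 1 2 true) fun _ => 0 := by
    funext t c
    unfold put
    split_ifs with h
    · have := Nat.mod_lt c (show 0 < L by omega)
      beta_reduce
      rw [if_pos (by omega)]
    · rfl
  rw [hz] at a₄
  have a₅ := exec_copy (v := fun _ => 0) (s := 4) (d := 7) (k := m) hX (by omega) (by omega) rfl
    fun j n => by rw [put_low (by omega) (by omega), h2 4 n (by omega) (by omega), hm]
  have hs : put 7 L (writeCell T 1 2 true) (update (fun _ => 0) 7 m) =
      put 8 L (secondBase L T m) fun _ => 0 := by
    rw [secondBase, ← put_eq_put (by omega) (by omega) fun r h _ => by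
      rw [if_neg (by omega)]]
    congr 1
    funext r
    simp [Function.update_apply]
  rw [hs] at a₅
  have a₆ := h₁ (fun _ => True) (secondBase L T m) m
    ⟨by omega, by omega, fun k => by
      rw [secondBase, ← add_zero (L * k), put_low (by omega) (by omega)]; exact hX.mark k,
      fun _ => trivial⟩
    fun k => by rw [secondBase, put_reg (by omega) (by omega)]; simp
  exact a₁.seq (a₂.seq (a₃.seq (a₄.seq (a₅.seq a₆))))

theorem Layout.enc_eq {Y : Layout} {L : ℕ} {T A : Tapes}
    (h : ∀ i n, T (Y.tape i) (addr L (Y.mode i) n) = A i n) : Y.enc L T A = T := by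
  funext t c
  by_cases hc : ∃ p, Y.cell L p = (t, c)
  · rw [enc, Function.extend, dif_pos hc, ← h]
    obtain ⟨h1, h2⟩ := Prod.mk.inj hc.choose_spec
    rw [h1, h2]
  · rw [enc, Function.extend_apply' _ _ _ hc]

/-- The layout of the first simulation: all tapes are stored on tracks of the scratch tape. -/
def firstLayout : Layout where
  tape _ := 1
  mode := ![6, 3, 4]
  mode_lt := by decide
  low := by decide
  inj := by decide

/-- The layout of the second simulation: input and output tape are simulated by themselves, and the
scratch tape is stored on a track of the scratch tape. -/
def secondLayout : Layout where
  tape i := i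
  mode := ![0, 5, 0]
  mode_lt := by decide
  low := by decide
  inj := by decide

/-- The tapes for the first simulation, of program `q` on input `k`. -/
def firstBase (L : ℕ) (x : R) (k q : ℕ) : Tapes := put 6 L (flagged x zeroR) (tracks k q)

theorem firstBase_low {L : ℕ} (hL : 6 < L) (x : R) (k q n r : ℕ) (hr : r < 6) :
    firstBase L x k q 1 (L * n + r) = decide (L * n + r < 2) := by
  rw [firstBase, put_low (by omega) (by omega)]
  simp [flagged]

theorem frame_firstBase {L : ℕ} (hL : 8 < L) (x : R) (k q : ℕ) : Frame L q (firstBase L x k q) where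
  mark n := by
    have := (ctx_flagged (lo := 6) (L := L) (by omega) (by omega) x zeroR).mark n
    rw [← add_zero (L * n), firstBase, put_low (by omega) (by omega)]
    exact this
  flag := by
    have := firstBase_low (L := L) (by omega) x k q 0 1 (by omega)
    simpa using this
  code n := by rw [firstBase, put_reg (by omega) (by omega)]; simp [tracks]

theorem enc_firstBase {L : ℕ} (hL : 8 < L) (x : R) (k q : ℕ) :
    firstLayout.enc L (firstBase L x k q) ((prog q).init (natR k)).tape = firstBase L x k q := by
  refine Layout.enc_eq fun i n => ?_
  have h1 (r : ℕ) (h2 : 2 ≤ r) (hr : r < 6) := firstBase_low (L := L) (by omega) x k q n r hr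
  fin_cases i
  · simp [firstLayout, addr, Machine.init, firstBase, put_reg (L := L) (lo := 6) (r := 6) le_rfl
      (by omega), tracks, natR]
  · have := h1 3 (by omega) (by omega)
    simpa [firstLayout, addr, Machine.init] using this
  · have := h1 4 (by omega) (by omega)
    simpa [firstLayout, addr, Machine.init] using this

section secondBase

variable {L q m k : ℕ} {x : R} {A : Tapes} (hL : 8 < L)
include hL

theorem secondBase_low {T : Tapes} {r : ℕ} (hr : r < 7) (h2 : r ≠ 2) (n : ℕ) :
    secondBase L T m 1 (L * n + r) = T 1 (L * n + r) := by
  have hm2 : 2 % L = 2 := Nat.mod_eq_of_lt (by omega)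
  rw [secondBase, put_low (by omega) (by omega), writeCell, if_neg]
  rintro ⟨-, h⟩
  have := congrArg (· % L) h
  simp only [Nat.mul_add_mod, hm2, Nat.mod_eq_of_lt (show r < L by omega)] at this
  exact h2 this

theorem frame_secondBase {T : Tapes} (hF : Frame L q T) : Frame L m (secondBase L T m) where
  mark n := by
    have := secondBase_low (m := m) (T := T) hL (r := 0) (by omega) (by omega) n
    rw [add_zero] at this
    rw [this, hF.mark]
  flag := by
    have := secondBase_low (m := m) (T := T) hL (r := 1) (by omega) (by omega) 0
    rw [mul_zero, zero_add] at this
    rw [this, hF.flag]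
  code n := by rw [secondBase, put_reg (by omega) (by omega)]; simp

theorem enc_secondBase :
    secondLayout.enc L (secondBase L (firstLayout.enc L (firstBase L x k q) A) m)
      ((prog m).init x).tape = secondBase L (firstLayout.enc L (firstBase L x k q) A) m := by
  have henc (t : Fin 3) (ht : t ≠ 1) (c : ℕ) :
      firstLayout.enc L (firstBase L x k q) A t c = flagged x zeroR t c := by
    rw [← put_ne (lo := 6) (L := L) (T := flagged x zeroR) (v := tracks k q) ht]
    refine Function.extend_apply' _ _ _ ?_
    rintro ⟨p, hp⟩
    exact ht (Prod.mk.inj hp).1.symm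
  refine Layout.enc_eq fun i n => ?_
  fin_cases i
  · simp [secondLayout, addr, Machine.init, secondBase, put, writeCell, henc, flagged]
  · have h1 := secondBase_low (m := m) (T := firstLayout.enc L (firstBase L x k q) A) hL
      (r := 5) (by omega) (by omega) n
    have h2 : firstLayout.enc L (firstBase L x k q) A 1 (L * n + 5) =
        firstBase L x k q 1 (L * n + 5) := by
      refine Function.extend_apply' _ _ _ ?_
      rintro ⟨⟨i, h⟩, hp⟩
      have := congrArg (· % L) (Prod.mk.inj hp).2
      fin_cases i <;> simp [firstLayout, addr,
        Nat.mod_eq_of_lt (show 5 < L by omega), Nat.mod_eq_of_lt (show 6 < L by omega),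
        Nat.mod_eq_of_lt (show 3 < L by omega), Nat.mod_eq_of_lt (show 4 < L by omega)] at this
    have h3 := firstBase_low (L := L) (by omega) x k q n 5 (by omega)
    simpa [secondLayout, addr, Machine.init, h1, h2] using h3
  · simp [secondLayout, addr, Machine.init, secondBase, put, writeCell, henc, flagged,
      zeroR]

end secondBase

theorem Machine.halts_iff_outputs {M : Machine} {x : R} : M.halts x ↔ ∃ z, M.outputs x z := by
  constructor
  · intro h
    refine ⟨_, sInf {α | M.haltedAt x α}, ⟨csInf_mem (s := {α | M.haltedAt x α}) h,
      fun β hβ => notMem_of_lt_csInf' (s := {α | M.haltedAt x α}) hβ⟩, rfl⟩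
  · rintro ⟨z, α, h, -⟩
    exact ⟨α, h.1⟩

theorem Machine.outputs_unique {M : Machine} {x z z' : R} (h : M.outputs x z) (h' : M.outputs x z') :
    z = z' := by
  obtain ⟨α, ⟨h1, h2⟩, rfl⟩ := h
  obtain ⟨β, ⟨h3, h4⟩, rfl⟩ := h'
  obtain h | rfl | h := lt_trichotomy α β
  · exact absurd h1 (h4 _ h)
  · rfl
  · exact absurd h3 (h2 _ h)

/-- The machine `U` on input `y` computes the same as `N` on input `x`. -/
def Machine.Agree (U N : Machine) (y x : R) : Prop :=
  (U.halts y ↔ N.halts x) ∧ ∀ z, U.outputs y z ↔ N.outputs x z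

theorem Machine.agree_of {U N : Machine} {y x : R} (h1 : ∀ z, N.outputs x z → U.outputs y z)
    (h2 : U.halts y → N.halts x) : U.Agree N y x := by
  refine ⟨⟨h2, fun h => ?_⟩, fun z => ⟨fun h => ?_, h1 z⟩⟩
  · obtain ⟨z, hz⟩ := halts_iff_outputs.1 h
    exact halts_iff_outputs.2 ⟨z, h1 z hz⟩
  · obtain ⟨z', hz⟩ := halts_iff_outputs.1 (h2 (halts_iff_outputs.2 ⟨z, h⟩))
    rwa [outputs_unique h (h1 z' hz)]

section host

variable {U : Machine} {x y : R} {L m k q : ℕ} {Bq Bm S P N : Frag}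
  {ι : (host L Bq Bm S P N).σ → Fin (U.Q + 1)}

theorem host_loops {e : Fin (U.Q + 1)} (hE : Emb U (host L Bq Bm S P N) ι e) :
    ∃ κ₁ d₁ κ₂ d₂, Emb U (simLoop Bq) κ₁ d₁ ∧ Emb U (simLoop Bm) κ₂ d₂ ∧
      ∀ (I : Tapes → Prop) (X : Tapes), I X →
        (X 1 2 = false → U.Run I ⟨ι (hostReady L Bq Bm S P N), 0, X⟩ ⟨κ₁ (simLoop Bq).entry, 12, X⟩) ∧
        (X 1 2 = true → U.Run I ⟨ι (hostReady L Bq Bm S P N), 0, X⟩ ⟨κ₂ (simLoop Bm).entry, 12, X⟩) ∧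
        (∀ X', I X' → Exec I N (0, X) (0, X') →
          U.Run I ⟨d₁, 12, X⟩ ⟨κ₂ (simLoop Bm).entry, 12, X'⟩) ∧
        U.Run I ⟨d₂, 12, X⟩ ⟨e, 0, X⟩ := by
  have eR := hE.seq_right.seq_left
  have eI := hE.seq_right.seq_right.seq_left
  have eQ := eI.ite_else.seq_right.seq_left
  have eM := hE.seq_right.seq_right.seq_right
  refine ⟨_, _, _, _, eQ.seq_right.seq_left, eM.seq_right.seq_left, fun I X hI =>
    ⟨fun h2 => ?_, fun h2 => ?_, fun X' hI' hN => ?_, ?_⟩⟩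
  · exact (((exec_rights hI 0 2 _ _ _ eR).trans (eI.ite_run_neg hI h2)).trans
      (exec_lefts hI 0 2 _ _ _ eI.ite_else.seq_left)).trans (exec_rights hI 0 12 _ _ _ eQ.seq_left)
  · exact (((exec_rights hI 0 2 _ _ _ eR).trans (eI.ite_run_pos hI h2)).trans
      (exec_lefts hI 0 2 _ _ _ eI.ite_then)).trans (exec_rights hI 0 12 _ _ _ eM.seq_left)
  · exact ((exec_lefts hI 0 12 _ _ _ eQ.seq_right.seq_right).trans
      (hN _ _ _ eI.ite_else.seq_right.seq_right)).trans (exec_rights hI' 0 12 _ _ _ eM.seq_left)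
  · exact exec_lefts hI 0 12 _ _ _ eM.seq_right.seq_right

theorem host_agree (hE : Emb U (host L Bq Bm S P N) ι U.halt)
    (hlim : U.limit = ι (host L Bq Bm S P N).entry) (hL : 24 ≤ L)
    (hS : Boots limitOf L S) (hBq : Steps firstLayout L Bq) (hBm : Steps secondLayout L Bm)
    {X : Tapes} (hX : X 1 0 = false)
    (hP : Exec (fun _ => True) P (0, X)
      (0, put 8 L (firstBase L x k q) (simRegs L q (startOf q) 0).val))
    (hN : ∀ T q m v, Frame L q T → (∀ n, T 1 (L * n + 4) = decide (n < m)) →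
      Exec (fun _ => True) N (0, put 8 L T v)
        (0, put 8 L (secondBase L T m) (simRegs L m (startOf m) 0).val))
    {δ : Ordinal.{0}} (hδ : U.Stays y (fun _ => True) 0 δ) (hδX : U.snap y δ = ⟨U.limit, 0, X⟩)
    (hq : (prog q).outputs (natR k) (natR m)) : U.Agree (prog m) y x := by
  have hm2 : 2 % L = 2 := Nat.mod_eq_of_lt (by omega)
  obtain ⟨κ₁, d₁, κ₂, d₂, hκ₁, hκ₂, hrun⟩ := host_loops hE
  -- the first simulation
  set T := firstBase L x k q with hT
  have hF : Frame L q T := frame_firstBase (by omega) x k q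
  have hT2 : T 1 2 = false := by
    have := firstBase_low (L := L) (by omega) x k q 0 2 (by omega)
    simpa using this
  have hr₁ (σ : Snapshot (prog q).Q) : firstLayout.tapes L T σ 1 2 = false := by
    rw [Layout.tapes_kept σ (by omega), Layout.enc_low (by omega) _ _ (.inl (by omega)), hT2]
  have hi₁ : put 8 L T (simRegs L q (startOf q) 0).val =
      firstLayout.tapes L T ((prog q).init (natR k)) := by
    rw [Layout.tapes, enc_firstBase (by omega)]; rfl
  rw [hi₁] at hP
  obtain ⟨δ₁, s₁, hδ₁⟩ := Machine.Run.stays (((hlim ▸ hE.seq_left.ite_run_neg (h := 0) trivial hX :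
    U.Run (fun _ => True) ⟨U.limit, 0, X⟩ _).trans (hP _ _ _ hE.seq_left.ite_else)).trans
    ((hrun _ _ trivial).1 (hr₁ _))) hδX
  have sim₁ := host_simulation hE hlim (by omega) hF hS hBq hκ₁
    (fun A σ hσ => (hrun _ _ (by subst hσ; exact fun t c h => Layout.tapes_kept σ h.1)).1 (hr₁ _)) hδ₁
  obtain ⟨α, ⟨hα, hα'⟩, hout⟩ := hq
  change ((prog q).snap (natR k) α).state = _ at hα
  obtain ⟨δ₂, -, hle₂, hδ₂, hnon₂⟩ := sim₁.exists_stage hα'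
  have s₂ : U.Stays y (fun _ => True) δ₁ δ₂ := ⟨hle₂, fun ξ h1 h2 => ⟨hnon₂ ξ h1 h2, trivial⟩⟩
  set σ := (prog q).snap (natR k) α with hσ
  -- the second simulation
  set T' := secondBase L (firstLayout.enc L T σ.tape) m with hT'
  have hF₁ : Frame L q (firstLayout.enc L T σ.tape) := by
    refine ⟨fun n => ?_, ?_, fun n => ?_⟩
    · rw [Layout.enc_low (by omega) _ _ (.inl (by simp)), hF.mark]
    · rw [Layout.enc_low (by omega) _ _ (.inl (by rw [Nat.mod_eq_of_lt (by omega)]; omega)), hF.flag]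
    · rw [Layout.enc_low (by omega) _ _ (.inr (by simp [Nat.mod_eq_of_lt (show 7 < L by omega)])),
        hF.code]
  have hF' : Frame L m T' := frame_secondBase (by omega) hF₁
  have hi₂ : put 8 L T' (simRegs L m (startOf m) 0).val =
      secondLayout.tapes L T' ((prog m).init x) := by
    rw [Layout.tapes, hT', enc_secondBase (by omega)]; rfl
  have hN' := hN (firstLayout.enc L T σ.tape) q m (simRegs L q σ.state σ.head).val hF₁ fun n => by
    have := Layout.enc_cell (Y := firstLayout) (L := L) (by omega) T σ.tape 2 n
    rw [hout] at this
    simpa [firstLayout, addr, natR] using this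
  rw [hi₂] at hN'
  obtain ⟨δ₃, s₃, hδ₃⟩ := Machine.Run.stays ((hκ₁.whl_exit (I := fun _ => True) trivial
    ((Layout.tapes_run (by omega) _).trans (by simpa using hα))).trans
    ((hrun _ _ trivial).2.2.1 _ trivial hN')) hδ₂
  have hT2' : T' 1 2 = true := by simp [hT', secondBase, put, hm2, writeCell]
  have hr₂ (σ : Snapshot (prog m).Q) : secondLayout.tapes L T' σ 1 2 = true := by
    rw [Layout.tapes_kept σ (by omega), Layout.enc_low (by omega) _ _ (.inl (by omega)), hT2']
  have sim₂ := host_simulation hE hlim (by omega) hF' hS hBm hκ₂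
    (fun A σ hσ => (hrun _ _ (by subst hσ; exact fun t c h => Layout.tapes_kept σ h.1)).2.1 (hr₂ _))
    hδ₃
  have s := ((hδ.trans s₁).trans s₂).trans s₃
  refine Machine.agree_of ?_ fun ⟨β, hβ⟩ => ?_
  · rintro z ⟨α, ⟨hα, hα'⟩, rfl⟩
    change ((prog m).snap x α).state = _ at hα
    obtain ⟨δ₄, -, hle₄, hδ₄, hnon₄⟩ := sim₂.exists_stage hα'
    have s₄ : U.Stays y (fun _ => True) δ₃ δ₄ := ⟨hle₄, fun ξ h1 h2 => ⟨hnon₄ ξ h1 h2, trivial⟩⟩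
    obtain ⟨δ₅, s₅, hδ₅⟩ := Machine.Run.stays ((hκ₂.whl_exit (I := fun _ => True) trivial
      ((Layout.tapes_run (by omega) _).trans (by simpa using hα))).trans
      (hrun _ _ trivial).2.2.2) hδ₄
    refine ⟨δ₅, ⟨by rw [Machine.haltedAt, hδ₅], fun β hβ =>
      (((s.trans s₄).trans s₅).stays β (zero_le) hβ).1⟩, ?_⟩
    rw [hδ₅]
    funext n
    have := Layout.enc_cell (Y := secondLayout) (L := L) (by omega) T' ((prog m).snap x α).tape 2 n
    simpa [Layout.tapes, put, secondLayout, addr] using this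
  · by_contra h
    obtain ⟨δ₄, hge, -, -, hnon⟩ := sim₂.exists_stage (α := β + 1) fun α _ hα => h ⟨α, hα⟩
    rcases lt_or_ge β δ₃ with hlt | hge'
    · exact (s.stays β (zero_le) hlt).1 hβ
    · exact hnon β hge' ((Order.lt_succ β).trans_le hge) hβ

end host

/-- A machine that starts, and continues at limit stages, at the entry of `F` and halts on leaving
`F`. -/
noncomputable def Frag.machine (F : Frag) : Machine :=
  letI := F.fin
  { Q := Fintype.card F.σ
    start := 0
    limit := (Fintype.equivFin F.σ F.entry).castSucc
    halt := Fin.last _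
    trans := fun p => Fin.lastCases (motive := fun _ => _) (Fin.last _, p.2, true) (fun i =>
      let t := F.tr ((Fintype.equivFin F.σ).symm i) p.2
      (t.1.elim (Fin.last _) fun s => (Fintype.equivFin F.σ s).castSucc, t.2)) p.1 }

theorem Frag.exists_emb (F : Frag) :
    ∃ ι, Emb F.machine F ι F.machine.halt ∧ F.machine.limit = ι F.entry := by
  let _ := F.fin
  refine ⟨fun s => (Fintype.equivFin F.σ s).castSucc, fun s b => ⟨?_, ?_⟩, rfl⟩
  · exact (Fin.castSucc_lt_last _).ne
  · simp only [machine, Fin.lastCases_castSucc, Equiv.symm_apply_apply]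

theorem Emb.prefixed {M : Machine} {F : Frag} {ι : F.σ → Fin (M.Q + 1)} (hE : Emb M F ι M.halt)
    (n : ℕ) : Emb (M.prefixed n) F (fun s => M.shift n (ι s)) (M.prefixed n).halt := by
  intro s b
  obtain ⟨h1, h2⟩ := hE s b
  refine ⟨fun h => h1 ?_, ?_⟩
  · have := congrArg Fin.val h
    simp only [Machine.shift, Machine.prefixed] at this
    exact Fin.ext (by omega)
  · have e : (⟨(M.shift n (ι s) : ℕ) - (n + 1), by simp only [Machine.shift]; omega⟩ : Fin (M.Q + 1)) =
        ι s := Fin.ext (by simp only [Machine.shift]; omega)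
    simp only [Machine.prefixed]
    rw [dif_neg (by simp only [Machine.shift]; omega), dif_neg (by simp [Machine.shift]; omega), e, h2]
    cases (F.tr s b).1 <;> rfl

theorem Machine.prefixed_stays (M : Machine) (n : ℕ) (x : R) :
    (M.prefixed n).Stays x (fun _ => True) 0 Ordinal.omega0 ∧
      (M.prefixed n).snap x Ordinal.omega0 =
        ⟨(M.prefixed n).limit, 0, ![x, fun _ => false, natR n]⟩ := by
  have hS (k : ℕ) : (M.prefixed n).snap x (0 + k) =
      ⟨⟨min k n, by simp only [prefixed]; omega⟩, k, ![x, fun _ => false, natR (min k n)]⟩ := by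
    rw [zero_add]
    induction k with
    | zero =>
      rw [Nat.cast_zero, snap_zero]
      simp only [init, prefixed, Nat.zero_min]
      congr 1
      funext i c
      fin_cases i <;> simp [natR]
    | succ k ih =>
      rw [Nat.cast_add, Nat.cast_one, snap_succ, ih]
      simp only [stepSnap]
      rcases lt_or_ge k n with h | h
      · have ht (b) : (M.prefixed n).trans (⟨min k n, by simp only [prefixed]; omega⟩, b) =
            (⟨k + 1, by simp only [prefixed]; omega⟩, setBit 2 true b, true) := by
          simp only [prefixed]
          rw [dif_pos (by omega)]
          simp [min_eq_left h.le]
        rw [ht]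
        simp only [min_eq_left h.le, min_eq_left (show k + 1 ≤ n by omega), if_true]
        congr 1
        funext i c
        fin_cases i <;> simp [setBit, natR]
        · rintro rfl; rfl
        · grind
      · have ht (b) : (M.prefixed n).trans (⟨min k n, by simp only [prefixed]; omega⟩, b) =
            (⟨n, by simp only [prefixed]; omega⟩, b, true) := by
          simp only [prefixed]
          rw [dif_neg (by omega), dif_pos (by omega)]
          simp [min_eq_right h]
        rw [ht]
        simp only [min_eq_right h, min_eq_right (show n ≤ k + 1 by omega), if_true]
        congr 1
        funext i c
        split_ifs with hc
        · rw [hc]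
        · rfl
  have hω := snap_add_omega (M := M.prefixed n) hS (X := ![x, fun _ => false, natR n]) fun i c =>
    ⟨n, fun k hk => by simp only [min_eq_right hk]⟩
  rw [zero_add] at hω
  refine ⟨⟨zero_le, fun ξ _ hξ => ⟨?_, trivial⟩⟩, hω⟩
  obtain ⟨k, rfl⟩ := Ordinal.lt_omega0.1 hξ
  rw [← zero_add (k : Ordinal), hS]
  intro h
  have := congrArg Fin.val h
  simp only [shift, prefixed] at this
  omega

end ITTM

/-- **The Recursion Theorem** for infinite time Turing machines: if
`f : ℕ → ℕ` is infinite time computable (some program, on the real coding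
`n`, halts with output the real coding `f n`), then there is a program `p`
with `φ_p = φ_{f(p)}`: on every input, `p` halts iff `f p` halts, and in that
case the outputs agree. -/
theorem recursion_theorem (f : ℕ → ℕ)
    (hf : ∃ q : ℕ, ∀ n : ℕ, (ITTM.prog q).outputs (ITTM.natR n) (ITTM.natR (f n))) :
    ∃ p : ℕ, ∀ x : ITTM.R,
      ((ITTM.prog p).halts x ↔ (ITTM.prog (f p)).halts x) ∧
      (∀ y : ITTM.R, (ITTM.prog p).outputs x y ↔ (ITTM.prog (f p)).outputs x y) := by
  open ITTM in
  obtain ⟨q, hq⟩ := hf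
  obtain ⟨C₁, h₁⟩ := exists_step firstLayout
  obtain ⟨C₂, h₂⟩ := exists_step secondLayout
  obtain ⟨C₃, h₃⟩ := exists_boot primrec_limit
  obtain ⟨C₄, h₄⟩ := exists_init primrec_diag q
  obtain ⟨C₅, h₅⟩ := exists_mid
  obtain ⟨L, hL⟩ : ∃ L, L = 24 + C₁ + C₂ + C₃ + C₄ + C₅ := ⟨_, rfl⟩
  obtain ⟨Bq, hBq⟩ := h₁ L (by omega)
  obtain ⟨Bm, hBm⟩ := h₂ L (by omega)
  obtain ⟨S, hS⟩ := h₃ L (by omega)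
  obtain ⟨P, hP⟩ := h₄ L (by omega)
  obtain ⟨N, hN⟩ := h₅ L (by omega)
  obtain ⟨ι, hE, hlim⟩ := (host L Bq Bm S P N).exists_emb
  set D := (host L Bq Bm S P N).machine
  set e := Encodable.encode D with he
  have hD : diag e = Encodable.encode (D.prefixed e) := by rw [diag, prog_encode]
  refine ⟨diag e, fun x => ?_⟩
  obtain ⟨hs, hω⟩ := D.prefixed_stays e x
  nth_rw 1 3 [hD]
  rw [prog_encode]
  exact host_agree (hE.prefixed e) (congrArg (D.shift e) hlim) (by omega) hS hBq hBm
    rfl (hP x e) hN hs hω (hq (diag e))
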